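/- Let d(q) denote the dimension of H_*(C_q(ℂ); F_p) as an F_p-vector space, where C_q(ℂ) is the unordered configuration space of q points in the plane. Then for every prime p and every natural number q, d(pq) = d(q) + d(q-1) + ... + d(1) + d(0). -/

import Mathlib

/-!
STATEMENT 1: Let `d(q)` be the total dimension of `H_*(C_q(ℂ); 𝔽_p)`.
Then for every prime `p` and every `q`, `d(pq) = d(q) + d(q-1) + ⋯ + d(1) + d(0)`.
-/

open CategoryTheory AlgebraicTopology
open scoped DirectSum

/-- The ordered configuration space of `n` points in `X`. -/
def OConf (n : ℕ) (X : Type*) [TopologicalSpace X] : Type _ :=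
  {f : Fin n → X // Function.Injective f}

instance (n : ℕ) (X : Type*) [TopologicalSpace X] : TopologicalSpace (OConf n X) :=
  instTopologicalSpaceSubtype

/-- Two ordered configurations are equivalent if they differ by a permutation. -/
def confSetoid (n : ℕ) (X : Type*) [TopologicalSpace X] : Setoid (OConf n X) where
  r f g := ∃ σ : Equiv.Perm (Fin n), f.1 = g.1 ∘ σ
  iseqv := by
    constructor
    · exact fun f => ⟨Equiv.refl _, rfl⟩
    · rintro f g ⟨σ, h⟩
      refine ⟨σ.symm, ?_⟩
      funext i
      simp [h]
    · rintro f g h ⟨σ, hσ⟩ ⟨τ, hτ⟩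
      exact ⟨σ.trans τ, by rw [hσ, hτ]; rfl⟩

/-- The unordered configuration space of `n` points in `X`, with the quotient topology. -/
def UConf (n : ℕ) (X : Type*) [TopologicalSpace X] : Type _ :=
  Quotient (confSetoid n X)

instance (n : ℕ) (X : Type*) [TopologicalSpace X] : TopologicalSpace (UConf n X) :=
  instTopologicalSpaceQuotient

/-- The singular chain complex of `X` with coefficients in `R`. -/
noncomputable def SingChains (R : Type) [CommRing R] (X : Type) [TopologicalSpace X] :
    ChainComplex (ModuleCat R) ℕ :=
  (alternatingFaceMapComplex (ModuleCat R)).obj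
    (((SimplicialObject.whiskering _ _).obj (ModuleCat.free R)).obj
      (TopCat.toSSet.obj (TopCat.of X)))

/-- Singular homology `H_k(X; R)`. -/
noncomputable def SHom (R : Type) [CommRing R] (X : Type) [TopologicalSpace X] (k : ℕ) :
    ModuleCat R :=
  (SingChains R X).homology k

/-- `d q` = total dimension of the mod `p` homology of `C_q(ℂ)`. -/
noncomputable def dDim (p q : ℕ) : ℕ :=
  Module.finrank (ZMod p) (⨁ (i : ℕ), SHom (ZMod p) (UConf q ℂ) i)

/-! ## Part 0: differential modules -/

section P0
set_option linter.unusedVariables false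
set_option linter.unusedSimpArgs false
variable {F : Type*} [Field F]
variable {M M' : Type*} [AddCommGroup M] [Module F M] [AddCommGroup M'] [Module F M']

/-- homology of a differential `d` on a submodule `P` -/
abbrev HH (d : M →ₗ[F] M) (P : Submodule F M) : Type _ :=
  ↥(P ⊓ LinearMap.ker d) ⧸ ((P.map d).comap (P ⊓ LinearMap.ker d).subtype)

theorem hh_equiv (d : M →ₗ[F] M) (P : Submodule F M) (d' : M' →ₗ[F] M') (P' : Submodule F M')
    (f : M →ₗ[F] M') (hf : ∀ x ∈ P, f x ∈ P') (hd : ∀ x ∈ P, f (d x) = d' (f x))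
    (hinj : ∀ x ∈ P, d x = 0 → ∀ y ∈ P', f x = d' y → ∃ x' ∈ P, x = d x')
    (hsurj : ∀ y ∈ P', d' y = 0 → ∃ x ∈ P, d x = 0 ∧ ∃ y' ∈ P', y = f x + d' y') :
    Nonempty (HH d P ≃ₗ[F] HH d' P') := by
  have hmem : ∀ x ∈ P ⊓ LinearMap.ker d, f x ∈ P' ⊓ LinearMap.ker d' := by
    rintro x ⟨hx, hx'⟩
    refine ⟨hf x hx, ?_⟩
    change d x = 0 at hx'
    change d' (f x) = 0
    rw [← hd x hx, hx', map_zero]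
  let g : ↥(P ⊓ LinearMap.ker d) →ₗ[F] HH d' P' :=
    (Submodule.mkQ _).comp (f.restrict hmem)
  have hker : LinearMap.ker g = (P.map d).comap (P ⊓ LinearMap.ker d).subtype := by
    ext ⟨x, hx⟩
    simp only [g, LinearMap.mem_ker, LinearMap.comp_apply, Submodule.mkQ_apply,
      Submodule.Quotient.mk_eq_zero, Submodule.mem_comap, Submodule.subtype_apply,
      LinearMap.coe_restrict_apply, Submodule.mem_map]
    constructor
    · rintro ⟨y, hy, hxy⟩
      obtain ⟨x', hx', h⟩ := hinj x hx.1 hx.2 y hy hxy.symm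
      exact ⟨x', hx', h.symm⟩
    · rintro ⟨y, hy, rfl⟩
      exact ⟨f y, hf y hy, (hd y hy).symm⟩
  have hsur : Function.Surjective g := by
    intro z
    obtain ⟨⟨y, hy⟩, rfl⟩ := Submodule.mkQ_surjective _ z
    obtain ⟨x, hx, hdx, y', hy', e⟩ := hsurj y hy.1 hy.2
    refine ⟨⟨x, hx, hdx⟩, ?_⟩
    simp only [g, LinearMap.comp_apply, Submodule.mkQ_apply]
    rw [Submodule.Quotient.eq]
    simp only [Submodule.mem_comap, Submodule.subtype_apply, Submodule.mem_map,
      AddSubgroupClass.coe_sub, LinearMap.coe_restrict_apply]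
    exact ⟨-y', neg_mem hy', by rw [e, map_neg]; abel⟩
  unfold HH
  rw [← hker]
  exact ⟨g.quotKerEquivOfSurjective hsur⟩

/-- acyclicity from a filtered contraction -/
theorem acyclic_aux {ι : Type*} {E : Type*} [AddCommGroup E] [Module F E] (e : ι → E) (ok : Set ι)
    (ρ : ι → ℕ) (D H : E →ₗ[F] E)
    (hD : ∀ i ∈ ok, D (e i) ∈ Submodule.span F (e '' ok))
    (hH : ∀ i ∈ ok, H (e i) ∈ Submodule.span F (e '' ok))
    (hDD : ∀ i ∈ ok, D (D (e i)) = 0)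
    (hN : ∀ i ∈ ok, e i - D (H (e i)) - H (D (e i)) ∈
      Submodule.span F (e '' {j | j ∈ ok ∧ ρ j < ρ i})) :
    ∀ x ∈ Submodule.span F (e '' ok), D x = 0 → ∃ y ∈ Submodule.span F (e '' ok), x = D y := by
  have hHP : ∀ x ∈ Submodule.span F (e '' ok), H x ∈ Submodule.span F (e '' ok) := by
    intro x hx
    have : Submodule.span F (e '' ok) ≤ (Submodule.span F (e '' ok)).comap H := by
      rw [Submodule.span_le]
      rintro _ ⟨i, hi, rfl⟩
      exact hH i hi
    exact this hx
  have hDD' : ∀ x ∈ Submodule.span F (e '' ok), D (D x) = 0 := by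
    intro x hx
    have : Submodule.span F (e '' ok) ≤ LinearMap.ker (D.comp D) := by
      rw [Submodule.span_le]
      rintro _ ⟨i, hi, rfl⟩
      exact hDD i hi
    exact this hx
  have key : ∀ n : ℕ, ∀ x ∈ Submodule.span F (e '' {j | j ∈ ok ∧ ρ j < n}), D x = 0 →
      ∃ y ∈ Submodule.span F (e '' ok), x = D y := by
    intro n
    induction n with
    | zero =>
      intro x hx _
      simp only [Nat.not_lt_zero, and_false, Set.ofPred_false, Set.image_empty,
        Submodule.span_empty, Submodule.mem_bot] at hx
      exact ⟨0, zero_mem _, by simp [hx]⟩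
    | succ n ih =>
      intro x hx hdx
      have h1 : x - D (H x) - H (D x) ∈ Submodule.span F (e '' {j | j ∈ ok ∧ ρ j < n}) := by
        have : Submodule.span F (e '' {j | j ∈ ok ∧ ρ j < n + 1}) ≤
            (Submodule.span F (e '' {j | j ∈ ok ∧ ρ j < n})).comap
              (LinearMap.id - D.comp H - H.comp D) := by
          rw [Submodule.span_le]
          rintro _ ⟨i, hi, rfl⟩
          refine Submodule.span_mono ?_ (hN i hi.1)
          apply Set.image_mono
          rintro j ⟨hj, hj'⟩
          exact ⟨hj, by have := hi.2; omega⟩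
        exact this hx
      have hxP : x ∈ Submodule.span F (e '' ok) :=
        Submodule.span_mono (Set.image_mono (fun j hj => hj.1)) hx
      rw [hdx, map_zero, sub_zero] at h1
      obtain ⟨y, hy, hxy⟩ := ih _ h1 (by rw [map_sub, hdx, hDD' _ (hHP x hxP), sub_zero])
      refine ⟨y + H x, add_mem hy (hHP x hxP), ?_⟩
      rw [map_add, ← hxy]; abel
  intro x hx hdx
  have : ∃ n, x ∈ Submodule.span F (e '' {j | j ∈ ok ∧ ρ j < n}) := by
    clear hdx
    induction hx using Submodule.span_induction with
    | mem x h =>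
      obtain ⟨i, hi, rfl⟩ := h
      exact ⟨ρ i + 1, Submodule.subset_span ⟨i, ⟨hi, by omega⟩, rfl⟩⟩
    | zero => exact ⟨0, zero_mem _⟩
    | add x y _ _ hx hy =>
      obtain ⟨n, hn⟩ := hx
      obtain ⟨m, hm⟩ := hy
      refine ⟨n + m, add_mem (Submodule.span_mono (Set.image_mono ?_) hn)
        (Submodule.span_mono (Set.image_mono ?_) hm)⟩
      · rintro j ⟨hj, hj'⟩
        exact ⟨hj, by omega⟩
      · rintro j ⟨hj, hj'⟩
        exact ⟨hj, by omega⟩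
    | smul a x _ hx =>
      obtain ⟨n, hn⟩ := hx
      exact ⟨n, Submodule.smul_mem _ _ hn⟩
  obtain ⟨n, hn⟩ := this
  exact key n x hn hdx

theorem span_image_le {ι E : Type*} [AddCommGroup E] [Module F E] (e : ι → E) (ok : Set ι)
    (Q : Submodule F E) (h : ∀ i ∈ ok, e i ∈ Q) : ∀ x ∈ Submodule.span F (e '' ok), x ∈ Q := by
  have : Submodule.span F (e '' ok) ≤ Q := by
    rw [Submodule.span_le]
    rintro _ ⟨i, hi, rfl⟩
    exact h i hi
  exact fun x hx => this hx

theorem map_span_image {ι E E' : Type*} [AddCommGroup E] [Module F E] [AddCommGroup E']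
    [Module F E'] (e : ι → E) (ok : Set ι) (f : E →ₗ[F] E')
    (Q : Submodule F E') (h : ∀ i ∈ ok, f (e i) ∈ Q) :
    ∀ x ∈ Submodule.span F (e '' ok), f x ∈ Q :=
  span_image_le e ok (Q.comap f) h

theorem eq_span_image {ι E E' : Type*} [AddCommGroup E] [Module F E] [AddCommGroup E']
    [Module F E'] (e : ι → E) (ok : Set ι) (f g : E →ₗ[F] E')
    (h : ∀ i ∈ ok, f (e i) = g (e i)) :
    ∀ x ∈ Submodule.span F (e '' ok), f x = g x := by
  intro x hx
  have := span_image_le e ok (LinearMap.ker (f - g))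
    (fun i hi => by simp [h i hi]) x hx
  simpa [sub_eq_zero] using this

/-- quasi-isomorphism from a filtered contraction of the mapping cone -/
theorem cone_equiv {ι κ A B : Type*} [AddCommGroup A] [Module F A] [AddCommGroup B] [Module F B]
    (eA : ι → A) (okA : Set ι) (ρA : ι → ℕ) (eB : κ → B) (okB : Set κ) (ρB : κ → ℕ)
    (dA : A →ₗ[F] A) (dB : B →ₗ[F] B) (f : A →ₗ[F] B)
    (hAA : A →ₗ[F] A) (hAB : A →ₗ[F] B) (hBA : B →ₗ[F] A) (hBB : B →ₗ[F] B)
    (mdA : ∀ i ∈ okA, dA (eA i) ∈ Submodule.span F (eA '' okA))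
    (mdB : ∀ i ∈ okB, dB (eB i) ∈ Submodule.span F (eB '' okB))
    (mf : ∀ i ∈ okA, f (eA i) ∈ Submodule.span F (eB '' okB))
    (mAA : ∀ i ∈ okA, hAA (eA i) ∈ Submodule.span F (eA '' okA))
    (mAB : ∀ i ∈ okA, hAB (eA i) ∈ Submodule.span F (eB '' okB))
    (mBA : ∀ i ∈ okB, hBA (eB i) ∈ Submodule.span F (eA '' okA))
    (mBB : ∀ i ∈ okB, hBB (eB i) ∈ Submodule.span F (eB '' okB))
    (ddA : ∀ i ∈ okA, dA (dA (eA i)) = 0)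
    (ddB : ∀ i ∈ okB, dB (dB (eB i)) = 0)
    (fd : ∀ i ∈ okA, f (dA (eA i)) = dB (f (eA i)))
    (NAA : ∀ i ∈ okA, eA i + dA (hAA (eA i)) + hAA (dA (eA i)) - hBA (f (eA i)) ∈
      Submodule.span F (eA '' {j | j ∈ okA ∧ ρA j < ρA i}))
    (NAB : ∀ i ∈ okA, f (hAA (eA i)) + dB (hAB (eA i)) - hAB (dA (eA i)) + hBB (f (eA i)) ∈
      Submodule.span F (eB '' {j | j ∈ okB ∧ ρB j < ρA i}))
    (NBA : ∀ i ∈ okB, dA (hBA (eB i)) - hBA (dB (eB i)) ∈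
      Submodule.span F (eA '' {j | j ∈ okA ∧ ρA j < ρB i}))
    (NBB : ∀ i ∈ okB, eB i - f (hBA (eB i)) - dB (hBB (eB i)) - hBB (dB (eB i)) ∈
      Submodule.span F (eB '' {j | j ∈ okB ∧ ρB j < ρB i})) :
    Nonempty (HH dA (Submodule.span F (eA '' okA)) ≃ₗ[F] HH dB (Submodule.span F (eB '' okB))) := by
  set PA := Submodule.span F (eA '' okA) with hPA
  set PB := Submodule.span F (eB '' okB) with hPB
  let D : A × B →ₗ[F] A × B :=
    ((-dA).comp (LinearMap.fst F A B)).prod (f.comp (LinearMap.fst F A B) +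
      dB.comp (LinearMap.snd F A B))
  let H : A × B →ₗ[F] A × B :=
    (hAA.comp (LinearMap.fst F A B) + hBA.comp (LinearMap.snd F A B)).prod
      (hAB.comp (LinearMap.fst F A B) + hBB.comp (LinearMap.snd F A B))
  have Dap : ∀ a b, D (a, b) = (-dA a, f a + dB b) := fun a b => rfl
  have Hap : ∀ a b, H (a, b) = (hAA a + hBA b, hAB a + hBB b) := fun a b => rfl
  let e : ι ⊕ κ → A × B := Sum.elim (fun i => (eA i, 0)) (fun j => (0, eB j))
  let ok : Set (ι ⊕ κ) := {s | Sum.elim (fun i => i ∈ okA) (fun j => j ∈ okB) s}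
  let ρ : ι ⊕ κ → ℕ := Sum.elim ρA ρB
  have lowmem : ∀ (S : Set (ι ⊕ κ)) (SA : Set ι) (SB : Set κ),
      (∀ i ∈ SA, Sum.inl i ∈ S) → (∀ i ∈ SB, Sum.inr i ∈ S) → ∀ a b,
      a ∈ Submodule.span F (eA '' SA) → b ∈ Submodule.span F (eB '' SB) →
      (a, b) ∈ Submodule.span F (e '' S) := by
    intro S SA SB h1 h2 a b ha hb
    have e1 : (a, b) = LinearMap.inl F A B a + LinearMap.inr F A B b := by simp
    rw [e1]
    refine add_mem ?_ ?_
    · exact map_span_image eA SA (LinearMap.inl F A B) (Submodule.span F (e '' S))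
        (fun i hi => Submodule.subset_span ⟨Sum.inl i, h1 i hi, rfl⟩) a ha
    · exact map_span_image eB SB (LinearMap.inr F A B) (Submodule.span F (e '' S))
        (fun i hi => Submodule.subset_span ⟨Sum.inr i, h2 i hi, rfl⟩) b hb
  have okmem : ∀ a b, a ∈ PA → b ∈ PB → (a, b) ∈ Submodule.span F (e '' ok) :=
    lowmem ok okA okB (fun i hi => hi) (fun i hi => hi)
  have memok : ∀ x ∈ Submodule.span F (e '' ok), x.1 ∈ PA ∧ x.2 ∈ PB := by
    intro x hx
    have := span_image_le e ok (PA.prod PB) (by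
      rintro (i | i) hi
      · exact ⟨Submodule.subset_span ⟨i, hi, rfl⟩, zero_mem _⟩
      · exact ⟨zero_mem _, Submodule.subset_span ⟨i, hi, rfl⟩⟩) x hx
    exact this
  have mdA' := map_span_image eA okA dA PA mdA
  have mdB' := map_span_image eB okB dB PB mdB
  have mf' := map_span_image eA okA f PB mf
  have fd' := eq_span_image eA okA (f.comp dA) (dB.comp f) fd
  have ac := acyclic_aux e ok ρ D H
    (by
      rintro (i | i) hi
      · change D (eA i, 0) ∈ _
        rw [Dap]
        exact okmem _ _ (neg_mem (mdA i hi)) (by simpa using mf i hi)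
      · change D (0, eB i) ∈ _
        rw [Dap]
        exact okmem _ _ (by simp) (by simpa using mdB i hi))
    (by
      rintro (i | i) hi
      · change H (eA i, 0) ∈ _
        rw [Hap]
        exact okmem _ _ (by simpa using (mAA i hi)) (by simpa using mAB i hi)
      · change H (0, eB i) ∈ _
        rw [Hap]
        exact okmem _ _ (by simpa using (mBA i hi)) (by simpa using mBB i hi))
    (by
      rintro (i | i) hi
      · change D (D (eA i, 0)) = 0
        simp [Dap, ddA i hi, fd i hi]
      · change D (D (0, eB i)) = 0
        simp [Dap, ddB i hi])
    (by
      rintro (i | i) hi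
      · change (eA i, 0) - D (H (eA i, 0)) - H (D (eA i, 0)) ∈ _
        have : (eA i, 0) - D (H (eA i, 0)) - H (D (eA i, 0)) =
          (eA i + dA (hAA (eA i)) + hAA (dA (eA i)) - hBA (f (eA i)),
           - (f (hAA (eA i)) + dB (hAB (eA i)) - hAB (dA (eA i)) + hBB (f (eA i)))) := by
          simp only [Dap, Hap, map_zero, map_neg, add_zero, Prod.mk_sub_mk, Prod.mk.injEq]
          constructor <;> abel
        rw [this]
        exact lowmem _ _ _ (fun j hj => hj) (fun j hj => hj) _ _ (NAA i hi) (neg_mem (NAB i hi))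
      · change (0, eB i) - D (H (0, eB i)) - H (D (0, eB i)) ∈ _
        have : (0, eB i) - D (H (0, eB i)) - H (D (0, eB i)) =
          (dA (hBA (eB i)) - hBA (dB (eB i)),
           eB i - f (hBA (eB i)) - dB (hBB (eB i)) - hBB (dB (eB i))) := by
          simp only [Dap, Hap, map_zero, map_neg, neg_zero, zero_add, Prod.mk_sub_mk,
            Prod.mk.injEq]
          constructor <;> abel
        rw [this]
        exact lowmem _ _ _ (fun j hj => hj) (fun j hj => hj) _ _ (NBA i hi) (NBB i hi))
  refine hh_equiv dA PA dB PB f mf' fd' ?_ ?_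
  · intro x hx hdx y hy hxy
    obtain ⟨⟨a, b⟩, hab, h⟩ := ac (x, -y) (okmem _ _ hx (neg_mem hy)) (by
      rw [Dap, hdx, hxy]; simp)
    rw [Dap] at h
    refine ⟨-a, neg_mem (memok _ hab).1, ?_⟩
    rw [map_neg]
    exact (Prod.mk.inj h).1
  · intro y hy hdy
    obtain ⟨⟨a, b⟩, hab, h⟩ := ac (0, y) (okmem _ _ (zero_mem _) hy) (by
      rw [Dap, hdy]; simp)
    rw [Dap] at h
    refine ⟨a, (memok _ hab).1, ?_, b, (memok _ hab).2, (Prod.mk.inj h).2⟩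
    have := (Prod.mk.inj h).1
    exact neg_eq_zero.mp this.symm

end P0

/-! ## Part 6: the algebra of words -/

section P6
set_option linter.unusedVariables false
set_option linter.unusedSimpArgs false
open Finsupp
variable {F : Type*} [Field F]

/-- basis word -/
noncomputable def wd (F : Type*) [Field F] (l : List ℕ) : List ℕ →₀ F := Finsupp.single l 1

/-- linear extension of a map defined on a basis -/
noncomputable def lext {ι M : Type*} (F : Type*) [Field F] [AddCommGroup M] [Module F M] (g : ι → M) :
    (ι →₀ F) →ₗ[F] M := Finsupp.linearCombination F g

theorem lext_single {ι M : Type*} [AddCommGroup M] [Module F M] (g : ι → M) (i : ι) :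
    lext F g (Finsupp.single i 1) = g i := by
  simp [lext, Finsupp.linearCombination_single]

theorem lext_wd {M : Type*} [AddCommGroup M] [Module F M] (g : List ℕ → M) (l : List ℕ) :
    lext F g (wd F l) = g l := lext_single g l

noncomputable def consL (m : ℕ) : (List ℕ →₀ F) →ₗ[F] (List ℕ →₀ F) :=
  lext F (fun l => wd F (m :: l))

theorem consL_wd (m : ℕ) (l : List ℕ) : consL m (wd F l) = wd F (m :: l) := lext_wd _ _

/-- two linear maps agree if they agree on words -/
theorem wd_ext {M : Type*} [AddCommGroup M] [Module F M] {f g : (List ℕ →₀ F) →ₗ[F] M}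
    (h : ∀ l, f (wd F l) = g (wd F l)) : f = g := by
  refine Finsupp.lhom_ext' fun l => LinearMap.ext_ring ?_
  exact h l

variable (β : ℕ → ℕ → F)

noncomputable def dW : List ℕ → (List ℕ →₀ F)
  | [] => 0
  | (m :: l) => (∑ a ∈ Finset.Ioo 0 m, β m a • wd F (a :: (m - a) :: l)) - consL m (dW l)

noncomputable def dWL : (List ℕ →₀ F) →ₗ[F] (List ℕ →₀ F) := lext F (dW β)

theorem dWL_nil : dWL β (wd F []) = 0 := by simp [dWL, lext_wd, dW]

theorem dWL_consL (m : ℕ) (x : List ℕ →₀ F) :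
    dWL β (consL m x) = (∑ a ∈ Finset.Ioo 0 m, β m a • consL a (consL (m - a) x))
      - consL m (dWL β x) := by
  have : (dWL β).comp (consL m) =
      (∑ a ∈ Finset.Ioo 0 m, β m a • (consL a).comp (consL (m - a))) - (consL m).comp (dWL β) := by
    apply wd_ext
    intro l
    simp [consL_wd, dWL, lext_wd, dW]
  have h2 := congrArg (fun f => f x) this
  simpa using h2

theorem dWL_cons (m : ℕ) (l : List ℕ) :
    dWL β (wd F (m :: l)) = (∑ a ∈ Finset.Ioo 0 m, β m a • wd F (a :: (m - a) :: l))
      - consL m (dWL β (wd F l)) := by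
  simp [dWL, lext_wd, dW]

/-- coassociativity -/
def Coassoc : Prop := ∀ a b c : ℕ, 0 < a → 0 < b → 0 < c →
  β (a + b + c) a * β (b + c) b = β (a + b + c) (a + b) * β (a + b) a

theorem dWL_dWL (hβ : Coassoc β) (x : List ℕ →₀ F) : dWL β (dWL β x) = 0 := by
  have : (dWL β).comp (dWL β) = 0 := by
    apply wd_ext
    intro l
    induction l with
    | nil => simp [dWL_nil]
    | cons m l ih =>
      simp only [LinearMap.comp_apply, LinearMap.zero_apply] at ih ⊢
      rw [dWL_cons]
      simp only [map_sub, map_sum, map_smul]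
      rw [dWL_consL, ih, map_zero, sub_zero]
      have key : ∀ a ∈ Finset.Ioo 0 m, dWL β (wd F (a :: (m - a) :: l)) =
          (∑ b ∈ Finset.Ioo 0 a, β a b • wd F (b :: (a - b) :: (m - a) :: l)) -
          (∑ c ∈ Finset.Ioo 0 (m - a), β (m - a) c • wd F (a :: c :: (m - a - c) :: l)) +
          consL a (consL (m - a) (dWL β (wd F l))) := by
        intro a _
        rw [dWL_cons, dWL_cons, map_sub, map_sum]
        simp only [map_smul, consL_wd]
        abel
      rw [Finset.sum_congr rfl (fun a ha => by rw [key a ha])]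
      simp only [smul_add, smul_sub, Finset.sum_add_distrib, Finset.sum_sub_distrib,
        Finset.smul_sum, smul_smul]
      rw [add_sub_cancel_right, sub_eq_zero]
      rw [Finset.sum_sigma', Finset.sum_sigma']
      refine Finset.sum_bij' (fun x _ => ⟨x.2, x.1 - x.2⟩) (fun x _ => ⟨x.1 + x.2, x.1⟩) ?_ ?_ ?_ ?_ ?_
      · rintro ⟨a, b⟩ h
        simp only [Finset.mem_sigma, Finset.mem_Ioo] at h ⊢
        omega
      · rintro ⟨a, b⟩ h
        simp only [Finset.mem_sigma, Finset.mem_Ioo] at h ⊢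
        omega
      · rintro ⟨a, b⟩ h
        simp only [Finset.mem_sigma, Finset.mem_Ioo] at h ⊢
        simp only [Sigma.mk.injEq, heq_eq_eq, and_true]
        omega
      · rintro ⟨a, b⟩ h
        simp
      · rintro ⟨a, b⟩ h
        simp only [Finset.mem_sigma, Finset.mem_Ioo] at h ⊢
        have h1 := hβ b (a - b) (m - a) (by omega) (by omega) (by omega)
        have e1 : b + (a - b) + (m - a) = m := by omega
        have e2 : a - b + (m - a) = m - b := by omega
        have e3 : b + (a - b) = a := by omega
        have e4 : m - b - (a - b) = m - a := by omega
        rw [e1, e2, e3] at h1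
        rw [e4, h1]
  have h2 := congrArg (fun f => f x) this
  simpa using h2

/-- admissible words of weight `w` -/
def okW (w : ℕ) : Set (List ℕ) := {l | (∀ m ∈ l, 0 < m) ∧ l.sum = w}

theorem okW_cons {m w : ℕ} {l : List ℕ} : (m :: l) ∈ okW w ↔ 0 < m ∧ m ≤ w ∧ l ∈ okW (w - m) := by
  simp only [okW, Set.mem_ofPred_eq, List.mem_cons, forall_eq_or_imp, List.sum_cons]
  constructor
  · rintro ⟨⟨h1, h2⟩, h3⟩; exact ⟨h1, by omega, h2, by omega⟩
  · rintro ⟨h1, h2, h3, h4⟩; exact ⟨⟨h1, h3⟩, by omega⟩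

noncomputable abbrev spW (F : Type*) [Field F] (S : Set (List ℕ)) : Submodule F (List ℕ →₀ F) :=
  Submodule.span F (wd F '' S)

theorem wd_mem {S : Set (List ℕ)} {l : List ℕ} (h : l ∈ S) : wd F l ∈ spW F S :=
  Submodule.subset_span ⟨l, h, rfl⟩

theorem consL_mem {S S' : Set (List ℕ)} (m : ℕ) (h : ∀ l ∈ S, m :: l ∈ S') :
    ∀ x ∈ spW F S, consL m x ∈ spW F S' :=
  map_span_image _ _ _ _ (fun l hl => by rw [consL_wd]; exact wd_mem (h l hl))

theorem dWL_mem_gen (S : ℕ → Set (List ℕ)) 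
    (h1 : ∀ w m l a, m :: l ∈ S w → 0 < a → a < m → β m a ≠ 0 → a :: (m - a) :: l ∈ S w)
    (h2 : ∀ w m l, m :: l ∈ S w → m ≤ w ∧ l ∈ S (w - m) ∧ (∀ l' ∈ S (w - m), m :: l' ∈ S w)) :
    ∀ l w, l ∈ S w → dWL β (wd F l) ∈ spW F (S w) := by
  intro l
  induction l with
  | nil => intro w _; rw [dWL_nil]; exact zero_mem _
  | cons m l ih =>
    intro w h
    obtain ⟨h3, h4, h5⟩ := h2 _ _ _ h
    rw [dWL_cons]
    refine sub_mem (Submodule.sum_mem _ fun a ha => ?_) ?_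
    · rw [Finset.mem_Ioo] at ha
      by_cases hb : β m a = 0
      · rw [hb, zero_smul]; exact zero_mem _
      · exact Submodule.smul_mem _ _ (wd_mem (h1 _ _ _ _ h ha.1 ha.2 hb))
    · exact consL_mem m h5 _ (ih _ h4)

theorem dWL_mem (w : ℕ) (l : List ℕ) (h : l ∈ okW w) : dWL β (wd F l) ∈ spW F (okW w) := by
  apply dWL_mem_gen β okW _ _ l w h
  · intro w m l a h h1 h2 _
    rw [okW_cons] at h ⊢
    rw [okW_cons]
    refine ⟨h1, by omega, by omega, by omega, ?_⟩
    have e : w - a - (m - a) = w - m := by omega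
    rw [e]; exact h.2.2
  · intro w m l h
    have h' := okW_cons.1 h
    exact ⟨h'.2.1, h'.2.2, fun l' hl' => okW_cons.2 ⟨h'.1, h'.2.1, hl'⟩⟩

end P6

section P6b
set_option linter.unusedVariables false
set_option linter.unusedSimpArgs false
open Finsupp
variable {F : Type*} [Field F]
variable (β : ℕ → ℕ → F) (N : ℕ)

/-- second contraction -/
noncomputable def h2W : List ℕ → (List ℕ →₀ F)
  | [] => 0
  | [_] => 0
  | (m :: s :: l) => if N ∣ m then (if s < N then wd F ((m + s) :: l) else
      - consL m (h2W (s :: l))) else 0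

noncomputable def h2L : (List ℕ →₀ F) →ₗ[F] (List ℕ →₀ F) := lext F (h2W N)

theorem h2_nil : h2L N (wd F []) = 0 := by simp [h2L, lext_wd, h2W]

theorem h2_ndvd {m : ℕ} (hm : ¬ N ∣ m) (x : List ℕ →₀ F) : h2L N (consL m x) = 0 := by
  have : (h2L (F := F) N).comp (consL m) = 0 := by
    apply wd_ext
    intro l
    cases l with
    | nil => simp [consL_wd, h2L, lext_wd, h2W]
    | cons s l => simp [consL_wd, h2L, lext_wd, h2W, hm]
  exact congrArg (fun f => f x) this

theorem h2_small {m s : ℕ} (hm : N ∣ m) (hs : s < N) (x : List ℕ →₀ F) :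
    h2L N (consL m (consL s x)) = consL (m + s) x := by
  have : (h2L (F := F) N).comp ((consL m).comp (consL s)) = consL (m + s) := by
    apply wd_ext
    intro l
    simp [consL_wd, h2L, lext_wd, h2W, hm, hs]
  exact congrArg (fun f => f x) this

theorem h2_big {m s : ℕ} (hm : N ∣ m) (hs : N ≤ s) (x : List ℕ →₀ F) :
    h2L N (consL m (consL s x)) = - consL m (h2L N (consL s x)) := by
  have : (h2L (F := F) N).comp ((consL m).comp (consL s)) =
      - (consL (F := F) m).comp ((h2L (F := F) N).comp (consL (F := F) s)) := by
    apply wd_ext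
    intro l
    simp [consL_wd, h2L, lext_wd, h2W, hm, not_lt.2 hs]
  exact congrArg (fun f => f x) this

/-- the full contraction on words; the three components of the source are pure words, pure words,
all words -/
noncomputable def hBW (l : List ℕ) : List ℕ →₀ F :=
  if ∀ m ∈ l, N ∣ m then 0 else
  match l with
  | [] => 0
  | (m :: u) => if m = 1 then
      (if ∀ m ∈ u, N ∣ m then 0 else
        match u with
        | [] => 0
        | (s :: x) => if s + 1 < N then wd F ((s + 1) :: x) else if s + 1 = N then 0
            else - consL 1 (h2W N (s :: x)))
    else h2W N (m :: u)

noncomputable def hAW (l : List ℕ) : (List ℕ →₀ F) × (List ℕ →₀ F) × (List ℕ →₀ F) :=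
  if ∀ m ∈ l, N ∣ m then (wd F l, 0, 0) else
  match l with
  | [] => 0
  | (m :: u) => if m = 1 then
      (if ∀ m ∈ u, N ∣ m then (0, wd F u, 0) else
        match u with
        | [] => 0
        | (s :: x) => if s + 1 = N then (0, 0, wd F x) else 0)
    else 0

noncomputable def hBL : (List ℕ →₀ F) →ₗ[F] (List ℕ →₀ F) := lext F (hBW N)
noncomputable def hAL : (List ℕ →₀ F) →ₗ[F] (List ℕ →₀ F) × (List ℕ →₀ F) × (List ℕ →₀ F) :=
  lext F (hAW N)

def pureW (l : List ℕ) : Prop := ∀ m ∈ l, N ∣ m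

theorem pureW_cons {m : ℕ} {l : List ℕ} : pureW N (m :: l) ↔ N ∣ m ∧ pureW N l := by
  simp [pureW]

theorem hB_pure {l : List ℕ} (h : pureW N l) : hBL N (wd F l) = 0 := by
  simp only [pureW] at h
  rw [hBL, lext_wd, hBW.eq_def, if_pos h]

theorem hA_pure {l : List ℕ} (h : pureW N l) : hAL N (wd F l) = (wd F l, 0, 0) := by
  simp only [pureW] at h
  rw [hAL, lext_wd, hAW.eq_def, if_pos h]

theorem h2_pure {l : List ℕ} (h0 : ∀ m ∈ l, 0 < m) (h : pureW N l) : h2L N (wd F l) = 0 := by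
  induction l with
  | nil => exact h2_nil N
  | cons m l ih =>
    cases l with
    | nil => simp [h2L, lext_wd, h2W]
    | cons s l =>
      rw [pureW_cons] at h
      have h' := (pureW_cons N).1 h.2
      have hs : N ≤ s := Nat.le_of_dvd (h0 s (by simp)) h'.1
      rw [← consL_wd, ← consL_wd, h2_big N h.1 hs, consL_wd, ih (by simp_all) h.2]
      simp

variable {N}
theorem not_pure_one (hN : 2 ≤ N) {u : List ℕ} : ¬ pureW N (1 :: u) := by
  rw [pureW_cons, Nat.dvd_one]; omega

theorem not_pure_small {s : ℕ} (hs : 0 < s) (hs' : s < N) {u : List ℕ} : ¬ pureW N (s :: u) := by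
  rw [pureW_cons]
  intro h
  exact absurd (Nat.le_of_dvd hs h.1) (by omega)

theorem hB_one_pure (hN : 2 ≤ N) {u : List ℕ} (h : pureW N u) : hBL N (wd F (1 :: u)) = 0 := by
  have h1 := not_pure_one hN (u := u)
  simp only [pureW] at h h1
  simp only [hBL, lext_wd, hBW, if_neg h1, if_true, if_pos h]

theorem hA_one_pure (hN : 2 ≤ N) {u : List ℕ} (h : pureW N u) :
    hAL N (wd F (1 :: u)) = (0, wd F u, 0) := by
  have h1 := not_pure_one hN (u := u)
  simp only [pureW] at h h1
  simp only [hAL, lext_wd, hAW, if_neg h1, if_true, if_pos h]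

theorem hB_one_small (hN : 2 ≤ N) {s : ℕ} (h0 : 0 < s) (hs : s + 1 < N) (x : List ℕ →₀ F) :
    hBL N (consL 1 (consL s x)) = consL (s + 1) x := by
  have : (hBL (F := F) N).comp ((consL 1).comp (consL s)) = consL (s + 1) := by
    apply wd_ext
    intro l
    have h1 := not_pure_one hN (u := s :: l)
    have h2 := not_pure_small (N := N) h0 (by omega) (u := l)
    simp only [pureW] at h1 h2
    simp only [LinearMap.comp_apply, consL_wd, hBL, lext_wd, hBW, if_neg h1, if_neg h2, if_true,
      if_pos hs]
  exact congrArg (fun f => f x) this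

theorem hA_one_small (hN : 2 ≤ N) {s : ℕ} (h0 : 0 < s) (hs : s + 1 < N) (x : List ℕ →₀ F) :
    hAL N (consL 1 (consL s x)) = 0 := by
  have : (hAL (F := F) N).comp ((consL 1).comp (consL s)) = 0 := by
    apply wd_ext
    intro l
    have h1 := not_pure_one hN (u := s :: l)
    have h2 := not_pure_small (N := N) h0 (by omega) (u := l)
    simp only [pureW] at h1 h2
    simp only [LinearMap.comp_apply, consL_wd, hAL, lext_wd, hAW, if_neg h1, if_neg h2, if_true,
      if_neg hs.ne, LinearMap.zero_apply]
  exact congrArg (fun f => f x) this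

theorem hB_one_last (hN : 2 ≤ N) {s : ℕ} (hs : s + 1 = N) (x : List ℕ →₀ F) :
    hBL N (consL 1 (consL s x)) = 0 := by
  have : (hBL (F := F) N).comp ((consL 1).comp (consL s)) = 0 := by
    apply wd_ext
    intro l
    have h1 := not_pure_one hN (u := s :: l)
    have h2 := not_pure_small (N := N) (show 0 < s by omega) (by omega) (u := l)
    simp only [pureW] at h1 h2
    simp only [LinearMap.comp_apply, consL_wd, hBL, lext_wd, hBW, if_neg h1, if_neg h2, if_true,
      if_neg (show ¬ s + 1 < N by omega), if_pos hs, LinearMap.zero_apply]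
  exact congrArg (fun f => f x) this

theorem hA_one_last (hN : 2 ≤ N) {s : ℕ} (hs : s + 1 = N) (x : List ℕ →₀ F) :
    hAL N (consL 1 (consL s x)) = (0, 0, x) := by
  have : (hAL (F := F) N).comp ((consL 1).comp (consL s)) =
      (LinearMap.inr F (List ℕ →₀ F) ((List ℕ →₀ F) × (List ℕ →₀ F))).comp
        (LinearMap.inr F (List ℕ →₀ F) (List ℕ →₀ F)) := by
    apply wd_ext
    intro l
    have h1 := not_pure_one hN (u := s :: l)
    have h2 := not_pure_small (N := N) (show 0 < s by omega) (by omega) (u := l)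
    simp only [pureW] at h1 h2
    simp only [LinearMap.comp_apply, consL_wd, hAL, lext_wd, hAW, if_neg h1, if_neg h2, if_true,
      if_pos hs, LinearMap.inr_apply]
  exact congrArg (fun f => f x) this

theorem hB_one_big (hN : 2 ≤ N) {s : ℕ} {l : List ℕ} (hs : N ≤ s) (hp : ¬ pureW N (s :: l)) :
    hBL N (wd F (1 :: s :: l)) = - consL 1 (h2L N (wd F (s :: l))) := by
  have h1 := not_pure_one hN (u := s :: l)
  simp only [pureW] at h1 hp
  simp only [h2L, hBL, lext_wd, hBW, if_neg h1, if_true, if_neg hp, 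
      if_neg (show ¬ s + 1 < N by omega), if_neg (show ¬ s + 1 = N by omega)]

theorem hA_one_big (hN : 2 ≤ N) {s : ℕ} {l : List ℕ} (hs : N ≤ s) (hp : ¬ pureW N (s :: l)) :
    hAL N (wd F (1 :: s :: l)) = 0 := by
  have h1 := not_pure_one hN (u := s :: l)
  simp only [pureW] at h1 hp
  simp only [hAL, lext_wd, hAW, if_neg h1, if_true, if_neg hp,
      if_neg (show ¬ s + 1 = N by omega)]

theorem hB_ne_one {m : ℕ} {l : List ℕ} (hm : m ≠ 1) (hp : ¬ pureW N (m :: l)) :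
    hBL N (wd F (m :: l)) = h2L N (wd F (m :: l)) := by
  simp only [pureW] at hp
  simp only [h2L, hBL, lext_wd, hBW, if_neg hp, if_neg hm]

theorem hA_ne_one {m : ℕ} {l : List ℕ} (hm : m ≠ 1) (hp : ¬ pureW N (m :: l)) :
    hAL N (wd F (m :: l)) = 0 := by
  simp only [pureW] at hp
  simp only [hAL, lext_wd, hAW, if_neg hp, if_neg hm]

theorem hB_mid {r : ℕ} (h2 : 2 ≤ r) (hr : r < N) (x : List ℕ →₀ F) : hBL N (consL r x) = 0 := by
  have : (hBL (F := F) N).comp (consL r) = 0 := by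
    apply wd_ext
    intro l
    rw [LinearMap.comp_apply, consL_wd, hB_ne_one (by omega) (not_pure_small (by omega) hr),
      ← consL_wd, h2_ndvd]
    · rfl
    · intro h; exact absurd (Nat.le_of_dvd (by omega) h) (by omega)
  exact congrArg (fun f => f x) this

theorem hA_mid {r : ℕ} (h2 : 2 ≤ r) (hr : r < N) (x : List ℕ →₀ F) : hAL N (consL r x) = 0 := by
  have : (hAL (F := F) N).comp (consL r) = 0 := by
    apply wd_ext
    intro l
    rw [LinearMap.comp_apply, consL_wd, hA_ne_one (by omega) (not_pure_small (by omega) hr)]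
    rfl
  exact congrArg (fun f => f x) this

end P6b

section P6c
set_option linter.unusedVariables false
set_option linter.unusedSimpArgs false
open Finsupp
variable {F : Type*} [Field F]

structure GoodB (β : ℕ → ℕ → F) (N : ℕ) : Prop where
  two : 2 ≤ N
  co : Coassoc β
  g1 : ∀ m s t, N ∣ m → 0 < m + t → t < s → s < N → β (m + s) (m + t) = 1
  g2 : ∀ m s a, N ∣ m → N ∣ a → 0 < a → a < m → s < N → β (m + s) a = β m a
  g3 : ∀ m a, 0 < a → a < m → β m a ≠ 0 → a % N ≤ m % N

variable {β : ℕ → ℕ → F} {N : ℕ}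

def eW (N : ℕ) : List ℕ → ℕ
  | [] => 1
  | (m :: l) => if N ∣ m then m + eW N l else m

theorem eW_le (l : List ℕ) : eW N l ≤ l.sum + 1 := by
  induction l with
  | nil => simp [eW]
  | cons m l ih =>
    simp only [eW, List.sum_cons]
    split_ifs <;> omega

theorem not_dvd_of_lt {a : ℕ} (h0 : 0 < a) (h : a < N) : ¬ N ∣ a := fun h' => by
  have := Nat.le_of_dvd h0 h'; omega

theorem okW_split {m w a : ℕ} {l : List ℕ} (h : (m :: l) ∈ okW w) (h1 : 0 < a) (h2 : a < m) :
    (a :: (m - a) :: l) ∈ okW w := by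
  rw [okW_cons] at h ⊢
  rw [okW_cons]
  refine ⟨h1, by omega, by omega, by omega, ?_⟩
  have e : w - a - (m - a) = w - m := by omega
  rw [e]; exact h.2.2

theorem d_nonpure (l : List ℕ) : ∀ w, l ∈ okW w → ¬ pureW N l →
    dWL β (wd F l) ∈ spW F {v | v ∈ okW w ∧ ¬ pureW N v} := by
  induction l with
  | nil => intro w _ h; exact absurd (by simp [pureW]) h
  | cons m l ih =>
    intro w hw hp
    have hw' := okW_cons.1 hw
    rw [dWL_cons]
    refine sub_mem (Submodule.sum_mem _ fun a ha => ?_) ?_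
    · rw [Finset.mem_Ioo] at ha
      refine Submodule.smul_mem _ _ (wd_mem ⟨okW_split hw ha.1 ha.2, ?_⟩)
      intro h
      rw [pureW_cons, pureW_cons] at h
      refine hp ((pureW_cons N).2 ⟨?_, h.2.2⟩)
      have := Nat.dvd_add h.1 h.2.1
      rwa [Nat.add_sub_cancel' ha.2.le] at this
    · by_cases hm : N ∣ m
      · refine consL_mem m ?_ _ (ih _ hw'.2.2 (fun h => hp ((pureW_cons N).2 ⟨hm, h⟩)))
        rintro l' ⟨h1, h2⟩
        exact ⟨okW_cons.2 ⟨hw'.1, hw'.2.1, h1⟩, fun h => h2 ((pureW_cons N).1 h).2⟩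
      · refine consL_mem m ?_ _ (dWL_mem β _ _ hw'.2.2)
        intro l' h1
        exact ⟨okW_cons.2 ⟨hw'.1, hw'.2.1, h1⟩, fun h => hm ((pureW_cons N).1 h).1⟩

theorem d_big (hg : GoodB β N) (m : ℕ) (l : List ℕ) (w : ℕ) (hw : (m :: l) ∈ okW w) (hm : N ≤ m)
    (hp : ¬ pureW N (m :: l)) :
    dWL β (wd F (m :: l)) ∈ spW F {v | v ∈ okW w ∧ ¬ pureW N v ∧
      ∀ s y, v = s :: y → s < N → s < eW N (m :: l)} := by
  have hw' := okW_cons.1 hw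
  rw [dWL_cons]
  refine sub_mem (Submodule.sum_mem _ fun a ha => ?_) ?_
  · rw [Finset.mem_Ioo] at ha
    by_cases hb : β m a = 0
    · rw [hb, zero_smul]; exact zero_mem _
    refine Submodule.smul_mem _ _ (wd_mem ⟨okW_split hw ha.1 ha.2, ?_, ?_⟩)
    · intro h
      rw [pureW_cons, pureW_cons] at h
      refine hp ((pureW_cons N).2 ⟨?_, h.2.2⟩)
      have := Nat.dvd_add h.1 h.2.1
      rwa [Nat.add_sub_cancel' ha.2.le] at this
    · intro s y he hs
      obtain ⟨rfl, _⟩ := List.cons.inj he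
      have h3 := hg.g3 m a ha.1 ha.2 hb
      rw [Nat.mod_eq_of_lt hs] at h3
      have : ¬ N ∣ m := fun h => by rw [Nat.mod_eq_zero_of_dvd h] at h3; omega
      simp only [eW, if_neg this]
      omega
  · by_cases hd : N ∣ m
    · refine consL_mem m ?_ _ (d_nonpure l _ hw'.2.2 (fun h => hp ((pureW_cons N).2 ⟨hd, h⟩)))
      rintro l' ⟨h1, h2⟩
      refine ⟨okW_cons.2 ⟨hw'.1, hw'.2.1, h1⟩, fun h => h2 ((pureW_cons N).1 h).2, ?_⟩
      intro s y he hs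
      obtain ⟨rfl, _⟩ := List.cons.inj he
      omega
    · refine consL_mem m ?_ _ (dWL_mem β _ _ hw'.2.2)
      intro l' h1
      refine ⟨okW_cons.2 ⟨hw'.1, hw'.2.1, h1⟩, fun h => hd ((pureW_cons N).1 h).1, ?_⟩
      intro s y he hs
      obtain ⟨rfl, _⟩ := List.cons.inj he
      omega

/-- case (i) -/
theorem N2_i (hg : GoodB β N) (m : ℕ) (hm : N ≤ m) (hd : ¬ N ∣ m) (x : List ℕ →₀ F) :
    h2L N (dWL β (consL m x)) = consL m x := by
  have hN := hg.two
  rw [dWL_consL, map_sub, h2_ndvd N hd, sub_zero, map_sum]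
  have hr : 0 < m % N := Nat.pos_of_ne_zero fun h => hd (Nat.dvd_of_mod_eq_zero h)
  have hrN : m % N < N := Nat.mod_lt _ (by omega)
  have hdv : N ∣ m - m % N := Nat.dvd_sub_mod m
  rw [Finset.sum_eq_single (m - m % N)]
  · have e : m - (m - m % N) = m % N := by omega
    rw [map_smul, e, h2_small N hdv hrN]
    have e2 : m - m % N + m % N = m := by omega
    have := hg.g1 (m - m % N) (m % N) 0 hdv (by omega) hr hrN
    rw [e2, add_zero] at this
    rw [e2, this, one_smul]
  · intro a ha hne
    rw [Finset.mem_Ioo] at ha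
    rw [map_smul]
    by_cases h : N ∣ a
    · have h1 : ¬ N ∣ m - a := fun h' => hd (by
        have := Nat.dvd_add h h'
        rwa [Nat.add_sub_cancel' ha.2.le] at this)
      have h3 : N ≤ m - a := by
        by_contra hlt
        push Not at hlt
        apply hne
        have : m % N = m - a := by
          obtain ⟨k, rfl⟩ := h
          have e : m = (m - N * k) + N * k := by omega
          rw [e, Nat.add_mul_mod_self_left, Nat.mod_eq_of_lt hlt]; omega
        omega
      rw [h2_big N h h3, h2_ndvd N h1, map_zero, neg_zero, smul_zero]
    · rw [h2_ndvd N h, smul_zero]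
  · intro h
    exact absurd (Finset.mem_Ioo.2 ⟨by omega, by omega⟩) h

/-- case (ii) -/
theorem N2_ii (hg : GoodB β N) (m s : ℕ) (hm : 0 < m) (hd : N ∣ m) (hs0 : 0 < s) (hs : s < N)
    (x : List ℕ →₀ F) :
    consL m (consL s x) - dWL β (h2L N (consL m (consL s x))) - h2L N (dWL β (consL m (consL s x)))
     = - ∑ a ∈ (Finset.Ioo 0 m).filter (fun a => ¬ N ∣ a), β (m + s) a •
        consL a (consL (m + s - a) x) := by
  rw [h2_small N hd hs, dWL_consL, dWL_consL, dWL_consL]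
  simp only [map_sub, map_sum, map_smul]
  rw [h2_small N hd hs]
  have hN := hg.two
  have E1 : ∑ a ∈ Finset.Ioo 0 m, β m a • h2L N (consL a (consL (m - a) (consL s x))) =
      - ∑ a ∈ (Finset.Ioo 0 m).filter (fun a => N ∣ a), β (m + s) a •
        consL a (consL (m + s - a) x) := by
    rw [Finset.sum_filter, ← Finset.sum_neg_distrib]
    refine Finset.sum_congr rfl fun a ha => ?_
    rw [Finset.mem_Ioo] at ha
    split_ifs with h
    · have h1 : N ∣ m - a := Nat.dvd_sub hd h
      have h2 : N ≤ m - a := Nat.le_of_dvd (by omega) h1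
      rw [h2_big N h h2, h2_small N h1 hs, hg.g2 m s a hd h ha.1 ha.2 hs, smul_neg,
        show m - a + s = m + s - a by omega]
    · rw [h2_ndvd N h, smul_zero, neg_zero]
  have E2 : ∑ a ∈ Finset.Ioo 0 s, β s a • h2L N (consL m (consL a (consL (s - a) x))) =
      ∑ a ∈ Finset.Ioo m (m + s), β (m + s) a • consL a (consL (m + s - a) x) := by
    refine Finset.sum_bij' (fun a _ => m + a) (fun a _ => a - m) ?_ ?_ ?_ ?_ ?_
    · intro a ha; rw [Finset.mem_Ioo] at *; omega
    · intro a ha; rw [Finset.mem_Ioo] at *; omega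
    · intro a ha; simp
    · intro a ha; rw [Finset.mem_Ioo] at *; omega
    · intro a ha
      rw [Finset.mem_Ioo] at ha
      rw [h2_small N hd (by omega), hg.g1 m s a hd (by omega) ha.2 hs]
      have := hg.g1 0 s a (by simp) (by omega) ha.2 hs
      rw [zero_add, zero_add] at this
      rw [this, show m + s - (m + a) = s - a by omega]
  have E3 : ∑ a ∈ Finset.Ioo 0 (m + s), β (m + s) a • consL a (consL (m + s - a) x) =
      ∑ a ∈ Finset.Ioo 0 m, β (m + s) a • consL a (consL (m + s - a) x) + consL m (consL s x) +
      ∑ a ∈ Finset.Ioo m (m + s), β (m + s) a • consL a (consL (m + s - a) x) := by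
    have e : Finset.Ioo 0 (m + s) = (Finset.Ioo 0 m ∪ {m}) ∪ Finset.Ioo m (m + s) := by
      ext a
      simp only [Finset.mem_union, Finset.mem_Ioo, Finset.mem_singleton]
      omega
    rw [e, Finset.sum_union, Finset.sum_union, Finset.sum_singleton]
    · have := hg.g1 m s 0 hd (by omega) hs0 hs
      rw [add_zero] at this
      rw [this, one_smul, Nat.add_sub_cancel_left]
    · rw [Finset.disjoint_left]; intro a; simp only [Finset.mem_Ioo, Finset.mem_singleton]; omega
    · rw [Finset.disjoint_left]; intro a
      simp only [Finset.mem_union, Finset.mem_Ioo, Finset.mem_singleton]; omega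
  have E4 := Finset.sum_filter_add_sum_filter_not (Finset.Ioo 0 m) (fun a => N ∣ a)
    (fun a => β (m + s) a • consL a (consL (m + s - a) x))
  rw [E1, E2, E3, ← E4]
  abel

theorem N2_iii (hg : GoodB β N) (m s : ℕ) (hm : 0 < m) (hd : N ∣ m) (hs : N ≤ s)
    (x : List ℕ →₀ F) :
    consL m (consL s x) - dWL β (h2L N (consL m (consL s x))) - h2L N (dWL β (consL m (consL s x)))
     = consL m (consL s x - dWL β (h2L N (consL s x)) - h2L N (dWL β (consL s x))) +
     (h2L N (consL m (dWL β (consL s x))) + consL m (h2L N (dWL β (consL s x)))) := by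
  rw [h2_big N hd hs, map_neg, dWL_consL, dWL_consL β m (consL s x)]
  simp only [map_sub, map_sum, map_smul]
  have E1 : ∑ a ∈ Finset.Ioo 0 m, β m a • h2L N (consL a (consL (m - a) (consL s x))) =
     ∑ a ∈ Finset.Ioo 0 m, β m a • consL a (consL (m - a) (h2L N (consL s x))) := by
    refine Finset.sum_congr rfl fun a ha => ?_
    rw [Finset.mem_Ioo] at ha
    by_cases h : N ∣ a
    · have h1 : N ∣ m - a := Nat.dvd_sub hd h
      have h2 : N ≤ m - a := Nat.le_of_dvd (by omega) h1
      rw [h2_big N h h2, h2_big N h1 hs]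
      simp
    · have : β m a = 0 := by
        by_contra hb
        have := hg.g3 m a ha.1 ha.2 hb
        rw [Nat.mod_eq_zero_of_dvd hd] at this
        exact h (Nat.dvd_of_mod_eq_zero (by omega))
      rw [this, zero_smul, zero_smul]
  rw [E1]
  abel

theorem h2_mem (l : List ℕ) (w : ℕ) (hl : l ∈ okW w) : h2L N (wd F l) ∈ spW F (okW w) := by
  induction l generalizing w with
  | nil => rw [h2_nil]; exact zero_mem _
  | cons m l ih =>
    have h := okW_cons.1 hl
    cases l with
    | nil => simp [h2L, lext_wd, h2W]
    | cons s l =>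
      have h' := okW_cons.1 h.2.2
      by_cases hd : N ∣ m
      · by_cases hs : s < N
        · rw [← consL_wd, ← consL_wd, h2_small N hd hs, consL_wd]
          refine wd_mem (okW_cons.2 ⟨by omega, by omega, ?_⟩)
          have e : w - (m + s) = w - m - s := by omega
          rw [e]; exact h'.2.2
        · rw [← consL_wd, ← consL_wd, h2_big N hd (by omega), consL_wd]
          exact neg_mem (consL_mem m (fun l hl => okW_cons.2 ⟨h.1, h.2.1, hl⟩) _ (ih _ h.2.2))
      · rw [← consL_wd, h2_ndvd N hd]; exact zero_mem _

theorem N2_lower (hg : GoodB β N) (l : List ℕ) : ∀ m w, (m :: l) ∈ okW w → N ≤ m →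
    ¬ pureW N (m :: l) →
    wd F (m :: l) - dWL β (h2L N (wd F (m :: l))) - h2L N (dWL β (wd F (m :: l))) ∈
      spW F {v | v ∈ okW w ∧ eW N v < eW N (m :: l)} := by
  have hN := hg.two
  induction l with
  | nil =>
    intro m w hw hm hp
    have hd : ¬ N ∣ m := fun h => hp (by simp [pureW, h])
    have := N2_i hg m hm hd (wd F [])
    rw [consL_wd] at this
    rw [this, ← consL_wd, h2_ndvd N hd]
    simp
  | cons s l ih =>
    intro m w hw hm hp
    by_cases hd : N ∣ m
    · have hw' := okW_cons.1 hw
      have hw'' := okW_cons.1 hw'.2.2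
      have em : eW N (m :: s :: l) = m + eW N (s :: l) := by rw [eW, if_pos hd]
      rw [em]
      by_cases hs : s < N
      · have := N2_ii hg m s (by omega) hd hw''.1 hs (wd F l)
        rw [consL_wd, consL_wd] at this
        rw [this]
        refine neg_mem (Submodule.sum_mem _ fun a ha => Submodule.smul_mem _ _ ?_)
        rw [Finset.mem_filter, Finset.mem_Ioo] at ha
        rw [consL_wd, consL_wd]
        refine wd_mem ⟨?_, ?_⟩
        · rw [okW_cons, okW_cons]
          refine ⟨ha.1.1, by omega, by omega, by omega, ?_⟩
          have e : w - a - (m + s - a) = w - m - s := by omega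
          rw [e]; exact hw''.2.2
        · rw [eW, if_neg ha.2]; omega
      · have := N2_iii hg m s (by omega) hd (by omega) (wd F l)
        rw [consL_wd, consL_wd] at this
        rw [this]
        have hp' : ¬ pureW N (s :: l) := fun h => hp ((pureW_cons N).2 ⟨hd, h⟩)
        refine add_mem ?_ ?_
        · refine consL_mem m ?_ _ (ih s (w - m) hw'.2.2 (by omega) hp')
          rintro v ⟨h1, h2⟩
          refine ⟨okW_cons.2 ⟨hw'.1, hw'.2.1, h1⟩, ?_⟩
          rw [eW, if_pos hd]; omega
        · have hb := d_big hg s l _ hw'.2.2 (by omega) hp'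
          refine map_span_image (wd F) _ ((h2L N).comp (consL m) + (consL m).comp (h2L N)) _ ?_ _ hb
          rintro v ⟨h1, h2, h3⟩
          rw [LinearMap.add_apply, LinearMap.comp_apply, LinearMap.comp_apply]
          cases v with
          | nil => exact absurd (by simp [pureW]) h2
          | cons t y =>
            have ht := okW_cons.1 h1
            by_cases htN : t < N
            · rw [← consL_wd t, h2_small N hd htN, h2_ndvd N (not_dvd_of_lt ht.1 htN), map_zero,
                add_zero, consL_wd]
              refine wd_mem ⟨okW_cons.2 ⟨by omega, by omega, ?_⟩, ?_⟩
              · have e : w - (m + t) = w - m - t := by omega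
                rw [e]; exact ht.2.2
              · have hnd : ¬ N ∣ m + t := fun h =>
                  not_dvd_of_lt ht.1 htN ((Nat.dvd_add_right hd).1 h)
                have := h3 t y rfl htN
                rw [eW, if_neg hnd]; omega
            · rw [← consL_wd t, h2_big N hd (by omega), neg_add_cancel]; exact zero_mem _
    · have := N2_i hg m hm hd (wd F (s :: l))
      rw [consL_wd] at this
      rw [this, ← consL_wd, h2_ndvd N hd]
      simp

end P6c

section P6d
set_option linter.unusedVariables false
set_option linter.unusedSimpArgs false
open Finsupp
variable {F : Type*} [Field F]

theorem hh_prod {M M' : Type*} [AddCommGroup M] [Module F M] [AddCommGroup M'] [Module F M']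
    (d : M →ₗ[F] M) (P : Submodule F M) (d' : M' →ₗ[F] M') (P' : Submodule F M') :
    Nonempty (HH (d.prodMap d') (P.prod P') ≃ₗ[F] HH d P × HH d' P') := by
  have m1 : ∀ x ∈ (P.prod P') ⊓ LinearMap.ker (d.prodMap d'), x.1 ∈ P ⊓ LinearMap.ker d := by
    rintro x ⟨h1, h2⟩
    exact ⟨h1.1, congrArg Prod.fst h2⟩
  have m2 : ∀ x ∈ (P.prod P') ⊓ LinearMap.ker (d.prodMap d'), x.2 ∈ P' ⊓ LinearMap.ker d' := by
    rintro x ⟨h1, h2⟩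
    exact ⟨h1.2, congrArg Prod.snd h2⟩
  let g : ↥((P.prod P') ⊓ LinearMap.ker (d.prodMap d')) →ₗ[F] HH d P × HH d' P' :=
    ((Submodule.mkQ _).comp ((LinearMap.fst F M M').restrict m1)).prod
      ((Submodule.mkQ _).comp ((LinearMap.snd F M M').restrict m2))
  have hker : LinearMap.ker g = ((P.prod P').map (d.prodMap d')).comap
      ((P.prod P') ⊓ LinearMap.ker (d.prodMap d')).subtype := by
    ext ⟨x, hx⟩
    have e : g ⟨x, hx⟩ = (Submodule.Quotient.mk ⟨x.1, m1 x hx⟩,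
      Submodule.Quotient.mk ⟨x.2, m2 x hx⟩) := rfl
    rw [LinearMap.mem_ker, e, Prod.mk_eq_zero, Submodule.Quotient.mk_eq_zero,
      Submodule.Quotient.mk_eq_zero]
    simp only [Submodule.mem_comap, Submodule.subtype_apply, Submodule.mem_map]
    constructor
    · rintro ⟨⟨a, ha, h1⟩, ⟨b, hb, h2⟩⟩
      exact ⟨(a, b), ⟨ha, hb⟩, Prod.ext h1 h2⟩
    · rintro ⟨y, hy, h⟩
      exact ⟨⟨y.1, hy.1, congrArg Prod.fst h⟩, ⟨y.2, hy.2, congrArg Prod.snd h⟩⟩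
  have hsur : Function.Surjective g := by
    rintro ⟨z, z'⟩
    obtain ⟨⟨y, hy⟩, rfl⟩ := Submodule.mkQ_surjective _ z
    obtain ⟨⟨y', hy'⟩, rfl⟩ := Submodule.mkQ_surjective _ z'
    exact ⟨⟨(y, y'), ⟨hy.1, hy'.1⟩, Prod.ext hy.2 hy'.2⟩, rfl⟩
  unfold HH
  rw [← hker]
  exact ⟨g.quotKerEquivOfSurjective hsur⟩

theorem hh_neg {M : Type*} [AddCommGroup M] [Module F M]
    (d : M →ₗ[F] M) (P : Submodule F M) :
    Nonempty (HH (-d) P ≃ₗ[F] HH d P) := by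
  have h1 : LinearMap.ker (-d) = LinearMap.ker d := by ext; simp
  have h2 : P.map (-d) = P.map d := by
    ext x
    simp only [Submodule.mem_map]
    constructor
    · rintro ⟨y, hy, rfl⟩; exact ⟨-y, neg_mem hy, by simp⟩
    · rintro ⟨y, hy, rfl⟩; exact ⟨-y, neg_mem hy, by simp⟩
  unfold HH
  rw [h1, h2]
  exact ⟨LinearEquiv.refl _ _⟩

theorem hh_finite {M : Type*} [AddCommGroup M] [Module F M]
    (d : M →ₗ[F] M) (P : Submodule F M) [FiniteDimensional F P] :
    FiniteDimensional F (HH d P) := by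
  have : FiniteDimensional F ↥(P ⊓ LinearMap.ker d) :=
    Submodule.finiteDimensional_of_le (S₂ := P) inf_le_left
  infer_instance

variable {β : ℕ → ℕ → F} {N : ℕ}
abbrev T3 (F : Type*) [Field F] := (List ℕ →₀ F) × (List ℕ →₀ F) × (List ℕ →₀ F)

noncomputable def e3 (F : Type*) [Field F] : List ℕ ⊕ List ℕ ⊕ List ℕ → T3 F
  | .inl l => (wd F l, 0, 0)
  | .inr (.inl l) => (0, wd F l, 0)
  | .inr (.inr l) => (0, 0, wd F l)

def S1 (N w : ℕ) : Set (List ℕ) := {l | l ∈ okW w ∧ pureW N l}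
def S2 (N w : ℕ) : Set (List ℕ) := {l | 1 ≤ w ∧ l ∈ okW (w - 1) ∧ pureW N l}
def S3 (N w : ℕ) : Set (List ℕ) := {l | N ≤ w ∧ l ∈ okW (w - N)}

def ok3 (N w : ℕ) : Set (List ℕ ⊕ List ℕ ⊕ List ℕ)
  | .inl l => l ∈ S1 N w
  | .inr (.inl l) => l ∈ S2 N w
  | .inr (.inr l) => l ∈ S3 N w

theorem sp3_eq (N w : ℕ) : Submodule.span F (e3 F '' ok3 N w) =
    (spW F (S1 N w)).prod ((spW F (S2 N w)).prod (spW F (S3 N w))) := by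
  apply le_antisymm
  · rw [Submodule.span_le]
    rintro _ ⟨l | l | l, hl, rfl⟩
    · exact ⟨wd_mem hl, zero_mem _, zero_mem _⟩
    · exact ⟨zero_mem _, wd_mem hl, zero_mem _⟩
    · exact ⟨zero_mem _, zero_mem _, wd_mem hl⟩
  · rintro ⟨a, b, c⟩ ⟨ha, hb, hc⟩
    have e : (a, b, c) = LinearMap.inl F _ _ a + ((LinearMap.inr F (List ℕ →₀ F) _).comp
      (LinearMap.inl F _ (List ℕ →₀ F)) b + (LinearMap.inr F (List ℕ →₀ F) _).comp
      (LinearMap.inr F (List ℕ →₀ F) (List ℕ →₀ F)) c) := by simp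
    rw [e]
    refine add_mem ?_ (add_mem ?_ ?_)
    · exact map_span_image (wd F) _ _ (Submodule.span F (e3 F '' ok3 N w))
        (fun l hl => Submodule.subset_span ⟨.inl l, hl, rfl⟩) a ha
    · exact map_span_image (wd F) _ _ (Submodule.span F (e3 F '' ok3 N w))
        (fun l hl => Submodule.subset_span ⟨.inr (.inl l), hl, rfl⟩) b hb
    · exact map_span_image (wd F) _ _ (Submodule.span F (e3 F '' ok3 N w))
        (fun l hl => Submodule.subset_span ⟨.inr (.inr l), hl, rfl⟩) c hc

noncomputable def zL (N : ℕ) : (List ℕ →₀ F) →ₗ[F] (List ℕ →₀ F) :=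
  ∑ s ∈ Finset.Ioo 0 N, (consL s).comp (consL (N - s))

theorem zL_apply (x : List ℕ →₀ F) : zL N x = ∑ s ∈ Finset.Ioo 0 N, consL s (consL (N - s) x) := by
  simp [zL]

noncomputable def f3 (F : Type*) [Field F] (N : ℕ) : T3 F →ₗ[F] (List ℕ →₀ F) :=
  LinearMap.coprod LinearMap.id (LinearMap.coprod (consL 1) (zL N))

theorem f3_apply (a b c : List ℕ →₀ F) : f3 F N (a, b, c) = a + (consL 1 b + zL N c) := rfl

noncomputable def d3 (β : ℕ → ℕ → F) : T3 F →ₗ[F] T3 F :=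
  (dWL β).prodMap ((-dWL β).prodMap (dWL β))

theorem d3_apply (a b c : List ℕ →₀ F) : d3 β (a, b, c) = (dWL β a, -dWL β b, dWL β c) := rfl

theorem d_one (x : List ℕ →₀ F) : dWL β (consL 1 x) = - consL 1 (dWL β x) := by
  rw [dWL_consL, show Finset.Ioo 0 1 = ∅ from rfl]; simp

theorem beta_small (hg : GoodB β N) {s a : ℕ} (h0 : 0 < a) (h : a < s) (hs : s < N) :
    β s a = 1 := by
  have := hg.g1 0 s a (by simp) (by omega) h hs
  simpa using this

theorem d_small (hg : GoodB β N) {s : ℕ} (hs : s < N) (x : List ℕ →₀ F) :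
    dWL β (consL s x) = (∑ a ∈ Finset.Ioo 0 s, consL a (consL (s - a) x)) - consL s (dWL β x) := by
  rw [dWL_consL]
  congr 1
  refine Finset.sum_congr rfl fun a ha => ?_
  rw [Finset.mem_Ioo] at ha
  rw [beta_small hg ha.1 ha.2 hs, one_smul]

theorem d_z (hg : GoodB β N) (x : List ℕ →₀ F) : dWL β (zL N x) = zL N (dWL β x) := by
  rw [zL_apply, zL_apply, map_sum]
  have key : ∀ s ∈ Finset.Ioo 0 N, dWL β (consL s (consL (N - s) x)) =
      ((∑ a ∈ Finset.Ioo 0 s, consL a (consL (s - a) (consL (N - s) x))) -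
      ∑ c ∈ Finset.Ioo 0 (N - s), consL s (consL c (consL (N - s - c) x))) +
      consL s (consL (N - s) (dWL β x)) := by
    intro s hs
    rw [Finset.mem_Ioo] at hs
    rw [d_small hg hs.2, d_small hg (by omega), map_sub, map_sum]
    abel
  rw [Finset.sum_congr rfl key, Finset.sum_add_distrib, Finset.sum_sub_distrib]
  rw [Finset.sum_sigma', Finset.sum_sigma']
  rw [add_eq_right, sub_eq_zero]
  refine Finset.sum_bij' (fun x _ => ⟨x.2, x.1 - x.2⟩) (fun x _ => ⟨x.1 + x.2, x.1⟩) ?_ ?_ ?_ ?_ ?_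
  · rintro ⟨a, b⟩ h
    simp only [Finset.mem_sigma, Finset.mem_Ioo] at h ⊢
    omega
  · rintro ⟨a, b⟩ h
    simp only [Finset.mem_sigma, Finset.mem_Ioo] at h ⊢
    omega
  · rintro ⟨a, b⟩ h
    simp only [Finset.mem_sigma, Finset.mem_Ioo] at h ⊢
    simp only [Sigma.mk.injEq, heq_eq_eq, and_true]
    omega
  · rintro ⟨a, b⟩ h
    simp
  · rintro ⟨a, b⟩ h
    simp only [Finset.mem_sigma, Finset.mem_Ioo] at h ⊢
    rw [show N - b - (a - b) = N - a by omega]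

theorem f3_d3 (hg : GoodB β N) (x : T3 F) : f3 F N (d3 β x) = dWL β (f3 F N x) := by
  obtain ⟨a, b, c⟩ := x
  rw [d3_apply, f3_apply, f3_apply, map_add, map_add, d_one, d_z hg, map_neg]

theorem d3_d3 (hg : GoodB β N) (x : T3 F) : d3 β (d3 β x) = 0 := by
  obtain ⟨a, b, c⟩ := x
  rw [d3_apply, d3_apply, map_neg]
  simp [dWL_dWL β hg.co]

theorem d_pure (hg : GoodB β N) (w : ℕ) (l : List ℕ) (h : l ∈ S1 N w) :
    dWL β (wd F l) ∈ spW F (S1 N w) := by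
  have hN := hg.two
  apply dWL_mem_gen β (S1 N) _ _ l w h
  · rintro w m l a ⟨h, hp⟩ h1 h2 hb
    refine ⟨okW_split h h1 h2, ?_⟩
    rw [pureW_cons] at hp
    have h3 := hg.g3 m a h1 h2 hb
    rw [Nat.mod_eq_zero_of_dvd hp.1] at h3
    have h4 : N ∣ a := Nat.dvd_of_mod_eq_zero (by omega)
    rw [pureW_cons, pureW_cons]
    exact ⟨h4, Nat.dvd_sub hp.1 h4, hp.2⟩
  · rintro w m l ⟨h, hp⟩
    have h' := okW_cons.1 h
    rw [pureW_cons] at hp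
    refine ⟨h'.2.1, ⟨h'.2.2, hp.2⟩, ?_⟩
    rintro l' ⟨hl', hp'⟩
    exact ⟨okW_cons.2 ⟨h'.1, h'.2.1, hl'⟩, (pureW_cons N).2 ⟨hp.1, hp'⟩⟩

theorem hA_span_pure (w : ℕ) : ∀ x ∈ spW F (S1 N w), hAL N x = (x, 0, 0) := by
  intro x hx
  exact eq_span_image (wd F) (S1 N w) (hAL N) (LinearMap.inl F _ _)
    (fun l hl => by rw [hA_pure N hl.2]; rfl) x hx

theorem hB_span_pure (w : ℕ) : ∀ x ∈ spW F (S1 N w), hBL N x = 0 := by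
  intro x hx
  exact eq_span_image (wd F) (S1 N w) (hBL N) 0
    (fun l hl => by rw [hB_pure N hl.2]; rfl) x hx

theorem hA_span_one_pure (hN : 2 ≤ N) (w : ℕ) :
    ∀ x ∈ spW F (S1 N w), hAL N (consL 1 x) = (0, x, 0) := by
  intro x hx
  exact eq_span_image (wd F) (S1 N w) ((hAL N).comp (consL 1)) ((LinearMap.inr F _ _).comp (LinearMap.inl F _ _))
    (fun l hl => by rw [LinearMap.comp_apply, consL_wd, hA_one_pure hN hl.2]; rfl) x hx

theorem hB_span_one_pure (hN : 2 ≤ N) (w : ℕ) :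
    ∀ x ∈ spW F (S1 N w), hBL N (consL 1 x) = 0 := by
  intro x hx
  exact eq_span_image (wd F) (S1 N w) ((hBL N).comp (consL 1)) 0
    (fun l hl => by rw [LinearMap.comp_apply, consL_wd, hB_one_pure hN hl.2]; rfl) x hx

theorem hA_z (hN : 2 ≤ N) (x : List ℕ →₀ F) : hAL N (zL N x) = (0, 0, x) := by
  rw [zL_apply, map_sum, Finset.sum_eq_single 1]
  · rw [hA_one_last hN (by omega)]
  · intro s hs hne
    rw [Finset.mem_Ioo] at hs
    rw [hA_mid (by omega) hs.2]
  · intro h; exact absurd (Finset.mem_Ioo.2 ⟨by omega, by omega⟩) h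

theorem hB_z (hN : 2 ≤ N) (x : List ℕ →₀ F) : hBL N (zL N x) = 0 := by
  rw [zL_apply, map_sum]
  refine Finset.sum_eq_zero fun s hs => ?_
  rw [Finset.mem_Ioo] at hs
  by_cases h : s = 1
  · subst h; rw [hB_one_last hN (by omega)]
  · rw [hB_mid (by omega) hs.2]

def rkW (N w : ℕ) : List ℕ → ℕ
  | [] => 0
  | (m :: t) => if m = 1 then 1 + eW N t else if m < N then 0 else w + 2 + eW N (m :: t)

theorem hA_mem (hN : 2 ≤ N) (w : ℕ) (l : List ℕ) (h : l ∈ okW w) :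
    hAL N (wd F l) ∈ Submodule.span F (e3 F '' ok3 N w) := by
  rw [sp3_eq]
  by_cases hp : pureW N l
  · rw [hA_pure N hp]; exact ⟨wd_mem ⟨h, hp⟩, zero_mem _, zero_mem _⟩
  cases l with
  | nil => exact absurd (by simp [pureW]) hp
  | cons m u =>
    by_cases hm : m = 1
    · subst hm
      have h' := okW_cons.1 h
      by_cases hp' : pureW N u
      · rw [hA_one_pure hN hp']
        exact ⟨zero_mem _, wd_mem ⟨h'.2.1, h'.2.2, hp'⟩, zero_mem _⟩
      cases u with
      | nil => exact absurd (by simp [pureW]) hp'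
      | cons s x =>
        have h'' := okW_cons.1 h'.2.2
        rcases lt_trichotomy (s + 1) N with hs | hs | hs
        · rw [← consL_wd, ← consL_wd, hA_one_small hN h''.1 hs]; exact zero_mem _
        · rw [← consL_wd, ← consL_wd, hA_one_last hN hs]
          refine ⟨zero_mem _, zero_mem _, wd_mem ⟨by omega, ?_⟩⟩
          rw [show w - N = w - 1 - s by omega]; exact h''.2.2
        · rw [hA_one_big hN (by omega) hp']; exact zero_mem _
    · rw [hA_ne_one hm hp]; exact zero_mem _

theorem hB_one_mem (hN : 2 ≤ N) (w : ℕ) (u : List ℕ) (h : 1 :: u ∈ okW w) :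
    hBL N (wd F (1 :: u)) ∈ spW F {v | v ∈ okW w ∧ rkW N w v < w + 2} := by
  have h' := okW_cons.1 h
  by_cases hp' : pureW N u
  · rw [hB_one_pure hN hp']; exact zero_mem _
  cases u with
  | nil => exact absurd (by simp [pureW]) hp'
  | cons s x =>
    have h'' := okW_cons.1 h'.2.2
    rcases lt_trichotomy (s + 1) N with hs | hs | hs
    · rw [← consL_wd, ← consL_wd, hB_one_small hN h''.1 hs, consL_wd]
      refine wd_mem ⟨okW_cons.2 ⟨by omega, by omega, ?_⟩, ?_⟩
      · rw [show w - (s + 1) = w - 1 - s by omega]; exact h''.2.2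
      · rw [rkW, if_neg (by omega), if_pos hs]; omega
    · rw [← consL_wd, ← consL_wd, hB_one_last hN hs]; exact zero_mem _
    · rw [hB_one_big hN (by omega) hp']
      refine neg_mem (consL_mem 1 ?_ _ (h2_mem _ _ h'.2.2))
      intro v hv
      refine ⟨okW_cons.2 ⟨by omega, h'.2.1, hv⟩, ?_⟩
      rw [rkW, if_pos rfl]
      have := eW_le (N := N) v
      have h4 : v.sum = w - 1 := hv.2
      omega

theorem hB_mem (hN : 2 ≤ N) (w : ℕ) (l : List ℕ) (h : l ∈ okW w) :
    hBL N (wd F l) ∈ spW F (okW w) := by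
  by_cases hp : pureW N l
  · rw [hB_pure N hp]; exact zero_mem _
  cases l with
  | nil => exact absurd (by simp [pureW]) hp
  | cons m u =>
    by_cases hm : m = 1
    · subst hm
      exact Submodule.span_mono (Set.image_mono (fun v hv => hv.1)) (hB_one_mem hN w u h)
    · rw [hB_ne_one hm hp]; exact h2_mem _ _ h

theorem rk_le (w : ℕ) (v : List ℕ) (hv : v ∈ okW w) : rkW N w v ≤ w + 2 + eW N v := by
  cases v with
  | nil => simp [rkW]
  | cons m t =>
    have := eW_le (N := N) t
    have h4 : m + t.sum = w := by have := hv.2; simpa using this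
    rw [rkW]
    split_ifs with h h'
    · omega
    · omega
    · omega

end P6d

section P6e
set_option linter.unusedVariables false
set_option linter.unusedSimpArgs false
open Finsupp
variable {F : Type*} [Field F] {β : ℕ → ℕ → F} {N : ℕ}

theorem NB_cases (hg : GoodB β N) (w : ℕ) (l : List ℕ) (hl : l ∈ okW w) :
    (rkW N w l = 0 → d3 β (hAL N (wd F l)) - hAL N (dWL β (wd F l)) = 0) ∧
    wd F l - f3 F N (hAL N (wd F l)) - dWL β (hBL N (wd F l)) - hBL N (dWL β (wd F l)) ∈
      spW F {j | j ∈ okW w ∧ rkW N w j < rkW N w l} := by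
  have hN := hg.two
  by_cases hp : pureW N l
  · have hd := d_pure hg w l ⟨hl, hp⟩
    rw [hA_pure N hp, hB_pure N hp, hA_span_pure w _ hd, hB_span_pure w _ hd, d3_apply, f3_apply]
    simp
  cases l with
  | nil => exact absurd (by simp [pureW]) hp
  | cons m u =>
    have hl' := okW_cons.1 hl
    by_cases hm : m = 1
    · subst hm
      refine ⟨fun h => by rw [rkW, if_pos rfl] at h; omega, ?_⟩
      have rk1 : rkW N w (1 :: u) = 1 + eW N u := by rw [rkW, if_pos rfl]
      have e1 : dWL β (wd F (1 :: u)) = - consL 1 (dWL β (wd F u)) := by rw [← consL_wd, d_one]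
      by_cases hpu : pureW N u
      · have hd := d_pure hg (w - 1) u ⟨hl'.2.2, hpu⟩
        rw [e1, hA_one_pure hN hpu, hB_one_pure hN hpu, f3_apply, map_neg,
          hB_span_one_pure hN _ _ hd, consL_wd]
        simp
      cases u with
      | nil => exact absurd (by simp [pureW]) hpu
      | cons s x =>
        have hl'' := okW_cons.1 hl'.2.2
        by_cases hs : s < N
        · have e2 : dWL β (wd F (1 :: s :: x)) =
              (consL 1 (consL s (dWL β (wd F x)))) - ∑ a ∈ Finset.Ioo 0 s,
                consL 1 (consL a (wd F ((s - a) :: x))) := by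
            rw [e1, ← consL_wd s, d_small hg hs, map_sub, neg_sub, map_sum]
            simp only [consL_wd]
          have e3 : ∑ a ∈ Finset.Ioo 0 s, hBL N (consL 1 (consL a (wd F ((s - a) :: x)))) =
              ∑ a ∈ Finset.Ioo 1 (s + 1), wd F (a :: (s + 1 - a) :: x) := by
            refine Finset.sum_bij' (fun a _ => a + 1) (fun a _ => a - 1) ?_ ?_ ?_ ?_ ?_
            · intro a ha; rw [Finset.mem_Ioo] at *; omega
            · intro a ha; rw [Finset.mem_Ioo] at *; omega
            · intro a ha; simp
            · intro a ha; rw [Finset.mem_Ioo] at *; omega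
            · intro a ha
              rw [Finset.mem_Ioo] at ha
              rw [hB_one_small hN ha.1 (by omega), consL_wd,
                show s + 1 - (a + 1) = s - a by omega]
          have e4 : ∑ a ∈ Finset.Ioo 0 (s + 1), wd F (a :: (s + 1 - a) :: x) =
              wd F (1 :: s :: x) + ∑ a ∈ Finset.Ioo 1 (s + 1), wd F (a :: (s + 1 - a) :: x) := by
            have : Finset.Ioo 0 (s + 1) = insert 1 (Finset.Ioo 1 (s + 1)) := by
              ext a; simp only [Finset.mem_insert, Finset.mem_Ioo]; omega
            rw [this, Finset.sum_insert (by simp)]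
            simp
          rw [e2, map_sub, map_sum, e3]
          rcases (show s + 1 < N ∨ s + 1 = N by omega) with h | h
          · have a1 : hAL N (wd F (1 :: s :: x)) = 0 := by
              rw [← consL_wd, ← consL_wd, hA_one_small hN hl''.1 h]
            have a2 : hBL N (wd F (1 :: s :: x)) = consL (s + 1) (wd F x) := by
              rw [← consL_wd, ← consL_wd, hB_one_small hN hl''.1 h]
            rw [a1, a2, hB_one_small hN hl''.1 h, d_small hg h]
            simp only [consL_wd]
            rw [e4, map_zero, sub_zero]
            convert Submodule.zero_mem _ using 1
            abel
          · have a1 : hAL N (wd F (1 :: s :: x)) = (0, 0, wd F x) := by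
              rw [← consL_wd, ← consL_wd, hA_one_last hN h]
            have a2 : hBL N (wd F (1 :: s :: x)) = 0 := by
              rw [← consL_wd, ← consL_wd, hB_one_last hN h]
            rw [a1, a2, hB_one_last hN h, f3_apply, zL_apply]
            subst h
            simp only [consL_wd]
            rw [e4]
            simp
        · have a1 := hA_one_big (F := F) hN (not_lt.1 hs) hpu
          have a2 := hB_one_big (F := F) hN (not_lt.1 hs) hpu
          rw [a1, a2, e1, map_neg, map_neg, d_one, rk1]
          have E : wd F (1 :: s :: x) - f3 F N 0 - - - consL 1 (dWL β (h2L N (wd F (s :: x)))) -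
              - hBL N (consL 1 (dWL β (wd F (s :: x)))) =
            consL 1 (wd F (s :: x) - dWL β (h2L N (wd F (s :: x))) - h2L N (dWL β (wd F (s :: x))))
            + (hBL N (consL 1 (dWL β (wd F (s :: x)))) +
              consL 1 (h2L N (dWL β (wd F (s :: x))))) := by
            rw [map_sub, map_sub, consL_wd, map_zero]
            abel
          rw [E]
          refine add_mem ?_ ?_
          · refine consL_mem 1 ?_ _ (N2_lower hg x s (w - 1) hl'.2.2 (not_lt.1 hs) hpu)
            rintro v ⟨h1, h2⟩
            refine ⟨okW_cons.2 ⟨hl'.1, hl'.2.1, h1⟩, ?_⟩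
            rw [rkW, if_pos rfl]; omega
          · have hb := d_nonpure (β := β) (s :: x) _ hl'.2.2 hpu
            refine map_span_image (wd F) _ ((hBL N).comp (consL 1) + (consL 1).comp (h2L N)) _
              ?_ _ hb
            rintro v ⟨h1, h2⟩
            rw [LinearMap.add_apply, LinearMap.comp_apply, LinearMap.comp_apply, consL_wd]
            cases v with
            | nil => exact absurd (by simp [pureW]) h2
            | cons t y =>
              have ht := okW_cons.1 h1
              rcases lt_trichotomy (t + 1) N with h | h | h
              · rw [← consL_wd, ← consL_wd, hB_one_small hN ht.1 h,
                  h2_ndvd N (not_dvd_of_lt ht.1 (by omega)), map_zero, add_zero, consL_wd]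
                refine wd_mem ⟨okW_cons.2 ⟨by omega, by omega, ?_⟩, ?_⟩
                · rw [show w - (t + 1) = w - 1 - t by omega]; exact ht.2.2
                · rw [rkW, if_neg (by omega), if_pos h]; omega
              · rw [← consL_wd, ← consL_wd, hB_one_last hN h,
                  h2_ndvd N (not_dvd_of_lt ht.1 (by omega)), map_zero, add_zero]
                exact zero_mem _
              · rw [hB_one_big hN (by omega) h2, neg_add_cancel]; exact zero_mem _
    · by_cases hmN : m < N
      · have rk0 : rkW N w (m :: u) = 0 := by rw [rkW, if_neg hm, if_pos hmN]
        have e1 : dWL β (wd F (m :: u)) = consL 1 (consL (m - 1) (wd F u)) +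
            (∑ a ∈ Finset.Ioo 1 m, consL a (consL (m - a) (wd F u))) -
            consL m (dWL β (wd F u)) := by
          rw [← consL_wd, d_small hg hmN]
          have : Finset.Ioo 0 m = insert 1 (Finset.Ioo 1 m) := by
            ext a; simp only [Finset.mem_insert, Finset.mem_Ioo]; omega
          rw [this, Finset.sum_insert (by simp)]
        have a1 : hAL N (wd F (m :: u)) = 0 := hA_ne_one hm hp
        have a2 : hBL N (wd F (m :: u)) = 0 := by rw [← consL_wd, hB_mid (by omega) hmN]
        have s1 : ∑ a ∈ Finset.Ioo 1 m, hAL N (consL a (consL (m - a) (wd F u))) = 0 :=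
          Finset.sum_eq_zero fun a ha => by
            rw [Finset.mem_Ioo] at ha; exact hA_mid (by omega) (by omega) _
        have s2 : ∑ a ∈ Finset.Ioo 1 m, hBL N (consL a (consL (m - a) (wd F u))) = 0 :=
          Finset.sum_eq_zero fun a ha => by
            rw [Finset.mem_Ioo] at ha; exact hB_mid (by omega) (by omega) _
        rw [e1, a1, a2]
        simp only [map_sub, map_add, map_sum, s1, s2]
        rw [hA_one_small hN (by omega) (by omega), hB_one_small hN (by omega) (by omega),
          hA_mid (by omega) hmN, hB_mid (by omega) hmN, show m - 1 + 1 = m by omega, consL_wd]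
        simp
      · have rk : rkW N w (m :: u) = w + 2 + eW N (m :: u) := by rw [rkW, if_neg hm, if_neg hmN]
        refine ⟨fun h => by omega, ?_⟩
        rw [hA_ne_one hm hp, hB_ne_one hm hp, rk]
        have E : wd F (m :: u) - f3 F N 0 - dWL β (h2L N (wd F (m :: u))) -
            hBL N (dWL β (wd F (m :: u))) =
          (wd F (m :: u) - dWL β (h2L N (wd F (m :: u))) - h2L N (dWL β (wd F (m :: u)))) +
          (h2L N (dWL β (wd F (m :: u))) - hBL N (dWL β (wd F (m :: u)))) := by
          rw [map_zero]; abel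
        rw [E]
        refine add_mem ?_ ?_
        · refine Submodule.span_mono (Set.image_mono ?_)
            (N2_lower hg u m w hl (not_lt.1 hmN) hp)
          rintro v ⟨h1, h2⟩
          exact ⟨h1, by have := rk_le (N := N) w v h1; omega⟩
        · have hb := d_nonpure (β := β) (m :: u) _ hl hp
          refine map_span_image (wd F) _ (h2L N - hBL N) _ ?_ _ hb
          rintro v ⟨h1, h2⟩
          rw [LinearMap.sub_apply]
          cases v with
          | nil => exact absurd (by simp [pureW]) h2
          | cons t y =>
            by_cases ht : t = 1
            · subst ht
              have e0 : h2L N (wd F (1 :: y)) = 0 := by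
                rw [← consL_wd, h2_ndvd N (not_dvd_of_lt (by omega) (by omega))]
              rw [e0, zero_sub]
              refine neg_mem (Submodule.span_mono (Set.image_mono ?_) (hB_one_mem hN w y h1))
              rintro v ⟨h3, h4⟩
              exact ⟨h3, by omega⟩
            · rw [hB_ne_one ht h2, sub_self]; exact zero_mem _

theorem main_equiv (hg : GoodB β N) (w : ℕ) :
    Nonempty (HH (d3 β) (Submodule.span F (e3 F '' ok3 N w)) ≃ₗ[F] HH (dWL β) (spW F (okW w))) := by
  have hN := hg.two
  have hP := sp3_eq (F := F) N w
  have shift1 : ∀ l ∈ S2 N w, l ∈ S1 N (w - 1) := fun l hl => ⟨hl.2.1, hl.2.2⟩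
  have shift1' : 1 ≤ w → S2 N w = S1 N (w - 1) := fun h => by
    ext l; exact ⟨fun hl => ⟨hl.2.1, hl.2.2⟩, fun hl => ⟨h, hl.1, hl.2⟩⟩
  refine cone_equiv (e3 F) (ok3 N w) (fun _ => 0) (wd F) (okW w) (rkW N w) (d3 β) (dWL β) (f3 F N)
    0 0 (hAL N) (hBL N) ?_ (dWL_mem β w) ?_ ?_ ?_ (hA_mem hN w) (hB_mem hN w) ?_ ?_ ?_ ?_ ?_ ?_ ?_
  · intro i hi
    rw [hP]
    match i, hi with
    | .inl l, hi =>
      rw [e3, d3_apply]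
      exact ⟨d_pure hg w l hi, by simp, by simp⟩
    | .inr (.inl l), hi =>
      rw [e3, d3_apply]
      refine ⟨by simp, ?_, by simp⟩
      have := d_pure hg (w - 1) l (shift1 l hi)
      rw [← shift1' hi.1] at this
      exact neg_mem this
    | .inr (.inr l), hi =>
      rw [e3, d3_apply]
      refine ⟨by simp, by simp, ?_⟩
      refine Submodule.span_mono (Set.image_mono ?_) (dWL_mem β (w - N) l hi.2)
      exact fun v hv => ⟨hi.1, hv⟩
  · intro i hi
    match i, hi with
    | .inl l, hi =>
      rw [e3, f3_apply]
      simpa using wd_mem hi.1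
    | .inr (.inl l), hi =>
      rw [e3, f3_apply, consL_wd]
      simpa using wd_mem (okW_cons.2 ⟨by omega, hi.1, hi.2.1⟩)
    | .inr (.inr l), hi =>
      rw [e3, f3_apply, zL_apply]
      simp only [map_zero, zero_add, consL_wd]
      refine Submodule.sum_mem _ fun s hs => wd_mem ?_
      rw [Finset.mem_Ioo] at hs
      have := hi.1
      rw [okW_cons, okW_cons]
      refine ⟨hs.1, by omega, by omega, by omega, ?_⟩
      rw [show w - s - (N - s) = w - N by omega]; exact hi.2
  · intro i hi; simp
  · intro i hi; simp
  · intro i hi; exact d3_d3 hg _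
  · intro i hi; exact dWL_dWL β hg.co _
  · intro i hi; exact f3_d3 hg _
  · intro i hi
    have : hAL N (f3 F N (e3 F i)) = e3 F i := by
      match i, hi with
      | .inl l, hi =>
        rw [e3, f3_apply]
        simpa using hA_pure N hi.2
      | .inr (.inl l), hi =>
        rw [e3, f3_apply, consL_wd]
        simpa using hA_one_pure hN hi.2.2
      | .inr (.inr l), hi =>
        rw [e3, f3_apply]
        simpa using hA_z hN (wd F l)
    rw [this]; simp
  · intro i hi
    have : hBL N (f3 F N (e3 F i)) = 0 := by
      match i, hi with
      | .inl l, hi =>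
        rw [e3, f3_apply]
        simpa using hB_pure N hi.2
      | .inr (.inl l), hi =>
        rw [e3, f3_apply, consL_wd]
        simpa using hB_one_pure hN hi.2.2
      | .inr (.inr l), hi =>
        rw [e3, f3_apply]
        simpa using hB_z hN (wd F l)
    rw [this]; simp
  · intro l hl
    by_cases h0 : rkW N w l = 0
    · rw [(NB_cases hg w l hl).1 h0]; exact zero_mem _
    · have : {j | j ∈ ok3 N w ∧ 0 < rkW N w l} = ok3 N w := by
        ext j; simp [Nat.pos_of_ne_zero h0]
      rw [this]
      have hPc : Submodule.span F (e3 F '' ok3 N w) = Submodule.span F (e3 F '' ok3 N w) := rfl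
      refine sub_mem ?_ ?_
      · have h1 := hA_mem (F := F) hN w l hl
        refine map_span_image (e3 F) (ok3 N w) (d3 β) _ ?_ _ h1
        intro i hi
        rw [hP]
        match i, hi with
        | .inl l, hi =>
          rw [e3, d3_apply]
          exact ⟨d_pure hg w l hi, by simp, by simp⟩
        | .inr (.inl l), hi =>
          rw [e3, d3_apply]
          refine ⟨by simp, ?_, by simp⟩
          have := d_pure hg (w - 1) l (shift1 l hi)
          rw [← shift1' hi.1] at this
          exact neg_mem this
        | .inr (.inr l), hi =>
          rw [e3, d3_apply]
          refine ⟨by simp, by simp, ?_⟩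
          refine Submodule.span_mono (Set.image_mono ?_) (dWL_mem β (w - N) l hi.2)
          exact fun v hv => ⟨hi.1, hv⟩
      · exact map_span_image (wd F) (okW w) (hAL N) _ (hA_mem hN w) _ (dWL_mem β w l hl)
  · intro l hl
    exact (NB_cases hg w l hl).2

theorem okW_finite (w : ℕ) : (okW w).Finite := by
  induction w using Nat.strong_induction_on with
  | _ w ih =>
    have : okW w ⊆ {[]} ∪ ⋃ m ∈ Finset.Icc 1 w, (fun l => m :: l) '' okW (w - m) := by
      intro l hl
      cases l with
      | nil => left; rfl
      | cons m l =>
        have h := okW_cons.1 hl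
        right
        simp only [Set.mem_iUnion]
        exact ⟨m, Finset.mem_Icc.2 ⟨h.1, h.2.1⟩, l, h.2.2, rfl⟩
    refine Set.Finite.subset (Set.Finite.union (Set.finite_singleton _) ?_) this
    refine Set.Finite.biUnion (Finset.finite_toSet _) ?_
    intro m hm
    have hm' := Finset.mem_Icc.1 hm
    exact (ih (w - m) (by omega)).image _

theorem spW_fin {S : Set (List ℕ)} (hS : S.Finite) : FiniteDimensional F (spW F S) :=
  FiniteDimensional.span_of_finite F (hS.image _)

/-- dimension of the homology of the word complex in weight `w` -/
noncomputable def XW (β : ℕ → ℕ → F) (w : ℕ) : ℕ := Module.finrank F (HH (dWL β) (spW F (okW w)))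

theorem hh_empty {M : Type*} [AddCommGroup M] [Module F M] (d : M →ₗ[F] M) :
    Module.finrank F (HH d (⊥ : Submodule F M)) = 0 := by
  have : Subsingleton (HH d (⊥ : Submodule F M)) := by
    have : Subsingleton ↥((⊥ : Submodule F M) ⊓ LinearMap.ker d) := by
      rw [bot_inf_eq]; infer_instance
    exact Function.Surjective.subsingleton (Submodule.mkQ_surjective _)
  exact Module.finrank_zero_of_subsingleton

theorem XW_rec (hg : GoodB β N) (w : ℕ) : XW β w =
    Module.finrank F (HH (dWL β) (spW F (S1 N w))) +
    (if 1 ≤ w then Module.finrank F (HH (dWL β) (spW F (S1 N (w - 1)))) else 0) +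
    (if N ≤ w then XW β (w - N) else 0) := by
  obtain ⟨e⟩ := main_equiv hg w
  rw [XW, ← e.finrank_eq, sp3_eq]
  have f1 : (S1 N w).Finite := (okW_finite w).subset fun l hl => hl.1
  have f2 : (S2 N w).Finite := (okW_finite (w - 1)).subset fun l hl => hl.2.1
  have f3 : (S3 N w).Finite := (okW_finite (w - N)).subset fun l hl => hl.2
  have := spW_fin (F := F) f1
  have := spW_fin (F := F) f2
  have := spW_fin (F := F) f3
  obtain ⟨e1⟩ := hh_prod (dWL β) (spW F (S1 N w)) ((-dWL β).prodMap (dWL β))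
    ((spW F (S2 N w)).prod (spW F (S3 N w)))
  obtain ⟨e2⟩ := hh_prod (-dWL β) (spW F (S2 N w)) (dWL β) (spW F (S3 N w))
  obtain ⟨e4⟩ := hh_neg (dWL β) (spW F (S2 N w))
  have q1 := hh_finite (dWL β) (spW F (S1 N w))
  have q2 := hh_finite (-dWL β) (spW F (S2 N w))
  have q3 := hh_finite (dWL β) (spW F (S3 N w))
  have q4 : FiniteDimensional F (HH ((-dWL β).prodMap (dWL β))
    ((spW F (S2 N w)).prod (spW F (S3 N w)))) := FiniteDimensional.of_injective e2.toLinearMap e2.injective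
  rw [d3, e1.finrank_eq, Module.finrank_prod, e2.finrank_eq, Module.finrank_prod, e4.finrank_eq,
    add_assoc]
  congr 2
  · split_ifs with h
    · have : S2 N w = S1 N (w - 1) := by
        ext l; exact ⟨fun hl => ⟨hl.2.1, hl.2.2⟩, fun hl => ⟨h, hl.1, hl.2⟩⟩
      rw [this]
    · have : S2 N w = ∅ := by
        ext l; exact ⟨fun hl => h hl.1, fun hl => hl.elim⟩
      rw [this, spW, Set.image_empty, Submodule.span_empty, hh_empty]
  · split_ifs with h
    · have : S3 N w = okW (w - N) := by
        ext l; exact ⟨fun hl => hl.2, fun hl => ⟨h, hl⟩⟩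
      rw [this]; rfl
    · have : S3 N w = ∅ := by
        ext l; exact ⟨fun hl => h hl.1, fun hl => hl.elim⟩
      rw [this, spW, Set.image_empty, Submodule.span_empty, hh_empty]

end P6e

section P6f
set_option linter.unusedVariables false
set_option linter.unusedSimpArgs false
open Finsupp
variable {F : Type*} [Field F]

theorem hh_iso {M M' : Type*} [AddCommGroup M] [Module F M] [AddCommGroup M'] [Module F M']
    (d : M →ₗ[F] M) (P : Submodule F M) (d' : M' →ₗ[F] M') (P' : Submodule F M')
    (f : M →ₗ[F] M') (g : M' →ₗ[F] M) (hf : ∀ x ∈ P, f x ∈ P') (hg : ∀ x ∈ P', g x ∈ P)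
    (hgf : ∀ x ∈ P, g (f x) = x) (hfg : ∀ x ∈ P', f (g x) = x)
    (hP : ∀ x ∈ P, d x ∈ P)
    (hd : ∀ x ∈ P, f (d x) = d' (f x)) : Nonempty (HH d P ≃ₗ[F] HH d' P') := by
  refine hh_equiv d P d' P' f hf hd ?_ ?_
  · intro x hx _ y hy hxy
    refine ⟨g y, hg y hy, ?_⟩
    rw [← hgf x hx, ← hgf _ (hP _ (hg y hy)), hd _ (hg y hy), hfg y hy, hxy]
  · intro y hy h
    refine ⟨g y, hg y hy, ?_, 0, zero_mem _, by rw [hfg y hy]; simp⟩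
    rw [← hgf _ (hP _ (hg y hy)), hd _ (hg y hy), hfg y hy, h, map_zero]

theorem mem_okW {w : ℕ} {l : List ℕ} : l ∈ okW w ↔ (∀ m ∈ l, 0 < m) ∧ l.sum = w := Iff.rfl

theorem rescale (β β' : ℕ → ℕ → F) (u : ℕ → F) (hu : ∀ m, u m ≠ 0)
    (h : ∀ m a, 0 < a → a < m → β' m a * (u a * u (m - a)) = u m * β m a) (w : ℕ) :
    XW β' w = XW β w := by
  let U : List ℕ → F := fun l => (l.map u).prod
  have hU : ∀ l, U l ≠ 0 := by
    intro l
    simp only [U]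
    refine List.prod_ne_zero ?_
    simp [hu]
  let f : (List ℕ →₀ F) →ₗ[F] (List ℕ →₀ F) := lext F fun l => U l • wd F l
  let g : (List ℕ →₀ F) →ₗ[F] (List ℕ →₀ F) := lext F fun l => (U l)⁻¹ • wd F l
  have ef : ∀ l, f (wd F l) = U l • wd F l := fun l => lext_wd _ _
  have eg : ∀ l, g (wd F l) = (U l)⁻¹ • wd F l := fun l => lext_wd _ _
  have fcons : ∀ m x, f (consL m x) = u m • consL m (f x) := by
    intro m x
    have : f.comp (consL m) = u m • (consL m).comp f := by
      apply wd_ext; intro l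
      simp [ef, consL_wd, U, smul_smul]
    simpa using congrArg (fun k => k x) this
  have key : ∀ l, f (dWL β' (wd F l)) = dWL β (f (wd F l)) := by
    intro l
    induction l with
    | nil => rw [dWL_nil, map_zero, ef, map_smul, dWL_nil, smul_zero]
    | cons m l ih =>
      rw [dWL_cons, map_sub, fcons, ih, ← consL_wd m, fcons, map_smul, dWL_consL, smul_sub]
      congr 1
      rw [map_sum, Finset.smul_sum]
      refine Finset.sum_congr rfl fun a ha => ?_
      rw [Finset.mem_Ioo] at ha
      rw [map_smul, ← consL_wd, fcons, ← consL_wd, fcons, map_smul, smul_smul, smul_smul, smul_smul]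
      congr 1
      have := h m a ha.1 ha.2
      linear_combination this
  have fs : ∀ w, ∀ x ∈ spW F (okW w), f x ∈ spW F (okW w) := fun w =>
    map_span_image _ _ _ _ fun l hl => by rw [ef]; exact Submodule.smul_mem _ _ (wd_mem hl)
  have gs : ∀ w, ∀ x ∈ spW F (okW w), g x ∈ spW F (okW w) := fun w =>
    map_span_image _ _ _ _ fun l hl => by rw [eg]; exact Submodule.smul_mem _ _ (wd_mem hl)
  have gf : g.comp f = LinearMap.id := by
    apply wd_ext; intro l
    simp [ef, eg, smul_smul, hU l]
  have fg : f.comp g = LinearMap.id := by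
    apply wd_ext; intro l
    simp [ef, eg, smul_smul, hU l]
  have kk : f.comp (dWL β') = (dWL β).comp f := wd_ext key
  obtain ⟨e⟩ := hh_iso (dWL β') (spW F (okW w)) (dWL β) (spW F (okW w)) f g (fs w) (gs w)
    (fun x _ => by simpa using congrArg (fun k => k x) gf)
    (fun x _ => by simpa using congrArg (fun k => k x) fg)
    (map_span_image _ _ _ _ fun l hl => dWL_mem β' w l hl)
    (fun x _ => by simpa using congrArg (fun k => k x) kk)
  exact e.finrank_eq

theorem S1_dim {β : ℕ → ℕ → F} {N : ℕ} (hg : GoodB β N) (b : ℕ → ℕ → F)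
    (hb : ∀ m a, 0 < a → a < m → β (N * m) (N * a) = b m a) (w : ℕ) :
    Module.finrank F (HH (dWL β) (spW F (S1 N w))) = if N ∣ w then XW b (w / N) else 0 := by
  have hN := hg.two
  split_ifs with hw
  · obtain ⟨n, rfl⟩ := hw
    rw [Nat.mul_div_cancel_left _ (by omega)]
    let f : (List ℕ →₀ F) →ₗ[F] (List ℕ →₀ F) := lext F fun l => wd F (l.map (N * ·))
    let g : (List ℕ →₀ F) →ₗ[F] (List ℕ →₀ F) := lext F fun l => wd F (l.map (· / N))
    have ef : ∀ l, f (wd F l) = wd F (l.map (N * ·)) := fun l => lext_wd _ _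
    have eg : ∀ l, g (wd F l) = wd F (l.map (· / N)) := fun l => lext_wd _ _
    have fcons : ∀ m x, f (consL m x) = consL (N * m) (f x) := by
      intro m x
      have : f.comp (consL m) = (consL (N * m)).comp f := by
        apply wd_ext; intro l
        simp [ef, consL_wd]
      simpa using congrArg (fun k => k x) this
    have key : ∀ l, f (dWL b (wd F l)) = dWL β (f (wd F l)) := by
      intro l
      induction l with
      | nil => rw [dWL_nil, map_zero, ef, List.map_nil, dWL_nil]
      | cons m l ih =>
        rw [dWL_cons, map_sub, fcons, ih, ← consL_wd m, fcons, dWL_consL]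
        congr 1
        rw [map_sum]
        have hinj : Set.InjOn (N * ·) (Finset.Ioo 0 m : Set ℕ) := by
          intro x _ y _ h
          exact Nat.eq_of_mul_eq_mul_left (by omega) h
        rw [← Finset.sum_subset (s₁ := (Finset.Ioo 0 m).image (N * ·)) (s₂ := Finset.Ioo 0 (N * m)), Finset.sum_image hinj]
        · refine Finset.sum_congr rfl fun a ha => ?_
          rw [Finset.mem_Ioo] at ha
          rw [map_smul, ← consL_wd, fcons, ← consL_wd, fcons, hb m a ha.1 ha.2, Nat.mul_sub]
        · intro x hx
          simp only [Finset.mem_image, Finset.mem_Ioo] at hx ⊢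
          obtain ⟨a, ha, rfl⟩ := hx
          exact ⟨by have := ha.1; positivity, Nat.mul_lt_mul_of_pos_left ha.2 (by omega)⟩
        · intro x hx hx'
          rw [Finset.mem_Ioo] at hx
          by_cases h0 : β (N * m) x = 0
          · rw [h0, zero_smul]
          · exfalso
            have := hg.g3 _ _ hx.1 hx.2 h0
            rw [Nat.mul_mod_right, Nat.le_zero] at this
            obtain ⟨a, rfl⟩ := Nat.dvd_of_mod_eq_zero this
            apply hx'
            simp only [Finset.mem_image, Finset.mem_Ioo]
            exact ⟨a, ⟨Nat.pos_of_mul_pos_left hx.1, Nat.lt_of_mul_lt_mul_left hx.2⟩, rfl⟩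
    have kk : f.comp (dWL b) = (dWL β).comp f := wd_ext key
    have gf : g.comp f = LinearMap.id := by
      apply wd_ext; intro l
      simp only [LinearMap.comp_apply, ef, eg, LinearMap.id_apply, List.map_map]
      congr 1
      conv_rhs => rw [← List.map_id l]
      refine List.map_congr_left fun a _ => ?_
      simp only [Function.comp_apply, id]
      exact Nat.mul_div_cancel_left _ (by omega)
    obtain ⟨e⟩ := hh_iso (dWL b) (spW F (okW n)) (dWL β) (spW F (S1 N (N * n))) f g
      (map_span_image _ _ _ _ fun l hl => by
        rw [ef]
        refine wd_mem ⟨⟨?_, ?_⟩, ?_⟩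
        · intro m hm
          rw [List.mem_map] at hm
          obtain ⟨a, ha, rfl⟩ := hm
          have := hl.1 a ha
          positivity
        · rw [List.sum_map_mul_left, List.map_id', hl.2]
        · intro m hm
          rw [List.mem_map] at hm
          obtain ⟨a, ha, rfl⟩ := hm
          exact Nat.dvd_mul_right _ _)
      (map_span_image _ _ _ _ fun l hl => by
        rw [eg]
        refine wd_mem ⟨?_, ?_⟩
        · intro m hm
          rw [List.mem_map] at hm
          obtain ⟨a, ha, rfl⟩ := hm
          exact Nat.div_pos (Nat.le_of_dvd (hl.1.1 a ha) (hl.2 a ha)) (by omega)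
        · refine Nat.eq_of_mul_eq_mul_left (show 0 < N by omega) ?_
          rw [← List.sum_map_mul_left, ← hl.1.2]
          congr 1
          conv_rhs => rw [← List.map_id l]
          refine List.map_congr_left fun a ha => ?_
          exact Nat.mul_div_cancel' (hl.2 a ha))
      (fun x _ => by simpa using congrArg (fun k => k x) gf)
      (eq_span_image _ _ (f.comp g) LinearMap.id fun l hl => by
        simp only [LinearMap.comp_apply, ef, eg, LinearMap.id_apply, List.map_map]
        congr 1
        conv_rhs => rw [← List.map_id l]
        refine List.map_congr_left fun a ha => ?_
        exact Nat.mul_div_cancel' (hl.2 a ha))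
      (map_span_image _ _ _ _ fun l hl => dWL_mem b n l hl)
      (fun x _ => by simpa using congrArg (fun k => k x) kk)
    exact e.finrank_eq.symm
  · have : S1 N w = ∅ := by
      ext l
      refine ⟨fun hl => hw ?_, fun hl => hl.elim⟩
      rw [← hl.1.2]
      exact List.dvd_sum hl.2
    rw [this, spW, Set.image_empty, Submodule.span_empty, hh_empty]

theorem XW_rec2 {β : ℕ → ℕ → F} {N : ℕ} (hg : GoodB β N) (b : ℕ → ℕ → F)
    (hb : ∀ m a, 0 < a → a < m → β (N * m) (N * a) = b m a) (n r : ℕ) (hr : r < N) :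
    XW β (N * n + r) = if r ≤ 1 then ∑ j ∈ Finset.range (n + 1), XW b j else 0 := by
  have hN := hg.two
  have dv : ∀ k s, s < N → (N ∣ N * k + s ↔ s = 0) := by
    intro k s hs
    rw [Nat.dvd_add_right (Nat.dvd_mul_right _ _)]
    exact ⟨fun h => Nat.eq_zero_of_dvd_of_lt h hs, fun h => h ▸ dvd_zero _⟩
  have q1 : ∀ k s, s < N → (N * k + s) / N = k := by
    intro k s hs
    rw [Nat.mul_add_div (by omega), Nat.div_eq_of_lt hs, add_zero]
  have step : ∀ k, XW β (N * k + r) = (if r ≤ 1 then XW b k else 0) +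
      (if N ≤ N * k + r then XW β (N * k + r - N) else 0) := by
    intro k
    rw [XW_rec hg, S1_dim hg b hb, S1_dim hg b hb]
    congr 1
    simp only [dv k r hr, q1 k r hr]
    rcases r with _ | _ | r
    · simp only [add_zero, if_true, Nat.zero_le]
      cases k with
      | zero => simp
      | succ k =>
        have : N * (k + 1) - 1 = N * k + (N - 1) := by rw [Nat.mul_succ]; omega
        rw [this, if_neg (show ¬ (N ∣ N * k + (N - 1)) by rw [dv k _ (by omega)]; omega)]
        simp
    · have : N * k + (0 + 1) - 1 = N * k + 0 := by omega
      rw [this, if_pos (show N ∣ N * k + 0 by rw [dv k _ (by omega)]), q1 k 0 (by omega)]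
      simp
    · have : N * k + (r + 1 + 1) - 1 = N * k + (r + 1) := by omega
      rw [this, if_neg (show ¬ (N ∣ N * k + (r + 1)) by rw [dv k _ (by omega)]; omega)]
      simp
  induction n with
  | zero =>
    rw [step, if_neg (show ¬ N ≤ N * 0 + r by omega)]; simp
  | succ n ih =>
    rw [step, if_pos (show N ≤ N * (n + 1) + r by rw [Nat.mul_succ]; omega),
      show N * (n + 1) + r - N = N * n + r by rw [Nat.mul_succ]; omega, ih]
    split_ifs
    · rw [Finset.sum_range_succ _ (n + 1), add_comm]
    · rfl

/-- binomial coefficients -/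
def bC (F : Type*) [Field F] (m a : ℕ) : F := (m.choose a : F)

/-- q-binomial coefficients at q = -1 -/
def b2 (F : Type*) [Field F] (m a : ℕ) : F :=
  if a % 2 ≤ m % 2 then ((m / 2).choose (a / 2) : F) else 0

theorem choose_co (a b c : ℕ) : (a + b + c).choose a * (b + c).choose b =
    (a + b + c).choose (a + b) * (a + b).choose a := by
  have h := Nat.choose_mul (n := a + b + c) (k := a + b) (s := a) (by omega)
  rw [h, show a + b + c - a = b + c by omega, show a + b - a = b by omega]

theorem good_b2 : GoodB (b2 F) 2 where
  two := le_refl _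
  co := by
    intro a b c _ _ _
    have key : ∀ x y z : ℕ, (((x + y + z).choose x : ℕ) : F) * ((y + z).choose y : ℕ) =
        ((x + y + z).choose (x + y) : ℕ) * ((x + y).choose x : ℕ) := by
      intro x y z; rw [← Nat.cast_mul, choose_co, Nat.cast_mul]
    have ha := Nat.mod_add_div a 2
    have hb := Nat.mod_add_div b 2
    have hc := Nat.mod_add_div c 2
    generalize a / 2 = x at *
    generalize b / 2 = y at *
    generalize c / 2 = z at *
    have k := key x y z
    rcases Nat.mod_two_eq_zero_or_one a with h1 | h1 <;>
    rcases Nat.mod_two_eq_zero_or_one b with h2 | h2 <;>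
    rcases Nat.mod_two_eq_zero_or_one c with h3 | h3 <;>
    rw [h1] at ha <;> rw [h2] at hb <;> rw [h3] at hc <;>
    subst ha hb hc <;>
    simp only [b2]
    · rw [if_pos (by omega), if_pos (by omega), if_pos (by omega), if_pos (by omega)]
      convert k using 4 <;> omega
    · rw [if_pos (by omega), if_pos (by omega), if_pos (by omega), if_pos (by omega)]
      convert k using 4 <;> omega
    · rw [if_pos (by omega), if_pos (by omega), if_pos (by omega), if_pos (by omega)]
      convert k using 4 <;> omega
    · rw [if_neg (show ¬ (0 + 2 * x + (1 + 2 * y)) % 2 ≤ (0 + 2 * x + (1 + 2 * y) + (1 + 2 * z)) % 2 by omega),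
        if_neg (show ¬ (1 + 2 * y) % 2 ≤ (1 + 2 * y + (1 + 2 * z)) % 2 by omega)]
      simp
    · rw [if_pos (by omega), if_pos (by omega), if_pos (by omega), if_pos (by omega)]
      convert k using 4 <;> omega
    · rw [if_neg (show ¬ (1 + 2 * x) % 2 ≤ (1 + 2 * x + (0 + 2 * y) + (1 + 2 * z)) % 2 by omega),
        if_neg (show ¬ (1 + 2 * x + (0 + 2 * y)) % 2 ≤ (1 + 2 * x + (0 + 2 * y) + (1 + 2 * z)) % 2 by omega)]
      simp
    · rw [if_neg (show ¬ (1 + 2 * x) % 2 ≤ (1 + 2 * x + (1 + 2 * y) + (0 + 2 * z)) % 2 by omega),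
        if_neg (show ¬ (1 + 2 * x) % 2 ≤ (1 + 2 * x + (1 + 2 * y)) % 2 by omega)]
      simp
    · rw [if_neg (show ¬ (1 + 2 * y) % 2 ≤ (1 + 2 * y + (1 + 2 * z)) % 2 by omega),
        if_neg (show ¬ (1 + 2 * x) % 2 ≤ (1 + 2 * x + (1 + 2 * y)) % 2 by omega)]
      simp
  g1 := by
    intro m s t hm _ h1 h2
    have : s = 1 := by omega
    have : t = 0 := by omega
    subst_vars
    rw [b2, if_pos (by omega), show (m + 1) / 2 = m / 2 by omega]
    simp
  g2 := by
    intro m s a hm ha _ _ hs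
    rw [b2, b2, if_pos (by omega), if_pos (by omega), show (m + s) / 2 = m / 2 by omega]
  g3 := by
    intro m a _ _ h
    by_contra hc
    exact h (by rw [b2, if_neg hc])

theorem b2_b (m a : ℕ) : b2 F (2 * m) (2 * a) = bC F m a := by
  rw [b2, if_pos (by omega), bC, show 2 * m / 2 = m by omega, show 2 * a / 2 = a by omega]

section
variable (p : ℕ) [Fact p.Prime]

theorem fact_ne (r : ℕ) (h : r < p) : ((Nat.factorial r : ℕ) : ZMod p) ≠ 0 := by
  rw [Ne, ZMod.natCast_eq_zero_iff, (Fact.out : p.Prime).dvd_factorial]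
  omega

noncomputable def uP (m : ℕ) : ZMod p := ((Nat.factorial (m % p) : ℕ) : ZMod p)

theorem uP_ne (m : ℕ) : uP p m ≠ 0 := fact_ne p _ (Nat.mod_lt _ (Fact.out : p.Prime).pos)

noncomputable def bP' (m a : ℕ) : ZMod p := bC (ZMod p) m a * uP p a * uP p (m - a) * (uP p m)⁻¹

theorem lucas (m a : ℕ) : bC (ZMod p) m a =
    (((m % p).choose (a % p) : ℕ) : ZMod p) * (((m / p).choose (a / p) : ℕ) : ZMod p) := by
  have h := Choose.choose_modEq_choose_mod_mul_choose_div_nat (p := p) (n := m) (k := a)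
  rw [← ZMod.natCast_eq_natCast_iff] at h
  rw [bC, h]
  push_cast
  rfl

theorem good_bP : GoodB (bP' p) p where
  two := (Fact.out : p.Prime).two_le
  co := by
    intro a b c _ _ _
    have k : bC (ZMod p) (a + b + c) a * bC (ZMod p) (b + c) b =
        bC (ZMod p) (a + b + c) (a + b) * bC (ZMod p) (a + b) a := by
      simp only [bC]; exact_mod_cast congrArg (Nat.cast (R := ZMod p)) (choose_co a b c)
    simp only [bP']
    rw [show a + b + c - a = b + c by omega, show b + c - b = c by omega,
      show a + b + c - (a + b) = c by omega, show a + b - a = b by omega]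
    have h1 := uP_ne p (b + c)
    have h2 := uP_ne p (a + b)
    have h3 := uP_ne p (a + b + c)
    field_simp
    linear_combination (uP p a * uP p b * uP p c) * k
  g1 := by
    intro m s t hm _ h1 h2
    obtain ⟨k, rfl⟩ := hm
    have hp := (Fact.out : p.Prime).pos
    have e1 : (p * k + s) % p = s := by rw [Nat.mul_add_mod, Nat.mod_eq_of_lt h2]
    have e2 : (p * k + t) % p = t := by rw [Nat.mul_add_mod, Nat.mod_eq_of_lt (by omega)]
    have e3 : (p * k + s) / p = k := by rw [Nat.mul_add_div hp, Nat.div_eq_of_lt h2, add_zero]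
    have e4 : (p * k + t) / p = k := by
      rw [Nat.mul_add_div hp, Nat.div_eq_of_lt (by omega), add_zero]
    rw [bP', lucas, e1, e2, e3, e4, Nat.choose_self, uP, uP, uP, e1, e2,
      show p * k + s - (p * k + t) = s - t by omega, Nat.mod_eq_of_lt (show s - t < p by omega)]
    have := Nat.choose_mul_factorial_mul_factorial (le_of_lt h1)
    have h3 := fact_ne p s h2
    field_simp
    rw [← this]
    push_cast
    ring
  g2 := by
    intro m s a hm ha h1 h2 hs
    obtain ⟨k, rfl⟩ := hm
    obtain ⟨j, rfl⟩ := ha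
    have hp := (Fact.out : p.Prime).pos
    have hjk : j < k := Nat.lt_of_mul_lt_mul_left h2
    obtain ⟨i, rfl⟩ := Nat.exists_eq_add_of_lt hjk
    have f1 : p * (j + i + 1) + s - p * j = p * (i + 1) + s := by
      rw [show j + i + 1 = j + (i + 1) by ring, Nat.mul_add p j]; omega
    have f2 : p * (j + i + 1) - p * j = p * (i + 1) := by
      rw [show j + i + 1 = j + (i + 1) by ring, Nat.mul_add p j]; omega
    have e0 : ∀ k, (p * k + s) % p = s := fun k => by rw [Nat.mul_add_mod, Nat.mod_eq_of_lt hs]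
    have e3 : ∀ k, (p * k + s) / p = k := fun k => by
      rw [Nat.mul_add_div hp, Nat.div_eq_of_lt hs, add_zero]
    have e4 : ∀ k, p * k / p = k := fun k => Nat.mul_div_cancel_left _ hp
    have e5 : ∀ k, p * k % p = 0 := fun k => Nat.mul_mod_right _ _
    simp only [bP', lucas, f1, f2, uP, e0, e3, e4, e5]
    have h3 := fact_ne p s hs
    simp
    field_simp
  g3 := by
    intro m a _ _ h
    by_contra hc
    apply h
    rw [bP', lucas, Nat.choose_eq_zero_of_lt (by omega)]
    simp

theorem bP'_b (m a : ℕ) : bP' p (p * m) (p * a) = bC (ZMod p) m a := by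
  have hp := (Fact.out : p.Prime).pos
  rw [bP', lucas, uP, uP, uP, ← Nat.mul_sub, Nat.mul_div_cancel_left _ hp,
    Nat.mul_div_cancel_left _ hp]
  simp [bC]

theorem XW_bP (w : ℕ) : XW (bP' p) w = XW (bC (ZMod p)) w := by
  rw [← rescale (bP' p) (bC (ZMod p)) (fun m => uP p m) (uP_ne p)]
  intro m a _ _
  rw [bP']
  have := uP_ne p m
  field_simp

theorem numerics (q : ℕ) : XW (b2 (ZMod p)) (p * q) =
    ∑ i ∈ Finset.range (q + 1), XW (b2 (ZMod p)) i := by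
  have hp : p.Prime := Fact.out
  set d := XW (b2 (ZMod p)) with hd
  set e := XW (bC (ZMod p)) with he
  have D : ∀ n r, r < 2 → d (2 * n + r) = ∑ j ∈ Finset.range (n + 1), e j := by
    intro n r hr
    rw [hd, XW_rec2 good_b2 (bC (ZMod p)) (fun m a _ _ => b2_b m a) n r hr, if_pos (by omega)]
  have E : ∀ n r, r < p → e (p * n + r) =
      if r ≤ 1 then ∑ j ∈ Finset.range (n + 1), e j else 0 := by
    intro n r hr
    rw [he, ← XW_bP, XW_rec2 (good_bP p) (bC (ZMod p)) (fun m a _ _ => bP'_b p m a) n r hr]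
  have D' : ∀ n, d n = ∑ j ∈ Finset.range (n / 2 + 1), e j := by
    intro n
    rw [← D (n / 2) (n % 2) (by omega), Nat.div_add_mod]
  set S : ℕ → ℕ := fun n => ∑ j ∈ Finset.range (n + 1), e j with hS
  rcases hp.eq_two_or_odd with h2 | h2
  · subst h2
    rw [show 2 * q = 2 * q + 0 by rfl, D q 0 (by omega)]
    refine Finset.sum_congr rfl fun i _ => ?_
    rw [D', ← Nat.div_add_mod i 2, E _ _ (by omega), if_pos (by omega)]
    rw [show (2 * (i / 2) + i % 2) / 2 = i / 2 by omega]
  · obtain ⟨t, ht⟩ : ∃ t, p = 2 * t + 1 := ⟨p / 2, by omega⟩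
    have ht0 : 0 < t := by have := hp.two_le; omega
    -- partial sums over a residue block
    have blk : ∀ n r, r < p → 1 ≤ r → S (p * n + r) = S (p * n) + S n := by
      intro n r hr h1
      induction r with
      | zero => omega
      | succ r ih =>
        have : S (p * n + (r + 1)) = S (p * n + r) + e (p * n + (r + 1)) := by
          simp only [hS]; rw [← add_assoc, Finset.sum_range_succ]
        rw [this, E n (r + 1) hr]
        rcases Nat.eq_zero_or_pos r with h | h
        · subst h; rw [if_pos (by omega)]
        · rw [if_neg (by omega), ih (by omega) (by omega), add_zero]
    have blk0 : ∀ n, S (p * (n + 1)) = S (p * n) + S n + S (n + 1) := by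
      intro n
      have e1 : p * (n + 1) = p * n + (p - 1) + 1 := by rw [Nat.mul_succ]; omega
      have : S (p * (n + 1)) = S (p * n + (p - 1)) + e (p * (n + 1)) := by
        simp only [hS]; rw [e1, Finset.sum_range_succ]
      rw [this, blk n (p - 1) (by omega) (by omega), show p * (n + 1) = p * (n + 1) + 0 by rfl,
        E (n + 1) 0 (by omega), if_pos (by omega)]
    have hm : ∀ q, ∑ i ∈ Finset.range (2 * q + 1), d i = S (p * q) ∧
        ∑ i ∈ Finset.range (2 * q + 2), d i = S (p * q + t) := by
      intro q
      induction q with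
      | zero =>
        have a0 : d 0 = S 0 := D' 0
        have a1 : d 1 = S 0 := D' 1
        have a2 := blk 0 t (by omega) ht0
        simp only [Nat.mul_zero, Nat.zero_add] at a2 ⊢
        rw [a2, Finset.sum_range_one, Finset.sum_range_succ, Finset.sum_range_one, a0, a1]
        exact ⟨rfl, rfl⟩
      | succ q ih =>
        have a0 : d (2 * q + 2) = S (q + 1) := by
          rw [D', show (2 * q + 2) / 2 = q + 1 by omega]
        have a1 : d (2 * q + 3) = S (q + 1) := by
          rw [D', show (2 * q + 3) / 2 = q + 1 by omega]
        have a2 := blk q t (by omega) ht0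
        have a3 := blk (q + 1) t (by omega) ht0
        have a4 : ∑ i ∈ Finset.range (2 * (q + 1) + 1), d i = S (p * (q + 1)) := by
          rw [show 2 * (q + 1) + 1 = (2 * q + 2) + 1 by ring, Finset.sum_range_succ, ih.2, a0, a2,
            blk0]
        refine ⟨a4, ?_⟩
        rw [show 2 * (q + 1) + 2 = (2 * (q + 1) + 1) + 1 by ring, Finset.sum_range_succ, a4, a3,
          show 2 * (q + 1) + 1 = 2 * q + 3 by ring, a1]
    rw [D']
    change S (p * q / 2) = _
    rcases Nat.even_or_odd' q with ⟨n, h | h⟩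
    · rw [h, (hm n).1]
      congr 1
      rw [show p * (2 * n) = 2 * (p * n) by ring]; omega
    · rw [h, show 2 * n + 1 + 1 = 2 * n + 2 by ring, (hm n).2]
      congr 1
      rw [show p * (2 * n + 1) = 2 * (p * n) + p by ring]; omega
end

end P6f

section P1a
set_option linter.unusedVariables false
set_option linter.unusedSimpArgs false
open CategoryTheory AlgebraicTopology DirectSum

variable {F : Type} [Field F] (C : ChainComplex (ModuleCat.{0} F) ℕ)

theorem cx_cyc (i j : ℕ) (hij : (ComplexShape.down ℕ).next i = j) (x : C.X i)
    (hx : C.d i j x = 0) : ∃ c : C.cycles i, C.iCycles i c = x := by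
  have h := C.cyclesIsKernel i j hij
  have ex := ShortComplex.exact_of_f_is_kernel
    (ShortComplex.mk (C.iCycles i) (C.d i j) (by simp)) h
  rw [ShortComplex.moduleCat_exact_iff] at ex
  exact ex x hx

theorem cx_bd (i j : ℕ) (hij : (ComplexShape.down ℕ).prev j = i) (c : C.cycles j)
    (hc : C.homologyπ j c = 0) : ∃ y : C.X i, C.toCycles i j y = c := by
  have h := C.homologyIsCokernel i j hij
  have ex := ShortComplex.exact_of_g_is_cokernel
    (ShortComplex.mk (C.toCycles i j) (C.homologyπ j) (by simp)) h
  rw [ShortComplex.moduleCat_exact_iff] at ex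
  exact ex c hc

theorem cx_total (D : (⨁ i, C.X i) →ₗ[F] (⨁ i, C.X i))
    (h0 : ∀ x : C.X 0, D (lof F ℕ (fun i => C.X i) 0 x) = 0)
    (h1 : ∀ n (x : C.X (n + 1)), D (lof F ℕ (fun i => C.X i) (n + 1) x) =
      lof F ℕ (fun i => C.X i) n ((C.d (n + 1) n) x)) :
    Nonempty ((⨁ i, C.homology i) ≃ₗ[F] HH D ⊤) := by
  let P : (⨁ i, C.cycles i) →ₗ[F] (⨁ i, C.homology i) := lmap fun i => (C.homologyπ i).hom
  let I : (⨁ i, C.cycles i) →ₗ[F] (⨁ i, C.X i) := lmap fun i => (C.iCycles i).hom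
  have comp : ∀ y n, (D y) n = C.d (n + 1) n (y (n + 1)) := by
    intro y n
    have : (component F ℕ (fun i => C.X i) n).comp D =
      (C.d (n + 1) n).hom.comp (component F ℕ (fun i => C.X i) (n + 1)) := by
      refine linearMap_ext _ fun i => LinearMap.ext fun x => ?_
      simp only [LinearMap.comp_apply]
      cases i with
      | zero =>
        rw [h0, map_zero, component.of, dif_neg (by omega), map_zero]
      | succ m =>
        rw [h1]
        by_cases hm : m = n
        · subst hm
          rw [component.lof_self, component.lof_self]
        · rw [component.of, component.of, dif_neg hm, dif_neg (by omega), map_zero]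
    exact congrArg (fun f => f y) this
  have Pl : ∀ i c, P (lof F ℕ _ i c) = lof F ℕ _ i (C.homologyπ i c) := fun i c => lmap_lof _ _ _
  have Il : ∀ i c, I (lof F ℕ _ i c) = lof F ℕ _ i (C.iCycles i c) := fun i c => lmap_lof _ _ _
  have Pa : ∀ x i, P x i = C.homologyπ i (x i) := fun x i => rfl
  have Ia : ∀ x i, I x i = C.iCycles i (x i) := fun x i => rfl
  have inj : Function.Injective I := (lmap_injective _).2 fun i =>
    (ModuleCat.mono_iff_injective _).1 inferInstance
  have sur : Function.Surjective P := (lmap_surjective _).2 fun i =>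
    (ModuleCat.epi_iff_surjective _).1 inferInstance
  have di : ∀ i j (c : C.cycles i), C.d i j (C.iCycles i c) = 0 := by
    intro i j c
    have := C.iCycles_d i j
    exact congrArg (fun f => f.hom c) this
  have ti : ∀ i j (y : C.X i), C.iCycles j (C.toCycles i j y) = C.d i j y := by
    intro i j c
    have := C.toCycles_i i j
    exact congrArg (fun f => f.hom c) this
  have tp : ∀ i j (y : C.X i), C.homologyπ j (C.toCycles i j y) = 0 := by
    intro i j c
    have := C.toCycles_comp_homologyπ i j
    exact congrArg (fun f => f.hom c) this
  have ID : ∀ x, D (I x) = 0 := by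
    intro x
    refine DFinsupp.ext fun n => ?_
    change (D (I x)) n = 0
    rw [comp, Ia, di]
  let J : (⨁ i, C.cycles i) →ₗ[F] ↥(⊤ ⊓ LinearMap.ker D) :=
    I.codRestrict _ fun x => ⟨trivial, ID x⟩
  let Q : (⨁ i, C.cycles i) →ₗ[F] HH D ⊤ := (Submodule.mkQ _).comp J
  have Jsur : Function.Surjective J := by
    rintro ⟨x, -, hx⟩
    classical
    have hc : ∀ i, ∃ c : C.cycles i, C.iCycles i c = x i := by
      intro i
      cases i with
      | zero =>
        refine cx_cyc C 0 _ rfl _ ?_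
        have : C.d 0 ((ComplexShape.down ℕ).next 0) = 0 := C.shape _ _ (by simp)
        rw [this]; rfl
      | succ n =>
        refine cx_cyc C (n + 1) n (ChainComplex.next_nat_succ n) _ ?_
        rw [← comp, LinearMap.mem_ker.1 hx]; rfl
    choose c hc using hc
    refine ⟨∑ i ∈ x.support, lof F ℕ _ i (c i), Subtype.ext ?_⟩
    change I _ = x
    rw [map_sum]
    conv_rhs => rw [← sum_support_of x]
    refine Finset.sum_congr rfl fun i _ => ?_
    rw [Il, hc]; rfl
  have Qsur : Function.Surjective Q := (Submodule.mkQ_surjective _).comp Jsur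
  have ker : LinearMap.ker P = LinearMap.ker Q := by
    ext x
    rw [LinearMap.mem_ker, LinearMap.mem_ker]
    have : Q x = 0 ↔ ∃ y, D y = I x := by
      change Submodule.Quotient.mk (J x) = 0 ↔ _
      rw [Submodule.Quotient.mk_eq_zero, Submodule.mem_comap, Submodule.mem_map]
      exact ⟨fun ⟨y, _, h⟩ => ⟨y, h⟩, fun ⟨y, h⟩ => ⟨y, trivial, h⟩⟩
    rw [this]
    constructor
    · intro h
      classical
      have hb : ∀ i, ∃ y : C.X (i + 1), C.toCycles (i + 1) i y = x i := by
        intro i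
        refine cx_bd C (i + 1) i (ChainComplex.prev _ _) _ ?_
        rw [← Pa, h]; rfl
      choose b hb using hb
      refine ⟨∑ i ∈ x.support, lof F ℕ _ (i + 1) (b i), ?_⟩
      rw [map_sum]
      conv_rhs => rw [← sum_support_of x]
      rw [map_sum]
      refine Finset.sum_congr rfl fun i _ => ?_
      rw [h1, ← ti, hb]
      exact (Il _ _).symm
    · rintro ⟨y, hy⟩
      refine DFinsupp.ext fun n => ?_
      change P x n = 0
      have h2 : C.iCycles n (x n) = C.iCycles n (C.toCycles (n + 1) n (y (n + 1))) := by
        rw [ti, ← comp, hy]; rfl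
      have h3 := (ModuleCat.mono_iff_injective (C.iCycles n)).1 inferInstance h2
      rw [Pa, h3, tp]
  exact ⟨(P.quotKerEquivOfSurjective sur).symm ≪≫ₗ
    (Submodule.quotEquivOfEq _ _ ker) ≪≫ₗ (Q.quotKerEquivOfSurjective Qsur)⟩

end P1a

section P1b
set_option linter.unusedVariables false
set_option linter.unusedSimpArgs false
open CategoryTheory AlgebraicTopology DirectSum

/-- singular simplices of all dimensions -/
abbrev Sg (X : Type) [TopologicalSpace X] : Type := Σ n : ℕ, C(stdSimplex ℝ (Fin (n + 1)), X)

/-- the map of simplices induced by a map of vertices -/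
noncomputable def sMap {a b : ℕ} (f : Fin a → Fin b) : C(stdSimplex ℝ (Fin a), stdSimplex ℝ (Fin b)) :=
  ⟨stdSimplex.map f, stdSimplex.continuous_map f⟩

variable {X : Type} [TopologicalSpace X] {F : Type} [Field F]

noncomputable def faceS {n : ℕ} (s : C(stdSimplex ℝ (Fin (n + 1 + 1)), X)) (i : Fin (n + 2)) :
    C(stdSimplex ℝ (Fin (n + 1)), X) := s.comp (sMap (Fin.succAbove i))

noncomputable def sg (F : Type) [Field F] {n : ℕ} (s : C(stdSimplex ℝ (Fin (n + 1)), X)) : Sg X →₀ F :=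
  Finsupp.single ⟨n, s⟩ 1

noncomputable def dSb (F : Type) [Field F] : Sg X → (Sg X →₀ F)
  | ⟨0, s⟩ => 0
  | ⟨n + 1, s⟩ => ∑ i : Fin (n + 2), (-1 : F) ^ (i : ℕ) • sg F (faceS s i)

noncomputable def dS (F : Type) [Field F] (X : Type) [TopologicalSpace X] : (Sg X →₀ F) →ₗ[F] (Sg X →₀ F) :=
  lext F (dSb F)

theorem dS_zero (s : C(stdSimplex ℝ (Fin (0 + 1)), X)) : dS F X (sg F s) = 0 := lext_single _ _

theorem dS_succ {n : ℕ} (s : C(stdSimplex ℝ (Fin (n + 1 + 1)), X)) :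
    dS F X (sg F s) = ∑ i : Fin (n + 2), (-1 : F) ^ (i : ℕ) • sg F (faceS s i) := lext_single _ _

/-- identification of n-simplices -/
noncomputable def smpE (X : Type) [TopologicalSpace X] (n : ℕ) :
    ((TopCat.toSSet.obj (TopCat.of X)).obj (Opposite.op (SimplexCategory.mk n))) ≃ C(stdSimplex ℝ (Fin (n + 1)), X) :=
  TopCat.toSSetObjEquiv (TopCat.of X) (Opposite.op (SimplexCategory.mk n))

theorem smpE_face (n : ℕ) (i : Fin (n + 2))
    (s : (TopCat.toSSet.obj (TopCat.of X)).obj (Opposite.op (SimplexCategory.mk (n + 1)))) :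
    smpE X n ((TopCat.toSSet.obj (TopCat.of X)).δ i s) = faceS (smpE X (n + 1) s) i := by
  rfl

/-- the simplicial module -/
noncomputable abbrev sYm (F : Type) [Field F] (X : Type) [TopologicalSpace X] :
    SimplicialObject (ModuleCat.{0} F) :=
  ((SimplicialObject.whiskering _ _).obj (ModuleCat.free F)).obj (TopCat.toSSet.obj (TopCat.of X))

theorem hom_sum_app {M N : ModuleCat.{0} F} {ι : Type} [Fintype ι] (c : ι → ℤ) (f : ι → (M ⟶ N)) (x : M) :
    (∑ i, c i • f i).hom x = ∑ i, c i • (f i).hom x := by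
  rw [ModuleCat.hom_sum, LinearMap.sum_apply]
  rfl

theorem chains_d (n : ℕ) (s : (TopCat.toSSet.obj (TopCat.of X)).obj (Opposite.op (SimplexCategory.mk (n + 1)))) :
    ((SingChains F X).d (n + 1) n).hom (Finsupp.single s 1) =
      (∑ i : Fin (n + 2), (-1 : F) ^ (i : ℕ) •
        Finsupp.single ((TopCat.toSSet.obj (TopCat.of X)).δ i s) (1 : F)) := by
  have h1 : (SingChains F X).d (n + 1) n =
    (∑ i : Fin (n + 2), (-1 : ℤ) ^ (i : ℕ) • (sYm F X).δ i :) :=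
    AlternatingFaceMapComplex.obj_d_eq (sYm F X) n
  rw [h1]
  have h2 : (∑ i : Fin (n + 2), (-1 : ℤ) ^ (i : ℕ) • (sYm F X).δ i :).hom (ModuleCat.freeMk s) =
    ∑ i : Fin (n + 2), (-1 : ℤ) ^ (i : ℕ) • ((sYm F X).δ i).hom (ModuleCat.freeMk s) := by
    exact hom_sum_app _ _ _
  refine h2.trans ?_
  refine Finset.sum_congr rfl fun i _ => ?_
  have h3 : ((sYm F X).δ i).hom (ModuleCat.freeMk s) =
    ModuleCat.freeMk ((TopCat.toSSet.obj (TopCat.of X)).δ i s) := ModuleCat.free_map_apply _ _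
  rw [h3]
  have h4 : ∀ (k : ℕ) {M : Type} [AddCommGroup M] [Module F M] (x : M),
      ((-1 : ℤ) ^ k) • x = ((-1 : F) ^ k) • x := by
    intro k M _ _ x
    rcases neg_one_pow_eq_or ℤ k with h | h
    · rw [h, one_smul]
      have := congrArg (Int.cast (R := F)) h
      push_cast at this
      rw [this, one_smul]
    · rw [h, neg_one_smul]
      have := congrArg (Int.cast (R := F)) h
      push_cast at this
      rw [this, neg_one_smul]
  exact h4 _ _

/-- the graded pieces -/
noncomputable def toT (F : Type) [Field F] (X : Type) [TopologicalSpace X] (n : ℕ) :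
    (SingChains F X).X n →ₗ[F] (Sg X →₀ F) :=
  Finsupp.lmapDomain F F (fun s => (⟨n, smpE X n s⟩ : Sg X))

theorem toT_single (n : ℕ) (s : (TopCat.toSSet.obj (TopCat.of X)).obj (Opposite.op (SimplexCategory.mk n))) :
    toT F X n (Finsupp.single s (1 : F)) = sg F (smpE X n s) := by
  exact Finsupp.mapDomain_single

theorem toT_d (n : ℕ) (x : (SingChains F X).X (n + 1)) :
    toT F X n (((SingChains F X).d (n + 1) n).hom x) = dS F X (toT F X (n + 1) x) := by
  have : (toT F X n).comp ((SingChains F X).d (n + 1) n).hom = (dS F X).comp (toT F X (n + 1)) := by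
    refine Finsupp.lhom_ext' fun s => LinearMap.ext_ring ?_
    refine (congrArg (toT F X n) (chains_d n s)).trans ?_
    refine Eq.trans ?_ (congrArg (dS F X) (toT_single (n + 1) s)).symm
    rw [dS_succ]
    refine (map_sum (toT F X n) _ _).trans ?_
    refine Finset.sum_congr rfl fun i _ => ?_
    refine (map_smul (toT F X n) _ _).trans ?_
    rw [← smpE_face]
    congr 1
    exact toT_single n _
  exact congrArg (fun f => f x) this

theorem toT_d0 (x : (SingChains F X).X 0) : dS F X (toT F X 0 x) = 0 := by
  have : (dS F X).comp (toT F X 0) = 0 := by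
    refine Finsupp.lhom_ext' fun s => LinearMap.ext_ring ?_
    refine (congrArg (dS F X) (toT_single 0 s)).trans (dS_zero _)
  exact congrArg (fun f => f x) this

theorem bridge : Module.finrank F (⨁ i, SHom F X i) = Module.finrank F (HH (dS F X) ⊤) := by
  let C := SingChains F X
  let D : (⨁ i, C.X i) →ₗ[F] (⨁ i, C.X i) := toModule F ℕ _ fun i => match i with
    | 0 => 0
    | n + 1 => (lof F ℕ (fun i => C.X i) n).comp (C.d (n + 1) n).hom
  have h0 : ∀ x : C.X 0, D (lof F ℕ (fun i => C.X i) 0 x) = 0 := by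
    intro x; rw [toModule_lof]; rfl
  have h1 : ∀ n (x : C.X (n + 1)), D (lof F ℕ (fun i => C.X i) (n + 1) x) =
      lof F ℕ (fun i => C.X i) n ((C.d (n + 1) n) x) := by
    intro n x; rw [toModule_lof]; rfl
  obtain ⟨e⟩ := cx_total C D h0 h1
  let f : (⨁ i, C.X i) →ₗ[F] (Sg X →₀ F) := toModule F ℕ _ fun i => toT F X i
  let g0 : ∀ n, C(stdSimplex ℝ (Fin (n + 1)), X) → C.X n := fun n s => Finsupp.single ((smpE X n).symm s) (1 : F)
  let g : (Sg X →₀ F) →ₗ[F] (⨁ i, C.X i) := lext F fun s =>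
    lof F ℕ (fun i => C.X i) s.1 (g0 s.1 s.2)
  have fl : ∀ i x, f (lof F ℕ _ i x) = toT F X i x := fun i x => toModule_lof _ _ _
  have gl : ∀ n s, g (sg F (n := n) s) = lof F ℕ (fun i => C.X i) n (g0 n s) := fun n s =>
    lext_single _ _
  have tg : ∀ n s, toT F X n (g0 n s) = sg F s := by
    intro n s
    rw [toT_single, Equiv.apply_symm_apply]
  have gf : g.comp f = LinearMap.id := by
    refine linearMap_ext _ fun i => ?_
    refine Finsupp.lhom_ext' fun s => LinearMap.ext_ring ?_
    refine (congrArg g (fl i _)).trans ?_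
    refine (congrArg g (toT_single i s)).trans ?_
    rw [gl]
    simp only [g0, Equiv.symm_apply_apply]
    rfl
  have fg : f.comp g = LinearMap.id := by
    refine Finsupp.lhom_ext' fun s => LinearMap.ext_ring ?_
    obtain ⟨n, s⟩ := s
    refine (congrArg f (gl n s)).trans ?_
    rw [fl, tg]
    rfl
  have fd : f.comp D = (dS F X).comp f := by
    refine linearMap_ext _ fun i => LinearMap.ext fun x => ?_
    simp only [LinearMap.comp_apply]
    cases i with
    | zero => rw [h0, map_zero, fl, toT_d0]
    | succ n => rw [h1, fl, fl, ← toT_d]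
  obtain ⟨e2⟩ := hh_iso D ⊤ (dS F X) ⊤ f g (fun _ _ => trivial) (fun _ _ => trivial)
    (fun x _ => congrArg (fun k => k x) gf) (fun x _ => congrArg (fun k => k x) fg)
    (fun _ _ => trivial) (fun x _ => congrArg (fun k => k x) fd)
  exact (e.trans e2).finrank_eq

end P1b

section P2a
set_option linter.unusedVariables false
set_option linter.unusedSimpArgs false

abbrev Dl (n : ℕ) : Type := stdSimplex ℝ (Fin n)

/-- affine simplex with given vertices -/
noncomputable def affC {k m : ℕ} (u : Fin k → Dl m) : C(Dl k, Dl m) where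
  toFun t := ⟨fun j => ∑ i, t.1 i * (u i).1 j, by
    constructor
    · intro j
      exact Finset.sum_nonneg fun i _ => mul_nonneg (t.2.1 i) ((u i).2.1 j)
    · rw [Finset.sum_comm]
      simp only [← Finset.mul_sum, (u _).2.2, mul_one]
      exact t.2.2⟩
  continuous_toFun := by
    refine Continuous.subtype_mk (continuous_pi fun j => ?_) _
    refine continuous_finsetSum _ fun i _ => ?_
    exact ((continuous_apply i).comp continuous_subtype_val).mul continuous_const

theorem affC_val {k m : ℕ} (u : Fin k → Dl m) (t : Dl k) (j : Fin m) :
    (affC u t).1 j = ∑ i, t.1 i * (u i).1 j := rfl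

theorem affC_val' {k m : ℕ} (u : Fin k → Dl m) (t : Dl k) :
    (affC u t).1 = ∑ i, t.1 i • (u i).1 := by
  ext j; simp [affC_val]

theorem affC_comp {k l m : ℕ} (u : Fin l → Dl m) (w : Fin k → Dl l) :
    (affC u).comp (affC w) = affC (fun i => affC u (w i)) := by
  refine ContinuousMap.ext fun t => Subtype.ext (funext fun j => ?_)
  simp only [ContinuousMap.comp_apply, affC_val, Finset.sum_mul, Finset.mul_sum]
  rw [Finset.sum_comm]
  exact Finset.sum_congr rfl fun _ _ => Finset.sum_congr rfl fun _ _ => by ring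

theorem affC_vertex {k m : ℕ} (u : Fin k → Dl m) (i : Fin k) :
    affC u (stdSimplex.vertex i) = u i := by
  refine Subtype.ext (funext fun j => ?_)
  rw [affC_val, Finset.sum_eq_single i]
  · simp
  · intro b _ hb; simp [Pi.single_eq_of_ne hb]
  · simp

theorem affC_id {k : ℕ} : affC (fun i : Fin k => (stdSimplex.vertex i : Dl k)) = ContinuousMap.id _ := by
  refine ContinuousMap.ext fun t => Subtype.ext (funext fun j => ?_)
  rw [affC_val, Finset.sum_eq_single j]
  · simp
  · intro b _ hb; simp [Pi.single_eq_of_ne hb.symm]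
  · simp

theorem sMap_eq {a b : ℕ} (f : Fin a → Fin b) :
    sMap f = affC (fun i => (stdSimplex.vertex (f i) : Dl b)) := by
  refine ContinuousMap.ext fun t => Subtype.ext (funext fun j => ?_)
  rw [affC_val]
  change FunOnFinite.linearMap ℝ ℝ f t j = _
  rw [FunOnFinite.linearMap_apply_apply, Finset.sum_filter]
  refine Finset.sum_congr rfl fun i _ => ?_
  simp only [Pi.single_apply]
  by_cases h : f i = j
  · rw [if_pos h, if_pos h.symm, mul_one]; rfl
  · rw [if_neg h, if_neg (Ne.symm h), mul_zero]

theorem affC_sMap {a b m : ℕ} (u : Fin b → Dl m) (f : Fin a → Fin b) :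
    (affC u).comp (sMap f) = affC (u ∘ f) := by
  rw [sMap_eq, affC_comp]
  simp only [affC_vertex]
  rfl

variable {F : Type} [Field F]

/-- augmented affine chains, on an arbitrary vertex set -/
abbrev LC (F : Type) [Field F] (K : Type) : Type := (Σ k : ℕ, Fin k → K) →₀ F

noncomputable def lc (F : Type) [Field F] {K : Type} {k : ℕ} (u : Fin k → K) : LC F K :=
  Finsupp.single ⟨k, u⟩ 1

theorem lc_ext {K M : Type} [AddCommGroup M] [Module F M] {f g : LC F K →ₗ[F] M}
    (h : ∀ k (u : Fin k → K), f (lc F u) = g (lc F u)) : f = g :=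
  Finsupp.lhom_ext' fun s => LinearMap.ext_ring (h s.1 s.2)

noncomputable def bdb (F : Type) [Field F] {K : Type} : (Σ k : ℕ, Fin k → K) → LC F K
  | ⟨0, u⟩ => 0
  | ⟨k + 1, u⟩ => ∑ i : Fin (k + 1), (-1 : F) ^ (i : ℕ) • lc F (u ∘ Fin.succAbove i)

noncomputable def bd (F : Type) [Field F] (K : Type) : LC F K →ₗ[F] LC F K := lext F (bdb F)

theorem bd_zero {K : Type} (u : Fin 0 → K) : bd F K (lc F u) = 0 := lext_single _ _
theorem bd_succ {K : Type} {k : ℕ} (u : Fin (k + 1) → K) : bd F K (lc F u) =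
    ∑ i : Fin (k + 1), (-1 : F) ^ (i : ℕ) • lc F (u ∘ Fin.succAbove i) := lext_single _ _

noncomputable def cone (F : Type) [Field F] {K : Type} (b : K) : LC F K →ₗ[F] LC F K :=
  lext F fun s => lc F (Fin.cons b s.2 : Fin (s.1 + 1) → K)

theorem cone_lc {K : Type} (b : K) {k : ℕ} (u : Fin k → K) :
    cone F b (lc F u) = lc F (Fin.cons b u : Fin (k + 1) → K) := lext_single _ _

theorem bd_cone_lc {K : Type} (b : K) {k : ℕ} (u : Fin k → K) :
    bd F K (cone F b (lc F u)) = lc F u - cone F b (bd F K (lc F u)) := by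
  rw [cone_lc, bd_succ, Fin.sum_univ_succ]
  have h0 : (Fin.cons b u : Fin (k + 1) → K) ∘ Fin.succAbove 0 = u := by
    ext i; simp
  rw [h0]
  cases k with
  | zero => rw [bd_zero]; simp
  | succ k =>
    rw [bd_succ, map_sum, sub_eq_add_neg, ← Finset.sum_neg_distrib]
    simp only [Fin.val_zero, pow_zero, one_smul]
    congr 1
    refine Finset.sum_congr rfl fun i _ => ?_
    rw [map_smul, cone_lc, ← neg_smul]
    have : (Fin.cons b u : Fin (k + 2) → K) ∘ Fin.succAbove i.succ =
        (Fin.cons b (u ∘ Fin.succAbove i) : Fin (k + 1) → K) := by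
      ext j
      refine Fin.cases ?_ (fun j => ?_) j
      · simp
      · simp [Fin.succ_succAbove_succ]
    rw [this, Fin.val_succ, pow_succ]
    simp

theorem bd_cone {K : Type} (b : K) (x : LC F K) :
    bd F K (cone F b x) = x - cone F b (bd F K x) := by
  have : (bd F K).comp (cone F b) = LinearMap.id - (cone F b).comp (bd F K) :=
    lc_ext fun k u => bd_cone_lc b u
  exact congrArg (fun f => f x) this

theorem bd_bd_lc {K : Type} : ∀ {k : ℕ} (u : Fin k → K), bd F K (bd F K (lc F u)) = 0
  | 0, u => by rw [bd_zero, map_zero]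
  | k + 1, u => by
    have : lc F u = cone F (u 0) (lc F (Fin.tail u)) := by
      rw [cone_lc, Fin.cons_self_tail]
    rw [this, bd_cone, map_sub, bd_cone, bd_bd_lc]
    simp

theorem bd_bd {K : Type} (x : LC F K) : bd F K (bd F K x) = 0 := by
  have : (bd F K).comp (bd F K) = 0 := lc_ext fun k u => bd_bd_lc u
  exact congrArg (fun f => f x) this

/-- barycenter -/
noncomputable def bary {k m : ℕ} (u : Fin (k + 1) → Dl m) : Dl m := affC u stdSimplex.barycenter

/-- barycentric subdivision of affine simplices -/
noncomputable def sdB (F : Type) [Field F] {m : ℕ} : (k : ℕ) → (Fin k → Dl m) → LC F (Dl m)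
  | 0, u => lc F u
  | k + 1, u => cone F (bary u) (∑ i : Fin (k + 1), (-1 : F) ^ (i : ℕ) • sdB F k (u ∘ Fin.succAbove i))

noncomputable def hmB (F : Type) [Field F] {m : ℕ} : (k : ℕ) → (Fin k → Dl m) → LC F (Dl m)
  | 0, u => 0
  | k + 1, u => cone F (bary u)
      (lc F u - ∑ i : Fin (k + 1), (-1 : F) ^ (i : ℕ) • hmB F k (u ∘ Fin.succAbove i))

noncomputable def sdL (F : Type) [Field F] (m : ℕ) : LC F (Dl m) →ₗ[F] LC F (Dl m) :=
  lext F fun s => sdB F s.1 s.2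
noncomputable def hmL (F : Type) [Field F] (m : ℕ) : LC F (Dl m) →ₗ[F] LC F (Dl m) :=
  lext F fun s => hmB F s.1 s.2

theorem sdL_lc {m k : ℕ} (u : Fin k → Dl m) : sdL F m (lc F u) = sdB F k u := lext_single _ _
theorem hmL_lc {m k : ℕ} (u : Fin k → Dl m) : hmL F m (lc F u) = hmB F k u := lext_single _ _

theorem sdL_zero {m : ℕ} (u : Fin 0 → Dl m) : sdL F m (lc F u) = lc F u := by
  rw [sdL_lc, sdB]
theorem hmL_zero {m : ℕ} (u : Fin 0 → Dl m) : hmL F m (lc F u) = 0 := by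
  rw [hmL_lc, hmB]

theorem sdL_succ {m k : ℕ} (u : Fin (k + 1) → Dl m) :
    sdL F m (lc F u) = cone F (bary u) (sdL F m (bd F _ (lc F u))) := by
  rw [sdL_lc, sdB, bd_succ, map_sum (sdL F m)]
  simp only [map_smul, sdL_lc]

theorem hmL_succ {m k : ℕ} (u : Fin (k + 1) → Dl m) :
    hmL F m (lc F u) = cone F (bary u) (lc F u - hmL F m (bd F _ (lc F u))) := by
  rw [hmL_lc, hmB, bd_succ, map_sum]
  simp only [map_smul, hmL_lc]

/-- if a linear identity holds on all simplices with k vertices, it holds on boundaries -/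
theorem on_bd {m k : ℕ} {M : Type} [AddCommGroup M] [Module F M] (f g : LC F (Dl m) →ₗ[F] M)
    (h : ∀ u : Fin k → Dl m, f (lc F u) = g (lc F u)) (u : Fin (k + 1) → Dl m) :
    f (bd F _ (lc F u)) = g (bd F _ (lc F u)) := by
  rw [bd_succ, map_sum, map_sum]
  exact Finset.sum_congr rfl fun i _ => by rw [map_smul, map_smul, h]

theorem bd_sd_lc {m : ℕ} : ∀ {k : ℕ} (u : Fin k → Dl m),
    bd F _ (sdL F m (lc F u)) = sdL F m (bd F _ (lc F u))
  | 0, u => by rw [sdL_zero, bd_zero, map_zero]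
  | k + 1, u => by
    have := on_bd ((bd F _).comp (sdL F m)) ((sdL F m).comp (bd F _)) (fun u => bd_sd_lc u) u
    simp only [LinearMap.comp_apply] at this
    rw [sdL_succ, bd_cone, this, bd_bd, map_zero, map_zero, sub_zero]

theorem bd_hm_lc {m : ℕ} : ∀ {k : ℕ} (u : Fin k → Dl m),
    bd F _ (hmL F m (lc F u)) + hmL F m (bd F _ (lc F u)) = lc F u - sdL F m (lc F u)
  | 0, u => by rw [sdL_zero, bd_zero, map_zero, hmL_zero]; simp
  | k + 1, u => by
    have := on_bd ((bd F _).comp (hmL F m) + (hmL F m).comp (bd F _)) (LinearMap.id - sdL F m)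
      (fun u => bd_hm_lc u) u
    simp only [LinearMap.comp_apply, LinearMap.add_apply, LinearMap.sub_apply, LinearMap.id_apply,
      bd_bd, map_zero, add_zero] at this
    rw [hmL_succ, bd_cone, map_sub, this, sub_sub_cancel, sdL_succ]
    abel

/-- functoriality in the vertices -/
noncomputable def lmp (F : Type) [Field F] {K K' : Type} (f : K → K') : LC F K →ₗ[F] LC F K' :=
  lext F fun s => lc F (f ∘ s.2)

theorem lmp_lc {K K' : Type} (f : K → K') {k : ℕ} (u : Fin k → K) :
    lmp F f (lc F u) = lc F (f ∘ u) := lext_single _ _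

theorem lmp_cone {K K' : Type} (f : K → K') (b : K) (x : LC F K) :
    lmp F f (cone F b x) = cone F (f b) (lmp F f x) := by
  have : (lmp F f).comp (cone F b) = (cone F (f b)).comp (lmp F f) := by
    refine lc_ext fun k u => ?_
    simp only [LinearMap.comp_apply, cone_lc, lmp_lc]
    congr 1
    ext j
    refine Fin.cases ?_ (fun j => ?_) j <;> simp
  exact congrArg (fun f => f x) this

theorem bary_aff {k l m : ℕ} (u : Fin l → Dl m) (w : Fin (k + 1) → Dl l) :
    bary (affC u ∘ w) = affC u (bary w) := by
  have := affC_comp u w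
  exact (congrArg (fun f => f stdSimplex.barycenter) this).symm

theorem sd_nat {l m : ℕ} (v : Fin l → Dl m) : ∀ {k : ℕ} (u : Fin k → Dl l),
    lmp F (affC v) (sdB F k u) = sdB F k (affC v ∘ u)
  | 0, u => by rw [sdB, sdB, lmp_lc]
  | k + 1, u => by
    rw [sdB, sdB, lmp_cone, bary_aff, map_sum]
    simp only [map_smul, sd_nat]
    rfl

theorem hm_nat {l m : ℕ} (v : Fin l → Dl m) : ∀ {k : ℕ} (u : Fin k → Dl l),
    lmp F (affC v) (hmB F k u) = hmB F k (affC v ∘ u)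
  | 0, u => by rw [hmB, hmB, map_zero]
  | k + 1, u => by
    rw [hmB, hmB, lmp_cone, bary_aff, map_sub, map_sum, lmp_lc]
    simp only [map_smul, hm_nat]
    rfl

end P2a

section P2b
set_option linter.unusedVariables false
set_option linter.unusedSimpArgs false

variable {F : Type} [Field F] {X : Type} [TopologicalSpace X]

/-- basis element -/
noncomputable abbrev bs (F : Type) [Field F] {ι : Type} (i : ι) : ι →₀ F := Finsupp.single i 1

/-- span of basis elements -/
noncomputable abbrev spn (F : Type) [Field F] {ι : Type} (S : Set ι) : Submodule F (ι →₀ F) :=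
  Submodule.span F ((fun i => bs F i) '' S)

theorem bs_mem {ι : Type} {S : Set ι} {i : ι} (h : i ∈ S) : bs F i ∈ spn F S :=
  Submodule.subset_span ⟨i, h, rfl⟩

theorem spn_map {ι M : Type} [AddCommGroup M] [Module F M] {S : Set ι} (f : (ι →₀ F) →ₗ[F] M)
    (Q : Submodule F M) (h : ∀ i ∈ S, f (bs F i) ∈ Q) : ∀ x ∈ spn F S, f x ∈ Q :=
  map_span_image _ S f Q h

theorem spn_univ {ι : Type} : spn F (Set.univ : Set ι) = ⊤ := by
  rw [eq_top_iff]
  intro x _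
  induction x using Finsupp.induction_linear with
  | zero => exact zero_mem _
  | add f g hf hg => exact add_mem (hf trivial) (hg trivial)
  | single a b =>
    have : Finsupp.single a b = b • bs F a := by simp
    rw [this]
    exact Submodule.smul_mem _ _ (bs_mem trivial)

theorem bs_ext {ι M : Type} [AddCommGroup M] [Module F M] {f g : (ι →₀ F) →ₗ[F] M}
    (h : ∀ i, f (bs F i) = g (bs F i)) : f = g :=
  Finsupp.lhom_ext' fun s => LinearMap.ext_ring (h s)

noncomputable def pushB (F : Type) [Field F] {m : ℕ} (σ : C(Dl m, X)) : (Σ k : ℕ, Fin k → Dl m) → (Sg X →₀ F)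
  | ⟨0, u⟩ => 0
  | ⟨k + 1, u⟩ => sg F (σ.comp (affC u))

noncomputable def push (F : Type) [Field F] {m : ℕ} (σ : C(Dl m, X)) : LC F (Dl m) →ₗ[F] (Sg X →₀ F) :=
  lext F (pushB F σ)

theorem push_zero {m : ℕ} (σ : C(Dl m, X)) (u : Fin 0 → Dl m) : push F σ (lc F u) = 0 := lext_single _ _
theorem push_succ {m k : ℕ} (σ : C(Dl m, X)) (u : Fin (k + 1) → Dl m) :
    push F σ (lc F u) = sg F (σ.comp (affC u)) := lext_single _ _

theorem dS_push {m : ℕ} (σ : C(Dl m, X)) (x : LC F (Dl m)) :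
    dS F X (push F σ x) = push F σ (bd F _ x) := by
  have : (dS F X).comp (push F σ) = (push F σ).comp (bd F _) := by
    refine lc_ext fun k u => ?_
    simp only [LinearMap.comp_apply]
    match k, u with
    | 0, u => rw [push_zero, bd_zero, map_zero, map_zero]
    | 1, u =>
      rw [push_succ, dS_zero, bd_succ, map_sum, Fin.sum_univ_one, map_smul, push_zero, smul_zero]
    | k + 2, u =>
      rw [push_succ, dS_succ, bd_succ, map_sum]
      refine Finset.sum_congr rfl fun i _ => ?_
      rw [map_smul, push_succ]
      congr 2
      rw [faceS, ContinuousMap.comp_assoc, affC_sMap]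
  exact congrArg (fun f => f x) this

/-- standard vertices -/
noncomputable abbrev vtx (n : ℕ) : Fin n → Dl n := fun i => stdSimplex.vertex i

theorem push_vtx {n : ℕ} (σ : C(Dl (n + 1), X)) : push F σ (lc F (vtx (n + 1))) = sg F σ := by
  rw [push_succ, affC_id, ContinuousMap.comp_id]

theorem push_comp {m l : ℕ} (σ : C(Dl m, X)) (v : Fin l → Dl m) (x : LC F (Dl l)) :
    push F (σ.comp (affC v)) x = push F σ (lmp F (affC v) x) := by
  have : push F (σ.comp (affC v)) = (push F σ).comp (lmp F (affC v)) := by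
    refine lc_ext fun k u => ?_
    simp only [LinearMap.comp_apply, lmp_lc]
    match k, u with
    | 0, u => rw [push_zero, push_zero]
    | k + 1, u =>
      rw [push_succ, push_succ, ContinuousMap.comp_assoc, affC_comp]
      rfl
  exact congrArg (fun f => f x) this

noncomputable def sdS (F : Type) [Field F] (X : Type) [TopologicalSpace X] :
    (Sg X →₀ F) →ₗ[F] (Sg X →₀ F) :=
  lext F fun s => push F s.2 (sdB F _ (vtx _))
noncomputable def hmS (F : Type) [Field F] (X : Type) [TopologicalSpace X] :
    (Sg X →₀ F) →ₗ[F] (Sg X →₀ F) :=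
  lext F fun s => push F s.2 (hmB F _ (vtx _))

theorem sdS_sg {n : ℕ} (s : C(Dl (n + 1), X)) : sdS F X (sg F s) = push F s (sdB F _ (vtx _)) :=
  lext_single _ _
theorem hmS_sg {n : ℕ} (s : C(Dl (n + 1), X)) : hmS F X (sg F s) = push F s (hmB F _ (vtx _)) :=
  lext_single _ _

theorem aff_vtx {k m : ℕ} (u : Fin k → Dl m) : affC u ∘ vtx k = u := by
  ext i : 1
  exact affC_vertex u i

theorem sdS_push {m : ℕ} (σ : C(Dl m, X)) (x : LC F (Dl m)) :
    sdS F X (push F σ x) = push F σ (sdL F m x) := by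
  have : (sdS F X).comp (push F σ) = (push F σ).comp (sdL F m) := by
    refine lc_ext fun k u => ?_
    simp only [LinearMap.comp_apply]
    match k, u with
    | 0, u => rw [push_zero, sdL_zero, map_zero, push_zero]
    | k + 1, u => rw [push_succ, sdS_sg, push_comp, sd_nat, aff_vtx, sdL_lc]
  exact congrArg (fun f => f x) this

theorem hmS_push {m : ℕ} (σ : C(Dl m, X)) (x : LC F (Dl m)) :
    hmS F X (push F σ x) = push F σ (hmL F m x) := by
  have : (hmS F X).comp (push F σ) = (push F σ).comp (hmL F m) := by
    refine lc_ext fun k u => ?_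
    simp only [LinearMap.comp_apply]
    match k, u with
    | 0, u => rw [push_zero, hmL_zero, map_zero, map_zero]
    | k + 1, u => rw [push_succ, hmS_sg, push_comp, hm_nat, aff_vtx, hmL_lc]
  exact congrArg (fun f => f x) this

theorem dS_dS (x : Sg X →₀ F) : dS F X (dS F X x) = 0 := by
  have : (dS F X).comp (dS F X) = 0 := by
    refine bs_ext fun ⟨n, s⟩ => ?_
    change dS F X (dS F X (sg F s)) = 0
    rw [← push_vtx, dS_push, dS_push, bd_bd, map_zero]
  exact congrArg (fun f => f x) this

theorem dS_sdS (x : Sg X →₀ F) : dS F X (sdS F X x) = sdS F X (dS F X x) := by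
  have : (dS F X).comp (sdS F X) = (sdS F X).comp (dS F X) := by
    refine bs_ext fun ⟨n, s⟩ => ?_
    change dS F X (sdS F X (sg F s)) = sdS F X (dS F X (sg F s))
    rw [← push_vtx, dS_push, sdS_push, sdS_push, dS_push, bd_sd_lc]
  exact congrArg (fun f => f x) this

theorem dS_hmS (x : Sg X →₀ F) : dS F X (hmS F X x) + hmS F X (dS F X x) = x - sdS F X x := by
  have : (dS F X).comp (hmS F X) + (hmS F X).comp (dS F X) = LinearMap.id - sdS F X := by
    refine bs_ext fun ⟨n, s⟩ => ?_
    change dS F X (hmS F X (sg F s)) + hmS F X (dS F X (sg F s)) = sg F s - sdS F X (sg F s)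
    rw [← push_vtx, dS_push, hmS_push, hmS_push, dS_push, sdS_push, ← map_add, ← map_sub, bd_hm_lc]
  exact congrArg (fun f => f x) this

/-- small simplices -/
def Sm {J : Type} (U : J → Set X) : Set (Sg X) := {s | ∃ i, ∀ t, s.2 t ∈ U i}

variable {J : Type} (U : J → Set X)

theorem push_small {m : ℕ} (σ : C(Dl m, X)) (i : J) (h : ∀ t, σ t ∈ U i) (x : LC F (Dl m)) :
    push F σ x ∈ spn F (Sm U) := by
  refine spn_map (S := Set.univ) (push F σ) _ ?_ x (by rw [spn_univ]; trivial)
  rintro ⟨k, u⟩ _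
  match k, u with
  | 0, u => 
    have : push F σ (bs F ⟨0, u⟩) = 0 := push_zero σ u
    rw [this]; exact zero_mem _
  | k + 1, u =>
    have : push F σ (bs F ⟨k + 1, u⟩) = bs F (⟨k, σ.comp (affC u)⟩ : Sg X) := push_succ σ u
    rw [this]
    exact bs_mem ⟨i, fun t => h _⟩

theorem small_of {f : (Sg X →₀ F) →ₗ[F] (Sg X →₀ F)}
    (hf : ∀ n (s : C(Dl (n + 1), X)), ∃ x, f (sg F s) = push F s x) : ∀ x ∈ spn F (Sm U), f x ∈ spn F (Sm U) := by
  refine spn_map f _ ?_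
  rintro ⟨n, s⟩ ⟨i, hi⟩
  obtain ⟨x, hx⟩ := hf n s
  change f (sg F s) ∈ _
  rw [hx]
  exact push_small U s i hi x

theorem dS_small : ∀ x ∈ spn F (Sm U), dS F X x ∈ spn F (Sm U) :=
  small_of U fun n s => ⟨bd F _ (lc F (vtx _)), by rw [← dS_push, push_vtx]⟩
theorem sdS_small : ∀ x ∈ spn F (Sm U), sdS F X x ∈ spn F (Sm U) :=
  small_of U fun n s => ⟨_, sdS_sg s⟩
theorem hmS_small : ∀ x ∈ spn F (Sm U), hmS F X x ∈ spn F (Sm U) :=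
  small_of U fun n s => ⟨_, hmS_sg s⟩

/-! mesh -/

theorem dist_val {m : ℕ} (a b : Dl m) : dist a b = ‖a.1 - b.1‖ := by
  rw [Subtype.dist_eq, dist_eq_norm]

theorem dist_aff {k m : ℕ} (u : Fin k → Dl m) (t : Dl k) (z : Dl m) (c : Fin k → ℝ)
    (h : ∀ j, dist (u j) z ≤ c j) : dist (affC u t) z ≤ ∑ j, t.1 j * c j := by
  rw [dist_val, affC_val']
  have h1 : z.1 = ∑ j, t.1 j • z.1 := by
    rw [← Finset.sum_smul, t.2.2, one_smul]
  rw [h1, ← Finset.sum_sub_distrib]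
  refine (norm_sum_le _ _).trans (Finset.sum_le_sum fun j _ => ?_)
  rw [← smul_sub, norm_smul, Real.norm_of_nonneg (t.2.1 j)]
  refine mul_le_mul_of_nonneg_left ?_ (t.2.1 j)
  rw [← dist_val]; exact h j

theorem dist_aff' {k m : ℕ} (u : Fin k → Dl m) (t : Dl k) (z : Dl m) (c : ℝ)
    (h : ∀ j, dist (u j) z ≤ c) : dist (affC u t) z ≤ c := by
  have := dist_aff u t z (fun _ => c) h
  rwa [← Finset.sum_mul, t.2.2, one_mul] at this

theorem dist_bary {k m : ℕ} (u : Fin (k + 1) → Dl m) (r : ℝ) (h : ∀ i j, dist (u i) (u j) ≤ r) (i : Fin (k + 1)) :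
    dist (u i) (bary u) ≤ k / (k + 1) * r := by
  rw [dist_comm]
  refine (dist_aff u _ (u i) (fun j => if j = i then 0 else r) ?_).trans ?_
  · intro j
    split_ifs with hj
    · rw [hj, dist_self]
    · exact h j i
  · have hb : ∀ j, (stdSimplex.barycenter : Dl (k + 1)).1 j = 1 / (k + 1 : ℝ) := by
      intro j
      simp
    simp only [hb]
    rw [← Finset.mul_sum, Finset.sum_ite, Finset.sum_const_zero, zero_add, Finset.sum_const]
    have : (Finset.univ.filter fun j : Fin (k + 1) => ¬ j = i).card = k := by
      rw [Finset.filter_ne' Finset.univ i, Finset.card_erase_of_mem (Finset.mem_univ _)]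
      simp
    rw [this, nsmul_eq_mul]
    apply le_of_eq
    ring

/-- subdivided pieces -/
def fine {m k : ℕ} (u : Fin k → Dl m) (c : ℝ) : Set (Σ k : ℕ, Fin k → Dl m) :=
  {s | s.1 = k ∧ (∀ i j, dist (s.2 i) (s.2 j) ≤ c) ∧ ∀ z c', (∀ j, dist (u j) z ≤ c') → ∀ i, dist (s.2 i) z ≤ c'}

theorem sd_fine {m N : ℕ} (r : ℝ) (hr : 0 ≤ r) : ∀ (k : ℕ) (u : Fin k → Dl m), k ≤ N + 1 →
    (∀ i j, dist (u i) (u j) ≤ r) → sdB F k u ∈ spn F (fine u (N / (N + 1) * r))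
  | 0, u, _, h => by
    rw [sdB]
    exact bs_mem (i := (⟨0, u⟩ : Σ k : ℕ, Fin k → Dl m)) ⟨rfl, fun i => i.elim0, fun z c h i => h i⟩
  | k + 1, u, hk, h => by
    rw [sdB, map_sum]
    refine sum_mem fun i _ => ?_
    rw [map_smul]
    refine Submodule.smul_mem _ _ ?_
    refine spn_map (cone F (bary u)) _ ?_ _ (sd_fine (N := N) r hr k (u ∘ Fin.succAbove i) (by omega) fun i j => h _ _)
    rintro ⟨l, v⟩ ⟨hl, h1, h2⟩
    have e : cone F (bary u) (bs F ⟨l, v⟩) = bs F ⟨l + 1, (Fin.cons (bary u) v : Fin (l + 1) → Dl m)⟩ := cone_lc _ _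
    rw [e]
    refine bs_mem ⟨by simpa using hl, ?_, ?_⟩
    · have hkN : (k : ℝ) / (k + 1) ≤ N / (N + 1) := by
        rw [div_le_div_iff₀ (by positivity) (by positivity)]
        have : (k : ℝ) ≤ N := by exact_mod_cast (by omega : k ≤ N)
        nlinarith
      have hb : ∀ j, dist (v j) (bary u) ≤ N / (N + 1) * r := by
        refine h2 _ _ fun j => (dist_bary u r h _).trans ?_
        exact mul_le_mul_of_nonneg_right hkN hr
      intro a b
      refine Fin.cases ?_ (fun a => ?_) a <;> refine Fin.cases ?_ (fun b => ?_) b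
      · simp only [Fin.cons_zero, dist_self]; positivity
      · simp only [Fin.cons_zero, Fin.cons_succ]; rw [dist_comm]; exact hb b
      · simp only [Fin.cons_zero, Fin.cons_succ]; exact hb a
      · simp only [Fin.cons_succ]; exact h1 a b
    · intro z c hz a
      refine Fin.cases ?_ (fun a => ?_) a
      · exact dist_aff' u _ z c hz
      · exact h2 z c (fun j => hz _) a

/-- simplices of mesh ≤ c with k vertices -/
def mesh (m k : ℕ) (c : ℝ) : Set (Σ k : ℕ, Fin k → Dl m) := {s | s.1 = k ∧ ∀ i j, dist (s.2 i) (s.2 j) ≤ c}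

theorem sd_iter {m N : ℕ} (r : ℝ) (hr : 0 ≤ r) (k : ℕ) (hk : k ≤ N + 1) (x : LC F (Dl m)) (hx : x ∈ spn F (mesh m k r)) (a : ℕ) :
    ((sdL F m)^[a]) x ∈ spn F (mesh m k ((N / (N + 1) : ℝ) ^ a * r)) := by
  induction a with
  | zero => simpa using hx
  | succ a ih =>
    rw [Function.iterate_succ_apply']
    refine spn_map (sdL F m) _ ?_ _ ih
    rintro ⟨l, v⟩ ⟨rfl, h⟩
    have e : sdL F m (bs F ⟨l, v⟩) = sdB F l v := sdL_lc v
    rw [e]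
    refine Submodule.span_mono (Set.image_mono ?_) (sd_fine (N := N) _ (by positivity) l v hk h)
    rintro s ⟨h1, h2, _⟩
    refine ⟨h1, fun i j => (h2 i j).trans (le_of_eq (by ring))⟩


theorem sdS_iter_push {m : ℕ} (σ : C(Dl m, X)) (x : LC F (Dl m)) (a : ℕ) :
    ((sdS F X)^[a]) (push F σ x) = push F σ ((sdL F m)^[a] x) := by
  induction a with
  | zero => rfl
  | succ a ih => rw [Function.iterate_succ_apply', Function.iterate_succ_apply', ih, sdS_push]

theorem ev_small_sg (hU : ∀ i, IsOpen (U i)) (hc : ∀ x, ∃ i, x ∈ U i) {n : ℕ} (s : C(Dl (n + 1), X)) : ∃ a, ((sdS F X)^[a]) (sg F s) ∈ spn F (Sm U) := by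
  obtain ⟨δ, hδ, hl⟩ := lebesgue_number_lemma_of_metric (s := (Set.univ : Set (Dl (n + 1)))) (c := fun i => s ⁻¹' (U i))
    isCompact_univ (fun i => (hU i).preimage s.continuous) (fun t _ => by
      obtain ⟨i, hi⟩ := hc (s t)
      exact Set.mem_iUnion.2 ⟨i, hi⟩)
  have hθ : (n / (n + 1) : ℝ) < 1 := by
    rw [div_lt_one (by positivity)]; linarith
  obtain ⟨a, ha⟩ := exists_pow_lt_of_lt_one (y := (n / (n + 1) : ℝ)) (x := δ / 2) (by positivity) hθ
  refine ⟨a, ?_⟩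
  rw [← push_vtx, sdS_iter_push]
  have h1 : lc F (vtx (n + 1)) ∈ spn F (mesh (n + 1) (n + 1) 1) := by
    refine bs_mem (i := (⟨n + 1, vtx (n + 1)⟩ : Σ k : ℕ, Fin k → Dl (n + 1))) ⟨rfl, fun i j => ?_⟩
    rw [dist_val, pi_norm_le_iff_of_nonneg (by norm_num)]
    intro l
    change ‖(Pi.single i (1 : ℝ) : Fin (n + 1) → ℝ) l - (Pi.single j (1 : ℝ) : Fin (n + 1) → ℝ) l‖ ≤ 1
    simp only [Pi.single_apply]
    split_ifs <;> simp
  have h2 := sd_iter (N := n) 1 zero_le_one (n + 1) le_rfl _ h1 a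
  refine spn_map (push F s) _ ?_ _ h2
  rintro ⟨k, v⟩ ⟨hk, hv⟩
  simp only at hk
  subst hk
  have e : push F s (bs F ⟨n + 1, v⟩) = bs F (⟨n, s.comp (affC v)⟩ : Sg X) := push_succ s v
  rw [e]
  obtain ⟨i, hi⟩ := hl (v 0) trivial
  refine bs_mem ⟨i, fun t => hi ?_⟩
  rw [Metric.mem_ball]
  refine lt_of_le_of_lt (dist_aff' v t (v 0) (δ / 2) fun j => (hv j 0).trans ?_) (by linarith)
  rw [mul_one]; exact ha.le

theorem iter_small (a b : ℕ) (x : Sg X →₀ F) (h : ((sdS F X)^[a]) x ∈ spn F (Sm U)) (hab : a ≤ b) :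
    ((sdS F X)^[b]) x ∈ spn F (Sm U) := by
  obtain ⟨c, rfl⟩ := Nat.exists_eq_add_of_le' hab
  rw [Function.iterate_add_apply]
  generalize ((sdS F X)^[a]) x = y at h
  induction c with
  | zero => exact h
  | succ c ih =>
    rw [Function.iterate_succ_apply']
    exact sdS_small U _ (ih (by omega))

theorem ev_small (hU : ∀ i, IsOpen (U i)) (hc : ∀ x, ∃ i, x ∈ U i) (x : Sg X →₀ F) : ∃ a, ((sdS F X)^[a]) x ∈ spn F (Sm U) := by
  induction x using Finsupp.induction_linear with
  | zero => exact ⟨0, zero_mem _⟩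
  | add f g hf hg =>
    obtain ⟨a, ha⟩ := hf
    obtain ⟨b, hb⟩ := hg
    refine ⟨a + b, ?_⟩
    rw [← Module.End.coe_pow, map_add, Module.End.coe_pow]
    exact add_mem (iter_small U a _ f ha (by omega)) (iter_small U b _ g hb (by omega))
  | single s b =>
    obtain ⟨a, ha⟩ := ev_small_sg (F := F) U hU hc s.2
    refine ⟨a, ?_⟩
    have : Finsupp.single s b = b • sg F s.2 := by simp [sg]
    rw [this, ← Module.End.coe_pow, map_smul, Module.End.coe_pow]
    exact Submodule.smul_mem _ _ ha

theorem homot (a : ℕ) : ∃ h : (Sg X →₀ F) →ₗ[F] (Sg X →₀ F), (∀ x, dS F X (h x) + h (dS F X x) = x - ((sdS F X)^[a]) x) ∧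
    ∀ x ∈ spn F (Sm U), h x ∈ spn F (Sm U) := by
  induction a with
  | zero => exact ⟨0, fun x => by simp, fun x _ => zero_mem _⟩
  | succ a ih =>
    obtain ⟨h, h1, h2⟩ := ih
    refine ⟨h.comp (sdS F X) + hmS F X, fun x => ?_, fun x hx => add_mem (h2 _ (sdS_small U x hx)) (hmS_small U x hx)⟩
    simp only [LinearMap.add_apply, LinearMap.comp_apply, map_add, Function.iterate_succ_apply]
    have e1 := h1 (sdS F X x)
    have e2 := dS_hmS x
    rw [dS_sdS] at e1
    rw [add_add_add_comm, e1, e2]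
    abel

/-- the theorem of small simplices -/
theorem small_simplices (hU : ∀ i, IsOpen (U i)) (hc : ∀ x, ∃ i, x ∈ U i) : Nonempty (HH (dS F X) (spn F (Sm U)) ≃ₗ[F] HH (dS F X) ⊤) := by
  refine hh_equiv _ _ _ _ LinearMap.id (fun _ _ => trivial) (fun _ _ => rfl) ?_ ?_
  · intro x hx hdx y _ hxy
    simp only [LinearMap.id_apply] at hxy
    obtain ⟨a, ha⟩ := ev_small U hU hc y
    obtain ⟨h, h1, h2⟩ := homot (F := F) U a
    refine ⟨((sdS F X)^[a]) y + h (dS F X y), add_mem ha (h2 _ (hxy ▸ hx)), ?_⟩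
    have e := h1 y
    have e2 : ((sdS F X)^[a]) y + h (dS F X y) = y - dS F X (h y) := by
      rw [eq_sub_iff_add_eq, ← sub_eq_zero] 
      rw [← sub_eq_zero] at e
      rw [← e]; abel_nf
    rw [e2, map_sub, dS_dS, sub_zero, hxy]
  · intro y _ hy
    obtain ⟨a, ha⟩ := ev_small U hU hc y
    obtain ⟨h, h1, h2⟩ := homot (F := F) U a
    have e := h1 y
    rw [hy, map_zero, add_zero] at e
    refine ⟨_, ha, ?_, h y, trivial, ?_⟩
    · have := congrArg (dS F X) e
      rw [dS_dS, map_sub, hy, zero_sub] at this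
      exact neg_eq_zero.1 this.symm
    · rw [e, LinearMap.id_apply]; abel

end P2b

section P3a
set_option linter.unusedVariables false
set_option linter.unusedSimpArgs false

/-- block index -/
def blk (G : Finset ℕ) (i : ℕ) : ℕ := (G.filter (· ≤ i)).card

theorem blk_mono (G : Finset ℕ) {i j : ℕ} (h : i ≤ j) : blk G i ≤ blk G j :=
  Finset.card_le_card fun g hg => by
    rw [Finset.mem_filter] at hg ⊢
    exact ⟨hg.1, hg.2.trans h⟩

theorem blk_lt_of {G : Finset ℕ} {i j g : ℕ} (hg : g ∈ G) (h1 : i < g) (h2 : g ≤ j) : blk G i < blk G j := by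
  refine Finset.card_lt_card ⟨fun g hg => ?_, fun h => ?_⟩
  · rw [Finset.mem_filter] at hg ⊢
    exact ⟨hg.1, by omega⟩
  · have := h (Finset.mem_filter.2 ⟨hg, h2⟩)
    rw [Finset.mem_filter] at this
    omega

theorem exists_of_blk_lt {G : Finset ℕ} {i j : ℕ} (h : blk G i < blk G j) : ∃ g ∈ G, i < g ∧ g ≤ j := by
  by_contra hc
  push Not at hc
  refine absurd h (not_lt.2 (Finset.card_le_card fun g hg => ?_))
  rw [Finset.mem_filter] at hg ⊢
  refine ⟨hg.1, ?_⟩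
  by_contra h'
  exact absurd hg.2 (not_le.2 (hc g hg.1 (by omega)))

theorem blk_eq_of {G : Finset ℕ} {i j : ℕ} (h : ∀ g ∈ G, (i < g ↔ j < g)) : blk G i = blk G j := by
  unfold blk
  congr 1
  refine Finset.filter_congr fun g hg => ?_
  have := h g hg
  omega

theorem lt_iff_of_blk_eq {G : Finset ℕ} {i j g : ℕ} (hg : g ∈ G) (h : blk G i = blk G j) : i < g ↔ j < g := by
  constructor
  · intro h1
    by_contra h2
    have := blk_lt_of hg h1 (not_lt.1 h2); omega
  · intro h1
    by_contra h2
    have := blk_lt_of hg h1 (not_lt.1 h2); omega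

theorem lt_of_blk_lt {G : Finset ℕ} {i j : ℕ} (h : blk G i < blk G j) : i < j := by
  by_contra h'
  exact absurd h (not_lt.2 (blk_mono G (not_lt.1 h')))

theorem blk_eq_sub {G G' : Finset ℕ} (hG : G ⊆ G') {i j : ℕ} (h : blk G' i = blk G' j) : blk G i = blk G j :=
  blk_eq_of fun g hg => lt_iff_of_blk_eq (hG hg) h

theorem blk_lt_sub {G G' : Finset ℕ} (hG : G ⊆ G') {i j : ℕ} (h : blk G i < blk G j) : blk G' i < blk G' j := by
  obtain ⟨g, hg, h1, h2⟩ := exists_of_blk_lt h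
  exact blk_lt_of (hG hg) h1 h2

variable {q : ℕ}

theorem p_ai (w : Equiv.Perm (Fin q)) (i : Fin q) : w (w⁻¹ i) = i := w.apply_symm_apply i
theorem p_ia (w : Equiv.Perm (Fin q)) (i : Fin q) : w⁻¹ (w i) = i := w.symm_apply_apply i

/-- block preserving -/
def Wp (G : Finset ℕ) (w : Equiv.Perm (Fin q)) : Prop := ∀ i, blk G (w i) = blk G i
/-- increasing on blocks -/
def Inc (G : Finset ℕ) (w : Equiv.Perm (Fin q)) : Prop := ∀ i j : Fin q, i < j → blk G i = blk G j → w i < w j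
/-- component labels -/
def Dp (G0 G1 : Finset ℕ) (w : Equiv.Perm (Fin q)) : Prop := Wp G0 w ∧ Inc G1 w

theorem perm_eq_one (w : Equiv.Perm (Fin q)) (h : StrictMono w) : w = 1 := by
  have h1 : (⇑w : Fin q → Fin q) = id := by
    exact (StrictMono.range_inj h strictMono_id).1 (by simp [w.surjective.range_eq])
  ext i
  rw [h1]; rfl

theorem Wp.lt {G : Finset ℕ} {w : Equiv.Perm (Fin q)} (h : Wp G w) {i j : Fin q} (hb : blk G i < blk G j) : w i < w j := by
  have : blk G (w i) < blk G (w j) := by rw [h, h]; exact hb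
  exact lt_of_blk_lt this

theorem Dp.one {G : Finset ℕ} {w : Equiv.Perm (Fin q)} (h : Dp G G w) : w = 1 := by
  refine perm_eq_one w fun i j hij => ?_
  rcases (blk_mono G hij.le).lt_or_eq with hb | hb
  · exact h.1.lt hb
  · exact h.2 i j hij hb

theorem Wp.mul {G : Finset ℕ} {w v : Equiv.Perm (Fin q)} (h : Wp G w) (h' : Wp G v) : Wp G (w * v) := by
  intro i
  rw [Equiv.Perm.mul_apply, h, h']

theorem Wp.inv {G : Finset ℕ} {w : Equiv.Perm (Fin q)} (h : Wp G w) : Wp G w⁻¹ := by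
  intro i
  have := h (w⁻¹ i)
  rw [p_ai] at this
  exact this.symm

theorem Wp.sub {G G' : Finset ℕ} (hG : G ⊆ G') {w : Equiv.Perm (Fin q)} (h : Wp G' w) : Wp G w :=
  fun i => blk_eq_sub hG (h i)

theorem Inc.sub {G G' : Finset ℕ} (hG : G ⊆ G') {w : Equiv.Perm (Fin q)} (h : Inc G w) : Inc G' w :=
  fun i j hij hb => h i j hij (blk_eq_sub hG hb)

theorem Inc.lt_iff {G : Finset ℕ} {w : Equiv.Perm (Fin q)} (h : Inc G w) {i j : Fin q} (hb : blk G i = blk G j) :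
    w i < w j ↔ i < j := by
  constructor
  · intro h1
    by_contra h2
    rcases (not_lt.1 h2).lt_or_eq with h3 | h3
    · exact absurd (h j i h3 hb.symm) (not_lt.2 h1.le)
    · rw [h3] at h1; exact lt_irrefl _ h1
  · exact fun h1 => h i j h1 hb

/-- composition of labels -/
theorem Dp.mul {G G' G'' : Finset ℕ} (h1 : G ⊆ G') (h2 : G' ⊆ G'') {d u : Equiv.Perm (Fin q)} (hd : Dp G G' d) (hu : Dp G' G'' u) :
    Dp G G'' (d * u) := by
  refine ⟨hd.1.mul (hu.1.sub h1), fun i j hij hb => ?_⟩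
  simp only [Equiv.Perm.mul_apply]
  refine hd.2 _ _ (hu.2 i j hij hb) ?_
  rw [hu.1, hu.1]
  exact blk_eq_sub h2 hb

/-- uniqueness of factorization -/
theorem Dp.unique {G G' G'' : Finset ℕ} {d u d' u' : Equiv.Perm (Fin q)} (hd : Dp G G' d) (hu : Dp G' G'' u)
    (hd' : Dp G G' d') (hu' : Dp G' G'' u') (h : d * u = d' * u') : d = d' ∧ u = u' := by
  have hv : u' * u⁻¹ = 1 := by
    refine Dp.one (G := G') ⟨hu'.1.mul hu.1.inv, fun i j hij hb => ?_⟩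
    have e : ∀ x, d' ((u' * u⁻¹) x) = d x := by
      intro x
      have := congrArg (fun f => f (u⁻¹ x)) h
      simp only [Equiv.Perm.mul_apply, p_ai] at this ⊢
      exact this.symm
    have h1 := hd.2 i j hij hb
    rw [← e, ← e] at h1
    refine (hd'.2.lt_iff ?_).1 h1
    rw [(hu'.1.mul hu.1.inv), (hu'.1.mul hu.1.inv), hb]
  have : u' = u := mul_inv_eq_one.1 hv
  subst this
  exact ⟨mul_right_cancel h, rfl⟩

/-- Lifted charts -/
def PG (q : ℕ) (G : Finset ℕ) : Set (Fin q → ℂ) :=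
  {f | ∀ i j : Fin q, i < j → (blk G i = blk G j → (f i).im < (f j).im) ∧ (blk G i < blk G j → (f i).re < (f j).re)}

noncomputable def cL (f : Fin q → ℂ) (i : Fin q) : ℕ := (Finset.univ.filter fun k => (f k).re < (f i).re).card

def Ag (f : Fin q → ℂ) (g : ℕ) : Prop := (Finset.univ.filter fun i => cL f i < g).card = g
def Bg (f : Fin q → ℂ) (G : Finset ℕ) : Prop :=
  ∀ i j, i ≠ j → (∀ g ∈ G, (cL f i < g ↔ cL f j < g)) → (f i).im ≠ (f j).im

theorem cL_perm (f : Fin q → ℂ) (w : Equiv.Perm (Fin q)) (i : Fin q) : cL (f ∘ w) i = cL f (w i) := by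
  unfold cL
  refine Finset.card_bij (fun k _ => w k) ?_ ?_ ?_
  · intro k hk; simpa using hk
  · intro a _ b _ h; exact w.injective h
  · intro b hb
    exact ⟨w⁻¹ b, by simpa using hb, by simp⟩

theorem Ag_perm (f : Fin q → ℂ) (w : Equiv.Perm (Fin q)) (g : ℕ) : Ag (f ∘ w) g ↔ Ag f g := by
  unfold Ag
  have : (Finset.univ.filter fun i => cL (f ∘ w) i < g).card = (Finset.univ.filter fun i => cL f i < g).card := by
    refine Finset.card_bij (fun k _ => w k) ?_ ?_ ?_
    · intro k hk; simpa [cL_perm] using hk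
    · intro a _ b _ h; exact w.injective h
    · intro b hb
      exact ⟨w⁻¹ b, by simpa [cL_perm] using hb, by simp⟩
  rw [this]

theorem Bg_perm (f : Fin q → ℂ) (w : Equiv.Perm (Fin q)) (G : Finset ℕ) (h : Bg f G) : Bg (f ∘ w) G := by
  intro i j hij hg
  simp only [cL_perm] at hg
  exact h (w i) (w j) (fun e => hij (w.injective e)) hg

theorem cL_mono (f : Fin q → ℂ) {i j : Fin q} (h : (f i).re ≤ (f j).re) : cL f i ≤ cL f j :=
  Finset.card_le_card fun k hk => by
    simp only [Finset.mem_filter, Finset.mem_univ, true_and] at hk ⊢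
    exact hk.trans_le h

theorem re_lt_of_cL (f : Fin q → ℂ) {i j : Fin q} (h : cL f i < cL f j) : (f i).re < (f j).re := by
  by_contra h'
  exact absurd h (not_lt.2 (cL_mono f (not_lt.1 h')))

theorem card_fin_lt (g : ℕ) (hg : g ≤ q) : (Finset.univ.filter fun i : Fin q => (i : ℕ) < g).card = g := by
  rw [Fin.card_filter_val_lt]
  omega

theorem PG_cL {G : Finset ℕ} (hG : G ⊆ Finset.Ico 1 q) {f : Fin q → ℂ} (hf : f ∈ PG q G) {g : ℕ} (hg : g ∈ G) (i : Fin q) :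
    cL f i < g ↔ (i : ℕ) < g := by
  have hq : g ≤ q := (Finset.mem_Ico.1 (hG hg)).2.le
  have hsep : ∀ a b : Fin q, (a : ℕ) < g → g ≤ (b : ℕ) → (f a).re < (f b).re := by
    intro a b ha hb
    exact (hf a b (by rw [Fin.lt_def]; omega)).2 (blk_lt_of hg ha hb)
  constructor
  · intro h
    by_contra h'
    push Not at h'
    refine absurd h (not_lt.2 ?_)
    conv_lhs => rw [← card_fin_lt g hq]
    refine Finset.card_le_card fun k hk => ?_
    simp only [Finset.mem_filter, Finset.mem_univ, true_and] at hk ⊢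
    exact hsep k i hk h'
  · intro h
    conv_rhs => rw [← card_fin_lt g hq]
    refine Finset.card_lt_card ⟨fun k hk => ?_, fun hs => ?_⟩
    · simp only [Finset.mem_filter, Finset.mem_univ, true_and] at hk ⊢
      by_contra h'
      exact absurd hk (not_lt.2 (hsep i k h (not_lt.1 h')).le)
    · have := hs (Finset.mem_filter.2 ⟨Finset.mem_univ i, h⟩)
      simp at this

theorem PG_AB {G : Finset ℕ} (hG : G ⊆ Finset.Ico 1 q) {f : Fin q → ℂ} (hf : f ∈ PG q G) :
    (∀ g ∈ G, Ag f g) ∧ Bg f G := by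
  constructor
  · intro g hg
    unfold Ag
    simp only [PG_cL hG hf hg]
    exact card_fin_lt g (Finset.mem_Ico.1 (hG hg)).2.le
  · intro i j hij h
    have hb : blk G i = blk G j := blk_eq_of fun g hg => by
      rw [← PG_cL hG hf hg, ← PG_cL hG hf hg]; exact h g hg
    rcases lt_or_gt_of_ne hij with h1 | h1
    · exact ((hf i j h1).1 hb).ne
    · exact ((hf j i h1).1 hb.symm).ne'

theorem lower_card (S : Finset (Fin q)) (h : ∀ a b, a < b → b ∈ S → a ∈ S) (i : Fin q) : i ∈ S ↔ (i : ℕ) < S.card := by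
  constructor
  · intro hi
    have : Finset.Iic i ⊆ S := fun a ha => by
      rcases (Finset.mem_Iic.1 ha).lt_or_eq with h1 | h1
      · exact h a i h1 hi
      · exact h1 ▸ hi
    have := Finset.card_le_card this
    rw [Fin.card_Iic] at this
    omega
  · intro hi
    by_contra h'
    have : S ⊆ Finset.Iio i := fun a ha => by
      rw [Finset.mem_Iio]
      by_contra h2
      rcases (not_lt.1 h2).lt_or_eq with h1 | h1
      · exact h' (h i a h1 ha)
      · exact h' (h1 ▸ ha)
    have := Finset.card_le_card this
    rw [Fin.card_Iio] at this
    omega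

theorem exists_sort {G : Finset ℕ} (hG : G ⊆ Finset.Ico 1 q) (f : Fin q → ℂ) (hA : ∀ g ∈ G, Ag f g) (hB : Bg f G) :
    ∃ w : Equiv.Perm (Fin q), f ∘ w ∈ PG q G := by
  let key : Fin q → ℕ ×ₗ ℝ := fun i => toLex (blk G (cL f i), (f i).im)
  have kinj : Function.Injective key := by
    intro i j hij
    by_contra hne
    have h1 := congrArg (fun x => (ofLex x).1) hij
    have h2 := congrArg (fun x => (ofLex x).2) hij
    simp only [key, ofLex_toLex] at h1 h2
    exact hB i j hne (fun g hg => lt_iff_of_blk_eq hg h1) h2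
  let w := Tuple.sort key
  have hmono : Monotone (key ∘ w) := Tuple.monotone_sort key
  have hs : StrictMono (key ∘ w) := hmono.strictMono_of_injective (kinj.comp w.injective)
  have hL : ∀ g ∈ G, ∀ i : Fin q, cL f (w i) < g ↔ (i : ℕ) < g := by
    intro g hg i
    have hc : (Finset.univ.filter fun i => cL (f ∘ w) i < g).card = g := (Ag_perm f w g).2 (hA g hg)
    have := lower_card (Finset.univ.filter fun i => cL (f ∘ w) i < g) (fun a b hab hb => by
      simp only [Finset.mem_filter, Finset.mem_univ, true_and, cL_perm] at hb ⊢
      by_contra h'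
      have h1 : blk G (cL f (w b)) < blk G (cL f (w a)) := blk_lt_of hg hb (not_lt.1 h')
      have h2 := hs hab
      simp only [key, Function.comp, Prod.Lex.toLex_lt_toLex] at h2
      omega) i
    rw [hc] at this
    simpa [cL_perm] using this
  refine ⟨w, fun i j hij => ⟨fun hb => ?_, fun hb => ?_⟩⟩
  · have h1 : blk G (cL f (w i)) = blk G (cL f (w j)) := blk_eq_of fun g hg => by
      rw [hL g hg, hL g hg]; exact lt_iff_of_blk_eq hg hb
    have h2 := hs hij
    simp only [key, Function.comp, Prod.Lex.toLex_lt_toLex] at h2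
    rcases h2 with h2 | h2
    · omega
    · exact h2.2
  · obtain ⟨g, hg, h1, h2⟩ := exists_of_blk_lt hb
    refine re_lt_of_cL f (lt_of_lt_of_le ((hL g hg i).2 h1) ?_)
    by_contra h3
    have := (hL g hg j).1 (not_le.1 h3)
    omega

/-- two lifts -/
theorem PG_Dp {G0 G1 : Finset ℕ} (h01 : G0 ⊆ G1) (h1 : G1 ⊆ Finset.Ico 1 q) {f : Fin q → ℂ} {w : Equiv.Perm (Fin q)}
    (hf : f ∈ PG q G1) (hf' : f ∘ ⇑w⁻¹ ∈ PG q G0) : Dp G0 G1 w := by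
  have hW : Wp G0 w := by
    intro i
    refine blk_eq_of fun g hg => ?_
    rw [← PG_cL (h01.trans h1) hf' hg (w i), cL_perm, p_ia, PG_cL h1 hf (h01 hg)]
  refine ⟨hW, fun i j hij hb => ?_⟩
  have h2 := (hf i j hij).1 hb
  by_contra h3
  have h4 : w j < w i := by
    rcases (not_lt.1 h3).lt_or_eq with h5 | h5
    · exact h5
    · exact absurd (w.injective h5) hij.ne'
  have h5 := (hf' _ _ h4).1 (by rw [hW, hW]; exact (blk_eq_sub h01 hb).symm)
  simp only [Function.comp, p_ia] at h5
  exact absurd h5 (not_lt.2 h2.le)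

theorem PG_unique {G : Finset ℕ} (h1 : G ⊆ Finset.Ico 1 q) {f : Fin q → ℂ} {w : Equiv.Perm (Fin q)}
    (hf : f ∈ PG q G) (hf' : f ∘ w ∈ PG q G) : w = 1 := by
  have := PG_Dp (w := w⁻¹) subset_rfl h1 hf (by simpa using hf')
  exact inv_eq_one.1 this.one

/-- base point of a component -/
noncomputable def bpt (G : Finset ℕ) (w : Equiv.Perm (Fin q)) : Fin q → ℂ := fun i => ⟨blk G i, (w i : ℕ)⟩

theorem bpt_mem {G0 G1 : Finset ℕ} (h01 : G0 ⊆ G1) {w : Equiv.Perm (Fin q)} (h : Dp G0 G1 w) :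
    bpt G1 w ∈ PG q G1 ∧ bpt G1 w ∘ ⇑w⁻¹ ∈ PG q G0 := by
  constructor
  · refine fun i j hij => ⟨fun hb => ?_, fun hb => ?_⟩
    · have := h.2 i j hij hb
      simpa [bpt] using this
    · simpa [bpt] using hb
  · refine fun i j hij => ⟨fun hb => ?_, fun hb => ?_⟩
    · simpa [bpt] using hij
    · simp only [bpt, Function.comp, Nat.cast_lt]
      refine blk_lt_sub h01 ?_
      rw [h.1.inv, h.1.inv]; exact hb

theorem PG_inj {G : Finset ℕ} {f : Fin q → ℂ} (hf : f ∈ PG q G) : Function.Injective f := by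
  intro i j hij
  by_contra hne
  have key : ∀ i j : Fin q, i < j → f i ≠ f j := by
    intro i j h e
    rcases (blk_mono G h.le).lt_or_eq with hb | hb
    · have := (hf i j h).2 hb; rw [e] at this; exact lt_irrefl _ this
    · have := (hf i j h).1 hb; rw [e] at this; exact lt_irrefl _ this
  rcases lt_or_gt_of_ne hne with h | h
  · exact key i j h hij
  · exact key j i h hij.symm

/-- every configuration is in a chart -/
theorem exists_chart (f : Fin q → ℂ) (hf : Function.Injective f) :
    ∃ G ⊆ Finset.Ico 1 q, (∀ g ∈ G, Ag f g) ∧ Bg f G := by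
  classical
  refine ⟨(Finset.Ico 1 q).filter fun g => Ag f g, Finset.filter_subset _ _, fun g hg => (Finset.mem_filter.1 hg).2, ?_⟩
  have key : ∀ i j, (∀ g ∈ (Finset.Ico 1 q).filter fun g => Ag f g, (cL f i < g ↔ cL f j < g)) → ¬ (f i).re < (f j).re := by
    intro i j h hlt
    let S := Finset.univ.filter fun k => (f k).re ≤ (f i).re
    have hiS : i ∈ S := by simp [S]
    have hjS : j ∉ S := by simpa [S] using hlt
    have hL : ∀ k, cL f k < S.card ↔ k ∈ S := by
      intro k
      constructor
      · intro hk
        by_contra h'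
        refine absurd hk (not_lt.2 (Finset.card_le_card fun l hl => ?_))
        simp only [S, Finset.mem_filter, Finset.mem_univ, true_and, not_le] at hl h' ⊢
        exact hl.trans_lt h'
      · intro hk
        refine Finset.card_lt_card ⟨fun l hl => ?_, fun hs => ?_⟩
        · simp only [S, Finset.mem_filter, Finset.mem_univ, true_and] at hl hk ⊢
          exact (hl.trans_le hk).le
        · have := hs hk
          simp at this
    have hmem : S.card ∈ (Finset.Ico 1 q).filter fun g => Ag f g := by
      rw [Finset.mem_filter, Finset.mem_Ico]
      refine ⟨⟨Finset.card_pos.2 ⟨i, hiS⟩, ?_⟩, ?_⟩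
      · have : S ⊂ Finset.univ := ⟨Finset.subset_univ _, fun h => hjS (h (Finset.mem_univ _))⟩
        simpa using Finset.card_lt_card this
      · unfold Ag
        congr 1
        ext k
        simp [hL]
    have := h _ hmem
    rw [hL, hL] at this
    exact hjS (this.1 hiS)
  intro i j hij h e
  apply hij
  apply hf
  refine Complex.ext (le_antisymm ?_ ?_) e
  · exact not_lt.1 (key j i fun g hg => (h g hg).symm)
  · exact not_lt.1 (key i j h)

theorem PG_convex (G : Finset ℕ) : Convex ℝ (PG q G) := by
  intro f hf g hg a b ha hb hab i j hij
  have key : ∀ x y x' y' : ℝ, x < y → x' < y' → a * x + b * x' < a * y + b * y' := by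
    intro x y x' y' h h'
    rcases ha.lt_or_eq with ha' | ha'
    · nlinarith [mul_lt_mul_of_pos_left h ha', mul_le_mul_of_nonneg_left h'.le hb]
    · have : b = 1 := by rw [← ha'] at hab; linarith
      rw [← ha', this]; linarith
  refine ⟨fun h => ?_, fun h => ?_⟩
  · simpa using key _ _ _ _ ((hf i j hij).1 h) ((hg i j hij).1 h)
  · simpa using key _ _ _ _ ((hf i j hij).2 h) ((hg i j hij).2 h)

theorem PG_open (G : Finset ℕ) : IsOpen (PG q G) := by
  have : PG q G = ⋂ i : Fin q, ⋂ j : Fin q, {f | i < j → (blk G i = blk G j → (f i).im < (f j).im) ∧ (blk G i < blk G j → (f i).re < (f j).re)} := by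
    ext f; simp [PG]
  rw [this]
  refine isOpen_iInter_of_finite fun i => isOpen_iInter_of_finite fun j => ?_
  by_cases hij : i < j
  · simp only [hij, true_imp_iff]
    refine IsOpen.inter ?_ ?_
    · by_cases h : blk G i = blk G j
      · simp only [h, true_imp_iff]
        exact isOpen_lt (by fun_prop) (by fun_prop)
      · simp only [h, false_imp_iff]; exact isOpen_univ
    · by_cases h : blk G i < blk G j
      · simp only [h, true_imp_iff]
        exact isOpen_lt (by fun_prop) (by fun_prop)
      · simp only [h, false_imp_iff]; exact isOpen_univ
  · simp [hij]

end P3a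

section P3b
set_option linter.unusedVariables false
set_option linter.unusedSimpArgs false

variable {q : ℕ}

theorem conf_perm_inj {f : Fin q → ℂ} (hf : Function.Injective f) (w : Equiv.Perm (Fin q)) :
    Function.Injective (f ∘ w) := hf.comp w.injective

noncomputable def dflt (q : ℕ) : UConf q ℂ :=
  Quotient.mk (confSetoid q ℂ) ⟨fun i => ((i : ℕ) : ℂ), fun i j h => Fin.ext (by simpa using h)⟩

open Classical in
/-- projection from tuples -/
noncomputable def pj (f : Fin q → ℂ) : UConf q ℂ :=
  if h : Function.Injective f then Quotient.mk (confSetoid q ℂ) ⟨f, h⟩ else dflt q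

theorem pj_of {f : Fin q → ℂ} (h : Function.Injective f) : pj f = Quotient.mk (confSetoid q ℂ) ⟨f, h⟩ := dif_pos h

theorem pj_surj (x : UConf q ℂ) : ∃ f, Function.Injective f ∧ pj f = x := by
  obtain ⟨⟨f, hf⟩, rfl⟩ := Quotient.exists_rep x
  exact ⟨f, hf, pj_of hf⟩

theorem pj_eq_iff {f g : Fin q → ℂ} (hf : Function.Injective f) (hg : Function.Injective g) :
    pj f = pj g ↔ ∃ w : Equiv.Perm (Fin q), f = g ∘ w := by
  rw [pj_of hf, pj_of hg]
  exact Quotient.eq (r := confSetoid q ℂ)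

theorem pj_perm {f : Fin q → ℂ} (hf : Function.Injective f) (w : Equiv.Perm (Fin q)) : pj (f ∘ w) = pj f :=
  (pj_eq_iff (conf_perm_inj hf w) hf).2 ⟨w, rfl⟩

/-- quotient map -/
noncomputable def mkU (f : OConf q ℂ) : UConf q ℂ := Quotient.mk (confSetoid q ℂ) f

theorem mkU_eq (x : OConf q ℂ) : mkU x = pj x.1 := (pj_of x.2).symm

theorem pj_open {U : Set (Fin q → ℂ)} (hU : IsOpen U) (hi : ∀ f ∈ U, Function.Injective f) : IsOpen (pj '' U) := by
  have hq : Topology.IsQuotientMap (mkU : OConf q ℂ → UConf q ℂ) := isQuotientMap_quotient_mk'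
  refine (hq.isOpen_preimage (s := pj '' U)).1 ?_
  have : mkU ⁻¹' (pj '' U) =
      ⋃ w : Equiv.Perm (Fin q), {f : OConf q ℂ | f.1 ∘ w ∈ U} := by
    ext x
    rw [Set.mem_iUnion, Set.mem_preimage, mkU_eq]
    constructor
    · rintro ⟨g, hg, h⟩
      obtain ⟨w, e⟩ := (pj_eq_iff (hi g hg) x.2).1 h
      refine ⟨w, ?_⟩
      rw [e] at hg
      exact hg
    · rintro ⟨w, hw⟩
      exact ⟨_, hw, pj_perm x.2 w⟩
  rw [this]
  refine isOpen_iUnion fun w => hU.preimage ?_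
  refine continuous_pi fun i => ?_
  exact (continuous_apply (w i)).comp continuous_subtype_val

theorem pj_cont {T : Type*} [TopologicalSpace T] (φ : T → Fin q → ℂ) (hφ : Continuous φ) (hi : ∀ t, Function.Injective (φ t)) :
    Continuous fun t => pj (φ t) := by
  have : (fun t => pj (φ t)) = (Quotient.mk (confSetoid q ℂ)) ∘ fun t => (⟨φ t, hi t⟩ : OConf q ℂ) := by
    funext t
    exact pj_of (hi t)
  rw [this]
  exact continuous_quotient_mk'.comp (hφ.subtype_mk _)

/-- charts -/
def VG (q : ℕ) (G : Finset ℕ) : Set (UConf q ℂ) := pj '' PG q G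

theorem VG_open (G : Finset ℕ) : IsOpen (VG q G) := pj_open (PG_open G) fun f => PG_inj

theorem mem_VG {G : Finset ℕ} (hG : G ⊆ Finset.Ico 1 q) {f : Fin q → ℂ} (hf : Function.Injective f) :
    pj f ∈ VG q G ↔ (∀ g ∈ G, Ag f g) ∧ Bg f G := by
  constructor
  · rintro ⟨g, hg, h⟩
    obtain ⟨w, rfl⟩ := (pj_eq_iff hf (PG_inj hg)).1 h.symm
    have := PG_AB hG hg
    exact ⟨fun a ha => (Ag_perm g w a).2 (this.1 a ha), Bg_perm g w G this.2⟩
  · rintro ⟨hA, hB⟩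
    obtain ⟨w, hw⟩ := exists_sort hG f hA hB
    exact ⟨_, hw, pj_perm hf w⟩

theorem VG_cover (x : UConf q ℂ) : ∃ G ⊆ Finset.Ico 1 q, x ∈ VG q G := by
  obtain ⟨f, hf, rfl⟩ := pj_surj x
  obtain ⟨G, hG, h⟩ := exists_chart f hf
  exact ⟨G, hG, (mem_VG hG hf).2 h⟩

theorem Bg.mono {G G' : Finset ℕ} (h : G ⊆ G') {f : Fin q → ℂ} (hB : Bg f G) : Bg f G' :=
  fun i j hij hg => hB i j hij fun g hgG => hg g (h hgG)

theorem VG_mid {G0 G G1 : Finset ℕ} (h0 : G0 ⊆ G) (h1 : G ⊆ G1) (hG : G1 ⊆ Finset.Ico 1 q) {x : UConf q ℂ}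
    (hx0 : x ∈ VG q G0) (hx1 : x ∈ VG q G1) : x ∈ VG q G := by
  obtain ⟨f, hf, rfl⟩ := pj_surj x
  rw [mem_VG ((h0.trans h1).trans hG) hf] at hx0
  rw [mem_VG hG hf] at hx1
  rw [mem_VG (h1.trans hG) hf]
  exact ⟨fun g hg => hx1.1 g (h1 hg), hx0.2.mono h0⟩

theorem VG_union {G0 G1 : Finset ℕ} (h0 : G0 ⊆ Finset.Ico 1 q) (h1 : G1 ⊆ Finset.Ico 1 q) {x : UConf q ℂ}
    (hx0 : x ∈ VG q G0) (hx1 : x ∈ VG q G1) : x ∈ VG q (G0 ∪ G1) := by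
  obtain ⟨f, hf, rfl⟩ := pj_surj x
  rw [mem_VG h0 hf] at hx0
  rw [mem_VG h1 hf] at hx1
  rw [mem_VG (Finset.union_subset h0 h1) hf]
  refine ⟨fun g hg => ?_, hx0.2.mono Finset.subset_union_left⟩
  rcases Finset.mem_union.1 hg with h | h
  · exact hx0.1 g h
  · exact hx1.1 g h

open Classical in
/-- the lift in a chart -/
noncomputable def lf (G : Finset ℕ) (x : UConf q ℂ) : Fin q → ℂ :=
  if h : x ∈ VG q G then h.choose else 0

theorem lf_mem {G : Finset ℕ} {x : UConf q ℂ} (h : x ∈ VG q G) : lf G x ∈ PG q G := by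
  rw [lf, dif_pos h]; exact h.choose_spec.1
theorem pj_lf {G : Finset ℕ} {x : UConf q ℂ} (h : x ∈ VG q G) : pj (lf G x) = x := by
  rw [lf, dif_pos h]; exact h.choose_spec.2

theorem lf_unique {G : Finset ℕ} (hG : G ⊆ Finset.Ico 1 q) {f : Fin q → ℂ} (hf : f ∈ PG q G) : lf G (pj f) = f := by
  have hx : pj f ∈ VG q G := ⟨f, hf, rfl⟩
  obtain ⟨w, hw⟩ := (pj_eq_iff (PG_inj (lf_mem hx)) (PG_inj hf)).1 (pj_lf hx)
  have h1 := lf_mem hx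
  rw [hw] at h1 ⊢
  rw [PG_unique hG hf h1]; rfl

theorem lf_cont {T : Type*} [TopologicalSpace T] {G : Finset ℕ} (hG : G ⊆ Finset.Ico 1 q) (s : C(T, UConf q ℂ))
    (hs : ∀ t, s t ∈ VG q G) : Continuous fun t => lf G (s t) := by
  refine continuous_def.2 fun O hO => ?_
  have : (fun t => lf G (s t)) ⁻¹' O = s ⁻¹' (pj '' (O ∩ PG q G)) := by
    ext t
    simp only [Set.mem_preimage]
    constructor
    · intro h
      exact ⟨_, ⟨h, lf_mem (hs t)⟩, pj_lf (hs t)⟩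
    · rintro ⟨f, ⟨hf, hf'⟩, e⟩
      rw [← e, lf_unique hG hf']; exact hf
  rw [this]
  exact (pj_open (hO.inter (PG_open G)) fun f hf => PG_inj hf.2).preimage s.continuous

open Classical in
/-- component label -/
noncomputable def lab (G0 G1 : Finset ℕ) (x : UConf q ℂ) : Equiv.Perm (Fin q) :=
  if h : ∃ w : Equiv.Perm (Fin q), lf G1 x = lf G0 x ∘ w then h.choose else 1

theorem lab_spec {G0 G1 : Finset ℕ} {x : UConf q ℂ} (h0 : x ∈ VG q G0) (h1 : x ∈ VG q G1) :
    lf G1 x = lf G0 x ∘ lab G0 G1 x := by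
  have h : ∃ w : Equiv.Perm (Fin q), lf G1 x = lf G0 x ∘ w :=
    (pj_eq_iff (PG_inj (lf_mem h1)) (PG_inj (lf_mem h0))).1 (by rw [pj_lf h0, pj_lf h1])
  rw [lab, dif_pos h]
  exact h.choose_spec

theorem lab_eq {G0 G1 : Finset ℕ} {x : UConf q ℂ} (h0 : x ∈ VG q G0) (h1 : x ∈ VG q G1) (w : Equiv.Perm (Fin q))
    (hw : lf G1 x = lf G0 x ∘ w) : lab G0 G1 x = w := by
  have := lab_spec h0 h1
  rw [hw] at this
  ext i
  have h2 := congrFun this i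
  exact congrArg _ (PG_inj (lf_mem h0) h2).symm

theorem lab_Dp {G0 G1 : Finset ℕ} (h01 : G0 ⊆ G1) (hG : G1 ⊆ Finset.Ico 1 q) {x : UConf q ℂ} (h0 : x ∈ VG q G0) (h1 : x ∈ VG q G1) :
    Dp G0 G1 (lab G0 G1 x) := by
  refine PG_Dp h01 hG (lf_mem h1) ?_
  rw [lab_spec h0 h1, Function.comp_assoc]
  have : (⇑(lab G0 G1 x) ∘ ⇑(lab G0 G1 x)⁻¹) = id := by funext i; exact p_ai _ _
  rw [this, Function.comp_id]
  exact lf_mem h0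

theorem lab_mul {G0 G1 G2 : Finset ℕ} {x : UConf q ℂ} (h0 : x ∈ VG q G0) (h1 : x ∈ VG q G1) (h2 : x ∈ VG q G2) :
    lab G0 G2 x = lab G0 G1 x * lab G1 G2 x := by
  refine lab_eq h0 h2 _ ?_
  rw [lab_spec h1 h2, lab_spec h0 h1]; rfl

/-- lifted component -/
def Qw (G0 G1 : Finset ℕ) (w : Equiv.Perm (Fin q)) : Set (Fin q → ℂ) := {f | f ∈ PG q G1 ∧ f ∘ ⇑w⁻¹ ∈ PG q G0}

/-- component -/
def Cw (G0 G1 : Finset ℕ) (w : Equiv.Perm (Fin q)) : Set (UConf q ℂ) :=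
  {x | x ∈ VG q G0 ∧ x ∈ VG q G1 ∧ lab G0 G1 x = w}

theorem pj_mem_Cw {G0 G1 : Finset ℕ} (hG0 : G0 ⊆ Finset.Ico 1 q) (hG : G1 ⊆ Finset.Ico 1 q) {w : Equiv.Perm (Fin q)} {f : Fin q → ℂ}
    (hf : f ∈ Qw G0 G1 w) : pj f ∈ Cw G0 G1 w := by
  have h1 : pj f ∈ VG q G1 := ⟨f, hf.1, rfl⟩
  have e : pj (f ∘ ⇑w⁻¹) = pj f := pj_perm (PG_inj hf.1) w⁻¹
  have h0 : pj f ∈ VG q G0 := ⟨_, hf.2, e⟩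
  refine ⟨h0, h1, lab_eq h0 h1 w ?_⟩
  rw [lf_unique hG hf.1]
  conv_rhs => rw [← e, lf_unique hG0 hf.2]
  funext i
  simp [Function.comp]

theorem lf_mem_Qw {G0 G1 : Finset ℕ} {w : Equiv.Perm (Fin q)} {x : UConf q ℂ} (hx : x ∈ Cw G0 G1 w) :
    lf G1 x ∈ Qw G0 G1 w := by
  obtain ⟨h0, h1, rfl⟩ := hx
  refine ⟨lf_mem h1, ?_⟩
  rw [lab_spec h0 h1, Function.comp_assoc]
  have : (⇑(lab G0 G1 x) ∘ ⇑(lab G0 G1 x)⁻¹) = id := by funext i; exact p_ai _ _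
  rw [this, Function.comp_id]
  exact lf_mem h0

theorem Qw_convex (G0 G1 : Finset ℕ) (w : Equiv.Perm (Fin q)) : Convex ℝ (Qw G0 G1 w) := by
  intro f hf g hg a b ha hb hab
  exact ⟨PG_convex G1 hf.1 hg.1 ha hb hab, PG_convex G0 hf.2 hg.2 ha hb hab⟩

theorem Qw_open (G0 G1 : Finset ℕ) (w : Equiv.Perm (Fin q)) : IsOpen (Qw G0 G1 w) := by
  refine (PG_open G1).inter ((PG_open G0).preimage ?_)
  exact continuous_pi fun i => continuous_apply _

theorem Cw_eq {G0 G1 : Finset ℕ} (hG0 : G0 ⊆ Finset.Ico 1 q) (hG : G1 ⊆ Finset.Ico 1 q) (w : Equiv.Perm (Fin q)) :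
    Cw G0 G1 w = pj '' Qw G0 G1 w := by
  ext x
  constructor
  · intro hx
    exact ⟨_, lf_mem_Qw hx, pj_lf hx.2.1⟩
  · rintro ⟨f, hf, rfl⟩
    exact pj_mem_Cw hG0 hG hf

theorem Cw_open {G0 G1 : Finset ℕ} (hG0 : G0 ⊆ Finset.Ico 1 q) (hG : G1 ⊆ Finset.Ico 1 q) (w : Equiv.Perm (Fin q)) :
    IsOpen (Cw G0 G1 w) := by
  rw [Cw_eq hG0 hG]
  exact pj_open (Qw_open G0 G1 w) fun f hf => PG_inj hf.1

theorem lab_const {n : ℕ} {G0 G1 : Finset ℕ} (hG0 : G0 ⊆ Finset.Ico 1 q) (hG : G1 ⊆ Finset.Ico 1 q) (s : C(Dl (n + 1), UConf q ℂ))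
    (h0 : ∀ t, s t ∈ VG q G0) (h1 : ∀ t, s t ∈ VG q G1) (t t' : Dl (n + 1)) : lab G0 G1 (s t) = lab G0 G1 (s t') := by
  have hl : IsLocallyConstant fun t => lab G0 G1 (s t) := by
    rw [IsLocallyConstant.iff_isOpen_fiber]
    intro w
    have : (fun t => lab G0 G1 (s t)) ⁻¹' {w} = s ⁻¹' (Cw G0 G1 w) := by
      ext t
      exact ⟨fun h => ⟨h0 t, h1 t, h⟩, fun h => h.2.2⟩
    rw [this]
    exact (Cw_open hG0 hG w).preimage s.continuous
  have : PreconnectedSpace (Dl (n + 1)) :=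
    Subtype.preconnectedSpace (convex_stdSimplex ℝ (Fin (n + 1))).isPreconnected
  exact hl.apply_eq_of_preconnectedSpace t t'

/-! cone construction -/

/-- join coordinate -/
noncomputable def jn {n : ℕ} (r : ℝ) (hr : 0 ≤ r ∧ r ≤ 1) (t : Dl n) : Dl (n + 1) :=
  ⟨Fin.cons r fun i => (1 - r) * t.1 i, by
    constructor
    · intro i
      refine Fin.cases ?_ (fun i => ?_) i
      · simpa using hr.1
      · simp only [Fin.cons_succ]
        exact mul_nonneg (by linarith [hr.2]) (t.2.1 i)
    · rw [Fin.sum_univ_succ]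
      simp only [Fin.cons_zero, Fin.cons_succ, ← Finset.mul_sum, t.2.2]
      ring⟩

theorem exists_jn {n : ℕ} (x : Dl (n + 2)) : ∃ (r : ℝ) (hr : 0 ≤ r ∧ r ≤ 1) (t : Dl (n + 1)), x = jn r hr t := by
  have hsum : x.1 0 + ∑ i : Fin (n + 1), x.1 i.succ = 1 := by
    rw [← Fin.sum_univ_succ]; exact x.2.2
  have hpos : 0 ≤ ∑ i : Fin (n + 1), x.1 i.succ := Finset.sum_nonneg fun i _ => x.2.1 _
  have hr : 0 ≤ x.1 0 ∧ x.1 0 ≤ 1 := ⟨x.2.1 0, by linarith⟩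
  by_cases h : x.1 0 = 1
  · have h0 : ∀ i : Fin (n + 1), x.1 i.succ = 0 := by
      intro i
      have : ∑ i : Fin (n + 1), x.1 i.succ = 0 := by linarith
      exact (Finset.sum_eq_zero_iff_of_nonneg fun i _ => x.2.1 _).1 this i (Finset.mem_univ i)
    refine ⟨x.1 0, hr, stdSimplex.barycenter, Subtype.ext (funext fun i => ?_)⟩
    refine Fin.cases rfl (fun i => ?_) i
    change x.1 i.succ = (1 - x.1 0) * _
    rw [h0, h]; ring
  · have h1 : 1 - x.1 0 ≠ 0 := fun e => h (by linarith)
    refine ⟨x.1 0, hr, ⟨fun i => x.1 i.succ / (1 - x.1 0), fun i => div_nonneg (x.2.1 _) (by linarith [hr.2]), ?_⟩,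
      Subtype.ext (funext fun i => ?_)⟩
    · rw [← Finset.sum_div, div_eq_one_iff_eq h1]; linarith
    · refine Fin.cases rfl (fun i => ?_) i
      change x.1 i.succ = (1 - x.1 0) * (x.1 i.succ / (1 - x.1 0))
      field_simp

theorem exists_cone {n : ℕ} {E : Type*} [NormedAddCommGroup E] [NormedSpace ℝ E] (b : E) (σ : C(Dl (n + 1), E)) :
    ∃ τ : C(Dl (n + 2), E), ∀ r hr t, τ (jn r hr t) = r • b + (1 - r) • σ t := by
  have hsur : ∀ x : Dl (n + 2), ∃ p : (Set.Icc (0 : ℝ) 1) × Dl (n + 1), x = jn p.1.1 p.1.2 p.2 := by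
    intro x
    obtain ⟨r, hr, t, h⟩ := exists_jn x
    exact ⟨(⟨r, hr⟩, t), h⟩
  choose c hc using hsur
  let φ : (Set.Icc (0 : ℝ) 1) × Dl (n + 1) → E := fun p => p.1.1 • b + (1 - p.1.1) • σ p.2
  have hφ : Continuous φ := by
    refine Continuous.add ?_ ?_
    · exact (continuous_subtype_val.comp continuous_fst).smul continuous_const
    · exact (continuous_const.sub (continuous_subtype_val.comp continuous_fst)).smul (σ.continuous.comp continuous_snd)
  let J : (Set.Icc (0 : ℝ) 1) × Dl (n + 1) → Dl (n + 2) := fun p => jn p.1.1 p.1.2 p.2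
  have hJ : Continuous J := by
    refine Continuous.subtype_mk (continuous_pi fun i => ?_) _
    refine Fin.cases ?_ (fun i => ?_) i
    · simp only [Fin.cons_zero]
      exact continuous_subtype_val.comp continuous_fst
    · simp only [Fin.cons_succ]
      exact (continuous_const.sub (continuous_subtype_val.comp continuous_fst)).mul
        ((continuous_apply i).comp (continuous_subtype_val.comp continuous_snd))
  have hcomp : ∀ p, φ (c (J p)) = φ p := by
    intro p
    have h := hc (J p)
    have h0 : p.1.1 = (c (J p)).1.1 := congrArg (fun x : Dl (n + 2) => x.1 0) h
    have h1 : ∀ i, (1 - p.1.1) * p.2.1 i = (1 - (c (J p)).1.1) * (c (J p)).2.1 i := fun i =>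
      congrArg (fun x : Dl (n + 2) => x.1 (Fin.succ i)) h
    simp only [φ, ← h0]
    by_cases e : p.1.1 = 1
    · rw [e]; simp
    · have : p.2 = (c (J p)).2 := by
        refine Subtype.ext (funext fun i => ?_)
        have h2 := h1 i
        rw [← h0] at h2
        exact mul_left_cancel₀ (fun e' => e (by linarith)) h2
      rw [← this]
  have hq : Topology.IsQuotientMap J := Topology.IsQuotientMap.of_surjective_continuous
    (fun x => ⟨c x, (hc x).symm⟩) hJ
  refine ⟨⟨fun x => φ (c x), ?_⟩, fun r hr t => hcomp (⟨r, hr⟩, t)⟩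
  rw [hq.continuous_iff]
  have : (fun x => φ (c x)) ∘ J = φ := funext hcomp
  rw [this]; exact hφ

theorem sMap_jn {n : ℕ} (r : ℝ) (hr : 0 ≤ r ∧ r ≤ 1) (t : Dl (n + 1)) (i : Fin (n + 2)) :
    sMap (Fin.succAbove i.succ) (jn r hr t) = jn r hr (sMap (Fin.succAbove i) t) := by
  rw [sMap_eq, sMap_eq]
  refine Subtype.ext (funext fun j => ?_)
  rw [affC_val, Fin.sum_univ_succ]
  refine Fin.cases ?_ (fun j => ?_) j
  · change r * (Pi.single (Fin.succAbove i.succ 0) (1:ℝ) : Fin (n + 3) → ℝ) 0 +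
      ∑ k : Fin (n + 1), ((1 - r) * t.1 k) * (Pi.single (Fin.succAbove i.succ k.succ) (1:ℝ) : Fin (n + 3) → ℝ) 0 = r
    simp only [Fin.succ_succAbove_zero, Fin.succ_succAbove_succ]
    rw [Finset.sum_eq_zero]
    · simp
    · intro k _
      rw [Pi.single_eq_of_ne (Fin.succ_ne_zero _).symm, mul_zero]
  · change r * (Pi.single (Fin.succAbove i.succ 0) (1:ℝ) : Fin (n + 3) → ℝ) j.succ +
      ∑ k : Fin (n + 1), ((1 - r) * t.1 k) * (Pi.single (Fin.succAbove i.succ k.succ) (1:ℝ) : Fin (n + 3) → ℝ) j.succ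
      = (1 - r) * ∑ k : Fin (n + 1), t.1 k * (Pi.single (Fin.succAbove i k) (1:ℝ) : Fin (n + 2) → ℝ) j
    simp only [Fin.succ_succAbove_zero, Fin.succ_succAbove_succ]
    rw [Pi.single_eq_of_ne (Fin.succ_ne_zero _), mul_zero, zero_add, Finset.mul_sum]
    refine Finset.sum_congr rfl fun k _ => ?_
    simp only [Pi.single_apply, Fin.succ_inj]
    ring

theorem sMap_zero_jn {n : ℕ} (t : Dl (n + 1)) :
    sMap (Fin.succAbove 0) t = jn 0 ⟨le_rfl, zero_le_one⟩ t := by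
  rw [sMap_eq]
  refine Subtype.ext (funext fun j => ?_)
  rw [affC_val]
  refine Fin.cases ?_ (fun j => ?_) j
  · change ∑ k : Fin (n + 1), t.1 k * (Pi.single (Fin.succAbove 0 k) (1:ℝ) : Fin (n + 2) → ℝ) 0 = 0
    refine Finset.sum_eq_zero fun k _ => ?_
    simp
  · change ∑ k : Fin (n + 1), t.1 k * (Pi.single (Fin.succAbove 0 k) (1:ℝ) : Fin (n + 2) → ℝ) j.succ = (1 - 0) * t.1 j
    simp [Pi.single_apply]

theorem sMap_one_jn (t : Dl 1) : sMap (Fin.succAbove (1 : Fin 2)) t = jn 1 ⟨zero_le_one, le_rfl⟩ t := by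
  have ht : t.1 0 = 1 := by
    have := t.2.2
    simpa using this
  rw [sMap_eq]
  refine Subtype.ext (funext fun j => ?_)
  rw [affC_val]
  refine Fin.cases ?_ (fun j => ?_) j
  · change ∑ k : Fin 1, t.1 k * (Pi.single (Fin.succAbove (1 : Fin 2) k) (1:ℝ) : Fin 2 → ℝ) 0 = 1
    rw [Fin.sum_univ_one, ht]; simp
  · change ∑ k : Fin 1, t.1 k * (Pi.single (Fin.succAbove (1 : Fin 2) k) (1:ℝ) : Fin 2 → ℝ) j.succ = (1 - 1) * t.1 j
    rw [Fin.sum_univ_one, ht]; simp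

/-- geometric cone inside a component -/
theorem exists_coneC {n : ℕ} {G0 G1 : Finset ℕ} (hG0 : G0 ⊆ Finset.Ico 1 q) (hG : G1 ⊆ Finset.Ico 1 q) (h01 : G0 ⊆ G1)
    (w : Equiv.Perm (Fin q)) (s : C(Dl (n + 1), UConf q ℂ)) (hs : ∀ t, s t ∈ Cw G0 G1 w) :
    ∃ τ : C(Dl (n + 2), UConf q ℂ), (∀ x, τ x ∈ Cw G0 G1 w) ∧
      ∀ r hr t, τ (jn r hr t) = pj (r • bpt G1 w + (1 - r) • lf G1 (s t)) := by
  have hw : Dp G0 G1 w := by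
    have := hs (stdSimplex.barycenter)
    rw [← this.2.2]
    exact lab_Dp h01 hG this.1 this.2.1
  obtain ⟨τ, hτ⟩ := exists_cone (bpt G1 w) ⟨fun t => lf G1 (s t), lf_cont hG s fun t => (hs t).2.1⟩
  have hQ : ∀ x, τ x ∈ Qw G0 G1 w := by
    intro x
    obtain ⟨r, hr, t, rfl⟩ := exists_jn x
    rw [hτ]
    exact Qw_convex G0 G1 w (bpt_mem h01 hw) (lf_mem_Qw (hs t)) hr.1 (by linarith [hr.2]) (by ring)
  refine ⟨⟨fun x => pj (τ x), pj_cont τ τ.continuous fun x => PG_inj (hQ x).1⟩, fun x => pj_mem_Cw hG0 hG (hQ x), fun r hr t => ?_⟩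
  exact congrArg pj (hτ r hr t)

open Classical in
noncomputable def coneC {n : ℕ} (G0 G1 : Finset ℕ) (w : Equiv.Perm (Fin q)) (s : C(Dl (n + 1), UConf q ℂ)) : C(Dl (n + 2), UConf q ℂ) :=
  if h : ∃ τ : C(Dl (n + 2), UConf q ℂ), (∀ x, τ x ∈ Cw G0 G1 w) ∧
      ∀ r hr t, τ (jn r hr t) = pj (r • bpt G1 w + (1 - r) • lf G1 (s t)) then h.choose else ContinuousMap.const _ (dflt q)

noncomputable def bvt (G1 : Finset ℕ) (w : Equiv.Perm (Fin q)) : C(Dl 1, UConf q ℂ) := ContinuousMap.const _ (pj (bpt G1 w))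

theorem coneC_spec {n : ℕ} {G0 G1 : Finset ℕ} (hG0 : G0 ⊆ Finset.Ico 1 q) (hG : G1 ⊆ Finset.Ico 1 q) (h01 : G0 ⊆ G1)
    (w : Equiv.Perm (Fin q)) (s : C(Dl (n + 1), UConf q ℂ)) (hs : ∀ t, s t ∈ Cw G0 G1 w) :
    (∀ x, coneC G0 G1 w s x ∈ Cw G0 G1 w) ∧
      ∀ r hr t, coneC G0 G1 w s (jn r hr t) = pj (r • bpt G1 w + (1 - r) • lf G1 (s t)) := by
  have h := exists_coneC hG0 hG h01 w s hs
  rw [coneC, dif_pos h]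
  exact h.choose_spec

theorem coneC_zero {n : ℕ} {G0 G1 : Finset ℕ} (hG0 : G0 ⊆ Finset.Ico 1 q) (hG : G1 ⊆ Finset.Ico 1 q) (h01 : G0 ⊆ G1)
    (w : Equiv.Perm (Fin q)) (s : C(Dl (n + 1), UConf q ℂ)) (hs : ∀ t, s t ∈ Cw G0 G1 w) :
    faceS (coneC G0 G1 w s) 0 = s := by
  refine ContinuousMap.ext fun t => ?_
  change coneC G0 G1 w s (sMap (Fin.succAbove 0) t) = s t
  rw [sMap_zero_jn, (coneC_spec hG0 hG h01 w s hs).2]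
  simp only [zero_smul, sub_zero, one_smul, zero_add]
  exact pj_lf (hs t).2.1

theorem coneC_one {G0 G1 : Finset ℕ} (hG0 : G0 ⊆ Finset.Ico 1 q) (hG : G1 ⊆ Finset.Ico 1 q) (h01 : G0 ⊆ G1)
    (w : Equiv.Perm (Fin q)) (s : C(Dl (0 + 1), UConf q ℂ)) (hs : ∀ t, s t ∈ Cw G0 G1 w) :
    faceS (coneC G0 G1 w s) 1 = bvt G1 w := by
  refine ContinuousMap.ext fun t => ?_
  change coneC G0 G1 w s (sMap (Fin.succAbove 1) t) = pj (bpt G1 w)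
  have e : sMap (Fin.succAbove (1 : Fin 2)) t = jn 1 ⟨zero_le_one, le_rfl⟩ t := sMap_one_jn t
  refine (congrArg (coneC G0 G1 w s) e).trans ?_
  rw [(coneC_spec hG0 hG h01 w s hs).2]
  simp

theorem coneC_succ {n : ℕ} {G0 G1 : Finset ℕ} (hG0 : G0 ⊆ Finset.Ico 1 q) (hG : G1 ⊆ Finset.Ico 1 q) (h01 : G0 ⊆ G1)
    (w : Equiv.Perm (Fin q)) (s : C(Dl (n + 1 + 1), UConf q ℂ)) (hs : ∀ t, s t ∈ Cw G0 G1 w) (i : Fin (n + 2)) :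
    faceS (coneC G0 G1 w s) i.succ = coneC G0 G1 w (faceS s i) := by
  refine ContinuousMap.ext fun x => ?_
  obtain ⟨r, hr, t, rfl⟩ := exists_jn x
  change coneC G0 G1 w s (sMap (Fin.succAbove i.succ) (jn r hr t)) = _
  rw [sMap_jn, (coneC_spec hG0 hG h01 w s hs).2, (coneC_spec hG0 hG h01 w (faceS s i) (fun t => hs _)).2]
  rfl

end P3b

/-! ## Part 4: the double complex of charts -/

section P4a
set_option linter.unusedVariables false
set_option linter.unusedSimpArgs false

variable {F : Type} [Field F]

/-- position sign -/
def sgF (F : Type) [Field F] (g : ℕ) (S : Finset ℕ) : F := (-1) ^ (S.filter (· < g)).card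

theorem sgF_sq (g : ℕ) (S : Finset ℕ) : sgF F g S * sgF F g S = 1 := by
  unfold sgF
  rw [← mul_pow]; simp

theorem sgF_min {g : ℕ} {S : Finset ℕ} (h : ∀ x ∈ S, g ≤ x) : sgF F g S = 1 := by
  unfold sgF
  rw [Finset.filter_false_of_mem, Finset.card_empty, pow_zero]
  intro x hx
  have := h x hx
  omega

theorem sgF_insert_lt {g h : ℕ} {S : Finset ℕ} (hh : h ∉ S) (hlt : h < g) : sgF F g (insert h S) = - sgF F g S := by
  unfold sgF
  rw [Finset.filter_insert, if_pos hlt, Finset.card_insert_of_notMem (by simp [hh]), pow_succ]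
  ring

theorem sgF_insert_gt {g h : ℕ} {S : Finset ℕ} (hlt : g ≤ h) : sgF F g (insert h S) = sgF F g S := by
  unfold sgF
  rw [Finset.filter_insert, if_neg (by omega)]

theorem sgF_erase_lt {g h : ℕ} {S : Finset ℕ} (hh : h ∈ S) (hlt : h < g) : sgF F g (S.erase h) = - sgF F g S := by
  conv_rhs => rw [← Finset.insert_erase hh, sgF_insert_lt (by simp) hlt]
  simp

theorem sgF_erase_gt {g h : ℕ} {S : Finset ℕ} (hlt : g ≤ h) : sgF F g (S.erase h) = sgF F g S := by
  by_cases hh : h ∈ S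
  · conv_rhs => rw [← Finset.insert_erase hh, sgF_insert_gt hlt]
  · rw [Finset.erase_eq_of_notMem hh]

theorem sgF_swap {g h : ℕ} {S : Finset ℕ} (hg : g ∈ S) (hh : h ∈ S) (hne : g ≠ h) :
    sgF F g S * sgF F h (S.erase g) + sgF F h S * sgF F g (S.erase h) = 0 := by
  rcases lt_or_gt_of_ne hne with hl | hl
  · rw [sgF_erase_lt hg hl, sgF_erase_gt hl.le]; ring
  · rw [sgF_erase_lt hh hl, sgF_erase_gt hl.le]; ring

theorem alt_sum {M : Type*} [AddCommGroup M] [Module F M] (S : Finset ℕ) (T : ℕ → ℕ → M) (hT : ∀ g h, T g h = T h g) :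
    ∑ g ∈ S, sgF F g S • ∑ h ∈ S.erase g, sgF F h (S.erase g) • T g h = 0 := by
  simp only [Finset.smul_sum, smul_smul]
  rw [Finset.sum_sigma']
  refine Finset.sum_involution (fun x _ => ⟨x.2, x.1⟩) ?_ ?_ ?_ ?_
  · rintro ⟨g, h⟩ hx
    simp only [Finset.mem_sigma, Finset.mem_erase] at hx
    change (sgF F g S * sgF F h (S.erase g)) • T g h + (sgF F h S * sgF F g (S.erase h)) • T h g = 0
    rw [hT h g, ← add_smul, sgF_swap hx.1 hx.2.2 (Ne.symm hx.2.1), zero_smul]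
  · rintro ⟨g, h⟩ hx _ he
    simp only [Finset.mem_sigma, Finset.mem_erase] at hx
    exact hx.2.1 (congrArg Sigma.fst he)
  · rintro ⟨g, h⟩ hx
    simp only [Finset.mem_sigma, Finset.mem_erase] at hx ⊢
    exact ⟨hx.2.2, Ne.symm hx.2.1, hx.1⟩
  · rintro ⟨g, h⟩ hx
    rfl

theorem sdiff_insert_er (G0 G1 : Finset ℕ) (g : ℕ) : G1 \ insert g G0 = (G1 \ G0).erase g := by
  ext x; simp only [Finset.mem_sdiff, Finset.mem_insert, Finset.mem_erase]; tauto
theorem erase_sdiff_er (G0 G1 : Finset ℕ) (g : ℕ) : G1.erase g \ G0 = (G1 \ G0).erase g := by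
  ext x; simp only [Finset.mem_sdiff, Finset.mem_erase]; tauto

/-- contraction identity -/
theorem contr_id {M : Type*} [AddCommGroup M] [Module F M] (G0 G1 : Finset ℕ) (T : Finset ℕ → M) (g : ℕ) (hg : g ∉ G0)
    (hm : ∀ x ∈ G1 \ G0, g ≤ x) :
    T G1 - (if g ∈ G1 then 0 else
        ∑ h ∈ insert g G1 \ G0, sgF F h (insert g G1 \ G0) • T ((insert g G1).erase h))
      - ∑ h ∈ G1 \ G0, sgF F h (G1 \ G0) • (if g ∈ G1.erase h then 0 else T (insert g (G1.erase h))) = 0 := by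
  by_cases hg1 : g ∈ G1
  · rw [if_pos hg1, Finset.sum_eq_single g]
    · rw [if_neg (by simp), Finset.insert_erase hg1, sgF_min hm]; simp
    · intro h hh hne
      rw [if_pos (by simp [hg1, Ne.symm hne])]; simp
    · intro h; exact absurd (Finset.mem_sdiff.2 ⟨hg1, hg⟩) h
  · rw [if_neg hg1]
    have e1 : insert g G1 \ G0 = insert g (G1 \ G0) := Finset.insert_sdiff_of_notMem _ hg
    have hgn : g ∉ G1 \ G0 := by simp [hg1]
    rw [e1, Finset.sum_insert hgn, sgF_insert_gt le_rfl, sgF_min hm, Finset.erase_insert hg1]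
    have e2 : ∀ h ∈ G1 \ G0, sgF F h (insert g (G1 \ G0)) • T ((insert g G1).erase h) =
        - (sgF F h (G1 \ G0) • (if g ∈ G1.erase h then 0 else T (insert g (G1.erase h)))) := by
      intro h hh
      have hne : g ≠ h := fun e => hgn (e ▸ hh)
      rw [sgF_insert_lt hgn (lt_of_le_of_ne (hm h hh) hne), if_neg (by simp [hg1]), neg_smul,
        Finset.erase_insert_of_ne hne]
    rw [Finset.sum_congr rfl e2, Finset.sum_neg_distrib]
    simp

variable {q : ℕ}

/-- index type for the chart complex -/
abbrev IX (q : ℕ) : Type := Sg (UConf q ℂ) × Finset ℕ × Finset ℕ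

theorem lext_bs {ι M : Type} [AddCommGroup M] [Module F M] (g : ι → M) (i : ι) :
    lext F g (bs F i) = g i := lext_single g i

noncomputable def plc (F : Type) [Field F] (q : ℕ) (G0 G1 : Finset ℕ) : (Sg (UConf q ℂ) →₀ F) →ₗ[F] (IX q →₀ F) :=
  lext F fun s => bs F (s, G0, G1)

theorem plc_bs (G0 G1 : Finset ℕ) (s : Sg (UConf q ℂ)) : plc F q G0 G1 (bs F s) = bs F (s, G0, G1) := lext_bs _ _

/-- degree sign -/
noncomputable def dgs (F : Type) [Field F] (X : Type) [TopologicalSpace X] : (Sg X →₀ F) →ₗ[F] (Sg X →₀ F) :=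
  lext F fun s => (-1 : F) ^ s.1 • bs F s

theorem dgs_dS {X : Type} [TopologicalSpace X] (x : Sg X →₀ F) : dS F X (dgs F X x) + dgs F X (dS F X x) = 0 := by
  have : (dS F X).comp (dgs F X) + (dgs F X).comp (dS F X) = 0 := by
    refine bs_ext fun ⟨n, s⟩ => ?_
    simp only [LinearMap.add_apply, LinearMap.comp_apply, LinearMap.zero_apply]
    rw [show dgs F X (bs F ⟨n, s⟩) = (-1 : F) ^ n • bs F ⟨n, s⟩ from lext_bs _ _, map_smul]
    cases n with
    | zero =>
      rw [show dS F X (bs F ⟨0, s⟩) = 0 from dS_zero s]; simp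
    | succ n =>
      rw [show dS F X (bs F ⟨n + 1, s⟩) = _ from dS_succ s, map_sum, Finset.smul_sum, ← Finset.sum_add_distrib]
      refine Finset.sum_eq_zero fun i _ => ?_
      rw [map_smul, show dgs F X (sg F (faceS s i)) = (-1 : F) ^ n • sg F (faceS s i) from lext_bs _ _, smul_comm _ _ (sg F _),
        ← smul_add, ← add_smul, pow_succ]
      simp
  exact LinearMap.congr_fun this x

noncomputable def hzt (F : Type) [Field F] (q : ℕ) (G0 G1 : Finset ℕ) : (Sg (UConf q ℂ) →₀ F) →ₗ[F] (IX q →₀ F) :=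
  ∑ g ∈ G1 \ G0, sgF F g (G1 \ G0) • (plc F q (insert g G0) G1 - plc F q G0 (G1.erase g))

noncomputable def dD (F : Type) [Field F] (q : ℕ) : (IX q →₀ F) →ₗ[F] (IX q →₀ F) :=
  lext F fun i => plc F q i.2.1 i.2.2 (dS F _ (bs F i.1)) + hzt F q i.2.1 i.2.2 (dgs F _ (bs F i.1))

theorem dD_plc (G0 G1 : Finset ℕ) (x : Sg (UConf q ℂ) →₀ F) :
    dD F q (plc F q G0 G1 x) = plc F q G0 G1 (dS F _ x) + hzt F q G0 G1 (dgs F _ x) := by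
  have : (dD F q).comp (plc F q G0 G1) = (plc F q G0 G1).comp (dS F _) + (hzt F q G0 G1).comp (dgs F _) := by
    refine bs_ext fun s => ?_
    simp only [LinearMap.add_apply, LinearMap.comp_apply]
    rw [plc_bs]
    exact lext_bs _ _
  exact LinearMap.congr_fun this x

theorem hzt_apply (G0 G1 : Finset ℕ) (x : Sg (UConf q ℂ) →₀ F) : hzt F q G0 G1 x =
    ∑ g ∈ G1 \ G0, sgF F g (G1 \ G0) • (plc F q (insert g G0) G1 x - plc F q G0 (G1.erase g) x) := by
  simp [hzt, LinearMap.sum_apply]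

theorem dD_dD (i : IX q) : dD F q (dD F q (bs F i)) = 0 := by
  obtain ⟨s, G0, G1⟩ := i
  rw [← plc_bs, dD_plc, map_add, dD_plc, dS_dS, map_zero, zero_add]
  have h1 := dgs_dS (F := F) (bs F s)
  generalize hx : dgs F _ (bs F s) = x at h1
  have h2 : dgs F _ (dS F _ (bs F s)) = - dS F _ x := by
    rw [← add_eq_zero_iff_eq_neg, add_comm]; exact h1
  rw [h2, map_neg, hzt_apply, hzt_apply, map_sum, neg_add_eq_sub, ← Finset.sum_sub_distrib]
  have e : ∀ g ∈ G1 \ G0, dD F q (sgF F g (G1 \ G0) • (plc F q (insert g G0) G1 x - plc F q G0 (G1.erase g) x)) -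
      sgF F g (G1 \ G0) • (plc F q (insert g G0) G1 (dS F _ x) - plc F q G0 (G1.erase g) (dS F _ x)) =
      sgF F g (G1 \ G0) • ∑ h ∈ (G1 \ G0).erase g, sgF F h ((G1 \ G0).erase g) •
        (plc F q (insert h (insert g G0)) G1 (dgs F _ x) - plc F q (insert g G0) (G1.erase h) (dgs F _ x)
          - plc F q (insert h G0) (G1.erase g) (dgs F _ x) + plc F q G0 ((G1.erase g).erase h) (dgs F _ x)) := by
    intro g hg
    rw [map_smul, ← smul_sub, map_sub, dD_plc, dD_plc, hzt_apply, hzt_apply, sdiff_insert_er, erase_sdiff_er]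
    congr 1
    rw [add_sub_add_comm, add_sub_cancel_left, ← Finset.sum_sub_distrib]
    refine Finset.sum_congr rfl fun h hh => ?_
    rw [← smul_sub]
    congr 1
    abel
  rw [Finset.sum_congr rfl e]
  refine alt_sum _ (fun g h => plc F q (insert h (insert g G0)) G1 (dgs F _ x) - plc F q (insert g G0) (G1.erase h) (dgs F _ x)
          - plc F q (insert h G0) (G1.erase g) (dgs F _ x) + plc F q G0 ((G1.erase g).erase h) (dgs F _ x)) ?_
  intro g h
  rw [Finset.insert_comm h g, Finset.erase_right_comm (a := g) (b := h)]
  abel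

theorem dD_bs (s : Sg (UConf q ℂ)) (G0 G1 : Finset ℕ) : dD F q (bs F (s, G0, G1)) =
    plc F q G0 G1 (dS F _ (bs F s)) + (-1 : F) ^ s.1 • ∑ g ∈ G1 \ G0, sgF F g (G1 \ G0) •
      (bs F (s, insert g G0, G1) - bs F (s, G0, G1.erase g)) := by
  rw [← plc_bs, dD_plc, show dgs F _ (bs F s) = (-1 : F) ^ s.1 • bs F s from lext_bs _ _, map_smul, hzt_apply]
  simp only [plc_bs]

/-- admissible triples -/
def okD (q : ℕ) : Set (IX q) :=
  {i | i.2.1 ⊆ i.2.2 ∧ i.2.2 ⊆ Finset.Ico 1 q ∧ (∀ t, i.1.2 t ∈ VG q i.2.1) ∧ ∀ t, i.1.2 t ∈ VG q i.2.2}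

theorem plc_face {S : Set (IX q)} (s : Sg (UConf q ℂ)) (G0 G1 : Finset ℕ)
    (h : ∀ s' : Sg (UConf q ℂ), s'.1 + 1 = s.1 → Set.range s'.2 ⊆ Set.range s.2 → (s', G0, G1) ∈ S) :
    plc F q G0 G1 (dS F _ (bs F s)) ∈ spn F S := by
  obtain ⟨n, s⟩ := s
  cases n with
  | zero =>
    rw [show dS F _ (bs F ⟨0, s⟩) = 0 from dS_zero s]; simp
  | succ n =>
    rw [show dS F _ (bs F ⟨n + 1, s⟩) = _ from dS_succ s, map_sum]
    refine Submodule.sum_mem _ fun i _ => ?_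
    rw [map_smul]
    refine Submodule.smul_mem _ _ ?_
    rw [show plc F q G0 G1 (sg F (faceS s i)) = bs F (⟨n, faceS s i⟩, G0, G1) from plc_bs _ _ _]
    refine bs_mem (h ⟨n, faceS s i⟩ rfl ?_)
    rintro _ ⟨t, rfl⟩
    exact ⟨_, rfl⟩

theorem okD_face {s s' : Sg (UConf q ℂ)} {G0 G1 : Finset ℕ} (h : (s, G0, G1) ∈ okD q) (hr : Set.range s'.2 ⊆ Set.range s.2) :
    (s', G0, G1) ∈ okD q := by
  obtain ⟨h1, h2, h3, h4⟩ := h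
  refine ⟨h1, h2, fun t => ?_, fun t => ?_⟩
  · obtain ⟨t', e⟩ := hr ⟨t, rfl⟩
    have := h3 t'
    change s.2 t' ∈ _ at this
    rwa [e] at this
  · obtain ⟨t', e⟩ := hr ⟨t, rfl⟩
    have := h4 t'
    change s.2 t' ∈ _ at this
    rwa [e] at this

theorem okD_raise {s : Sg (UConf q ℂ)} {G0 G1 : Finset ℕ} (h : (s, G0, G1) ∈ okD q) {g : ℕ} (hg : g ∈ G1 \ G0) :
    (s, insert g G0, G1) ∈ okD q := by
  obtain ⟨h1, h2, h3, h4⟩ := h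
  have hi : insert g G0 ⊆ G1 := Finset.insert_subset (Finset.mem_sdiff.1 hg).1 h1
  exact ⟨hi, h2, fun t => VG_mid (Finset.subset_insert _ _) hi h2 (h3 t) (h4 t), h4⟩

theorem okD_lower {s : Sg (UConf q ℂ)} {G0 G1 : Finset ℕ} (h : (s, G0, G1) ∈ okD q) {g : ℕ} (hg : g ∈ G1 \ G0) :
    (s, G0, G1.erase g) ∈ okD q := by
  obtain ⟨h1, h2, h3, h4⟩ := h
  have hi : G0 ⊆ G1.erase g := Finset.subset_erase.2 ⟨h1, (Finset.mem_sdiff.1 hg).2⟩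
  exact ⟨hi, (Finset.erase_subset _ _).trans h2, h3, fun t => VG_mid hi (Finset.erase_subset _ _) h2 (h3 t) (h4 t)⟩

theorem dD_mem (i : IX q) (hi : i ∈ okD q) : dD F q (bs F i) ∈ spn F (okD q) := by
  obtain ⟨s, G0, G1⟩ := i
  rw [dD_bs]
  refine add_mem (plc_face s G0 G1 fun s' _ hr => okD_face hi hr) (Submodule.smul_mem _ _ (Submodule.sum_mem _ fun g hg => ?_))
  exact Submodule.smul_mem _ _ (sub_mem (bs_mem (okD_raise hi hg)) (bs_mem (okD_lower hi hg)))

end P4a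

section P4b
set_option linter.unusedVariables false
set_option linter.unusedSimpArgs false

variable {F : Type} [Field F] {q : ℕ}

/-- charts indexed by gap sets -/
def UV (q : ℕ) (G : {G : Finset ℕ // G ⊆ Finset.Ico 1 q}) : Set (UConf q ℂ) := VG q G.1

open Classical in
/-- maximal chart -/
noncomputable def jm (s : Sg (UConf q ℂ)) : Finset ℕ :=
  ((Finset.Ico 1 q).powerset.filter fun G => ∀ t, s.2 t ∈ VG q G).sup id

theorem jm_le (s : Sg (UConf q ℂ)) {G : Finset ℕ} (hG : G ⊆ Finset.Ico 1 q) (h : ∀ t, s.2 t ∈ VG q G) : G ⊆ jm s := by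
  classical
  unfold jm
  exact Finset.le_sup (f := id) (Finset.mem_filter.2 ⟨Finset.mem_powerset.2 hG, h⟩)

theorem jm_spec {s : Sg (UConf q ℂ)} {G : Finset ℕ} (hG : G ⊆ Finset.Ico 1 q) (h : ∀ t, s.2 t ∈ VG q G) :
    jm s ⊆ Finset.Ico 1 q ∧ ∀ t, s.2 t ∈ VG q (jm s) := by
  classical
  have key : ∀ S : Finset (Finset ℕ), S.Nonempty → (∀ G ∈ S, G ⊆ Finset.Ico 1 q ∧ ∀ t, s.2 t ∈ VG q G) →
      S.sup id ⊆ Finset.Ico 1 q ∧ ∀ t, s.2 t ∈ VG q (S.sup id) := by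
    intro S hS
    induction hS using Finset.Nonempty.cons_induction with
    | singleton a => intro h; simpa using h
    | cons a S ha hS ih =>
      intro h
      have h1 := h a (by simp)
      have h2 := ih fun G hG => h G (by simp [hG])
      rw [Finset.sup_cons]
      exact ⟨Finset.union_subset h1.1 h2.1, fun t => VG_union h1.1 h2.1 (h1.2 t) (h2.2 t)⟩
  refine key _ ⟨G, Finset.mem_filter.2 ⟨Finset.mem_powerset.2 hG, h⟩⟩ fun G' h' => ?_
  rw [Finset.mem_filter, Finset.mem_powerset] at h'
  exact h'

noncomputable def mnS (S : Finset ℕ) : ℕ := sInf (S : Set ℕ)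
theorem mnS_mem {S : Finset ℕ} (h : S.Nonempty) : mnS S ∈ S := by
  have := Nat.sInf_mem (s := (S : Set ℕ)) h
  exact_mod_cast this
theorem mnS_le {S : Finset ℕ} {x : ℕ} (h : x ∈ S) : mnS S ≤ x := Nat.sInf_le (by exact_mod_cast h)

noncomputable def hD (F : Type) [Field F] (q : ℕ) : (IX q →₀ F) →ₗ[F] (IX q →₀ F) :=
  lext F fun i => if (jm i.1 \ i.2.1).Nonempty ∧ mnS (jm i.1 \ i.2.1) ∉ i.2.2 then
    (-1 : F) ^ i.1.1 • bs F (i.1, i.2.1, insert (mnS (jm i.1 \ i.2.1)) i.2.2) else 0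

theorem hD_bs (s : Sg (UConf q ℂ)) (G0 G1 : Finset ℕ) : hD F q (bs F (s, G0, G1)) =
    if (jm s \ G0).Nonempty ∧ mnS (jm s \ G0) ∉ G1 then
    (-1 : F) ^ s.1 • bs F (s, G0, insert (mnS (jm s \ G0)) G1) else 0 := lext_bs _ _

noncomputable def fDS (F : Type) [Field F] (q : ℕ) : (IX q →₀ F) →ₗ[F] (Sg (UConf q ℂ) →₀ F) :=
  lext F fun i => if i.2.1 = i.2.2 then bs F i.1 else 0

theorem fDS_bs (s : Sg (UConf q ℂ)) (G0 G1 : Finset ℕ) : fDS F q (bs F (s, G0, G1)) = if G0 = G1 then bs F s else 0 := lext_bs _ _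

noncomputable def hSD (F : Type) [Field F] (q : ℕ) : (Sg (UConf q ℂ) →₀ F) →ₗ[F] (IX q →₀ F) :=
  lext F fun s => bs F (s, jm s, jm s)

theorem hSD_bs (s : Sg (UConf q ℂ)) : hSD F q (bs F s) = bs F (s, jm s, jm s) := lext_bs _ _

def rhD (i : IX q) : ℕ := i.1.1 * (q + 1) + (q - i.2.1.card)

theorem card_le_q {G : Finset ℕ} (hG : G ⊆ Finset.Ico 1 q) : G.card ≤ q := by
  have := Finset.card_le_card hG
  rw [Nat.card_Ico] at this
  omega

theorem okD_ins {s : Sg (UConf q ℂ)} {G0 G1 : Finset ℕ} (h : (s, G0, G1) ∈ okD q) (hn : (jm s \ G0).Nonempty) :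
    (s, G0, insert (mnS (jm s \ G0)) G1) ∈ okD q := by
  obtain ⟨h1, h2, h3, h4⟩ := h
  have hj := jm_spec h2 h4
  have hm := Finset.mem_sdiff.1 (mnS_mem hn)
  have hs : insert (mnS (jm s \ G0)) G1 ⊆ jm s := Finset.insert_subset hm.1 (jm_le s h2 h4)
  exact ⟨h1.trans (Finset.subset_insert _ _), hs.trans hj.1, h3, fun t =>
    VG_mid (Finset.subset_insert _ _) hs hj.1 (h4 t) (hj.2 t)⟩

theorem okD_jm {s : Sg (UConf q ℂ)} {G : Finset ℕ} (hG : G ⊆ Finset.Ico 1 q) (h : ∀ t, s.2 t ∈ VG q G) :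
    (s, jm s, jm s) ∈ okD q := by
  have hj := jm_spec hG h
  exact ⟨subset_rfl, hj.1, hj.2, hj.2⟩

/-- lower part of the filtration -/
noncomputable def LwD (F : Type) [Field F] (q r : ℕ) : Submodule F (IX q →₀ F) := spn F {j | j ∈ okD q ∧ rhD j < r}

theorem LwD_mono {r r' : ℕ} (h : r ≤ r') : LwD F q r ≤ LwD F q r' :=
  Submodule.span_mono (Set.image_mono fun j hj => ⟨hj.1, hj.2.trans_le h⟩)

theorem hD_Lw (r : ℕ) : ∀ x ∈ LwD F q r, hD F q x ∈ LwD F q r := by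
  refine spn_map _ _ ?_
  rintro ⟨s, G0, G1⟩ ⟨hi, hr⟩
  rw [hD_bs]
  split_ifs with h
  · exact Submodule.smul_mem _ _ (bs_mem ⟨okD_ins hi h.1, hr⟩)
  · exact zero_mem _

theorem face_Lw {s : Sg (UConf q ℂ)} {G0 G1 : Finset ℕ} (hi : (s, G0, G1) ∈ okD q) :
    plc F q G0 G1 (dS F _ (bs F s)) ∈ LwD F q (s.1 * (q + 1)) := by
  refine plc_face s G0 G1 fun s' h hr => ⟨okD_face hi hr, ?_⟩
  unfold rhD
  simp only []
  rw [← h]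
  have : (s'.1 + 1) * (q + 1) = s'.1 * (q + 1) + (q + 1) := by ring
  omega

theorem dD_Lw {s : Sg (UConf q ℂ)} {G0 G1 : Finset ℕ} (hi : (s, G0, G1) ∈ okD q) :
    dD F q (bs F (s, G0, G1)) + (-1 : F) ^ s.1 • ∑ g ∈ G1 \ G0, sgF F g (G1 \ G0) • bs F (s, G0, G1.erase g) ∈
      LwD F q (rhD (s, G0, G1)) := by
  rw [dD_bs]
  simp only [smul_sub, Finset.sum_sub_distrib]
  have h1 : plc F q G0 G1 (dS F _ (bs F s)) ∈ LwD F q (rhD (s, G0, G1)) := LwD_mono (by unfold rhD; simp) (face_Lw hi)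
  have h2 : (-1 : F) ^ s.1 • ∑ g ∈ G1 \ G0, sgF F g (G1 \ G0) • bs F (s, insert g G0, G1) ∈ LwD F q (rhD (s, G0, G1)) := by
    refine Submodule.smul_mem _ _ (Submodule.sum_mem _ fun g hg => Submodule.smul_mem _ _ (bs_mem ⟨okD_raise hi hg, ?_⟩))
    unfold rhD
    simp only []
    have hc := card_le_q ((okD_raise hi hg).1.trans hi.2.1)
    simp only [] at hc
    rw [Finset.card_insert_of_notMem (Finset.mem_sdiff.1 hg).2] at hc ⊢
    omega
  have := add_mem h1 h2
  convert this using 1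
  abel

theorem D_NAA (i : IX q) (hi : i ∈ okD q) : bs F i + dD F q (hD F q (bs F i)) + hD F q (dD F q (bs F i)) - hSD F q (fDS F q (bs F i)) ∈
    LwD F q (rhD i) := by
  obtain ⟨s, G0, G1⟩ := i
  have hi' := hi
  obtain ⟨h1, h2, h3, h4⟩ := hi'
  simp only [] at h1 h2 h3 h4
  have hJ := jm_le s h2 h4
  have e2 := hD_Lw _ _ (dD_Lw (F := F) hi)
  rw [map_add, map_smul, map_sum] at e2
  by_cases hn : (jm s \ G0).Nonempty
  · -- nontrivial case
    obtain ⟨g, hg⟩ : ∃ g, g = mnS (jm s \ G0) := ⟨_, rfl⟩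
    have hgm := Finset.mem_sdiff.1 (mnS_mem hn)
    rw [← hg] at hgm
    have hf : hSD F q (fDS F q (bs F (s, G0, G1))) ∈ LwD F q (rhD (s, G0, G1)) := by
      rw [fDS_bs]
      split_ifs with h
      · rw [hSD_bs]
        refine bs_mem ⟨okD_jm h2 h4, ?_⟩
        have hc := card_le_q (jm_spec h2 h4).1
        have : G0.card < (jm s).card := Finset.card_lt_card ⟨h1.trans hJ, fun hh => hgm.2 (hh hgm.1)⟩
        unfold rhD
        simp only []
        omega
      · rw [map_zero]; exact zero_mem _
    refine sub_mem ?_ hf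
    have hid := contr_id (F := F) G0 G1 (fun G => bs F (s, G0, G)) g hgm.2 (fun x hx => by
      rw [Finset.mem_sdiff] at hx
      rw [hg]
      exact mnS_le (Finset.mem_sdiff.2 ⟨hJ hx.1, hx.2⟩))
    -- first term
    have e1 : dD F q (hD F q (bs F (s, G0, G1))) + (if g ∈ G1 then 0 else
        ∑ h ∈ insert g G1 \ G0, sgF F h (insert g G1 \ G0) • bs F (s, G0, (insert g G1).erase h)) ∈ LwD F q (rhD (s, G0, G1)) := by
      rw [hD_bs, ← hg]
      by_cases hg1 : g ∈ G1
      · rw [if_neg (fun h => h.2 hg1), if_pos hg1, map_zero, zero_add]; exact zero_mem _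
      · rw [if_pos ⟨hn, hg1⟩, if_neg hg1, map_smul]
        have := Submodule.smul_mem _ ((-1 : F) ^ s.1) (dD_Lw (F := F) (okD_ins hi hn))
        rw [smul_add, smul_smul, ← mul_pow, ← hg, neg_one_mul, neg_neg, one_pow, one_smul] at this
        exact this
    have e3 : (-1 : F) ^ s.1 • ∑ h ∈ G1 \ G0, hD F q (sgF F h (G1 \ G0) • bs F (s, G0, G1.erase h)) =
        ∑ h ∈ G1 \ G0, sgF F h (G1 \ G0) • (if g ∈ G1.erase h then 0 else bs F (s, G0, insert g (G1.erase h))) := by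
      rw [Finset.smul_sum]
      refine Finset.sum_congr rfl fun h hh => ?_
      rw [map_smul, hD_bs, smul_comm, ← hg]
      congr 1
      by_cases hg1 : g ∈ G1.erase h
      · rw [if_neg (fun h => h.2 hg1), if_pos hg1, smul_zero]
      · rw [if_pos ⟨hn, hg1⟩, if_neg hg1, smul_smul, ← mul_pow]; simp
    rw [e3] at e2
    have := add_mem e1 e2
    generalize (if g ∈ G1 then 0 else ∑ h ∈ insert g G1 \ G0, sgF F h (insert g G1 \ G0) • bs F (s, G0, (insert g G1).erase h)) = A at this hid
    generalize (∑ h ∈ G1 \ G0, sgF F h (G1 \ G0) • (if g ∈ G1.erase h then 0 else bs F (s, G0, insert g (G1.erase h)))) = B at this hid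
    have h0 : bs F (s, G0, G1) = A + B := by
      rw [sub_sub, sub_eq_zero] at hid
      exact hid
    rw [h0] at this ⊢
    have e9 : ∀ a b c d : IX q →₀ F, a + b + c + d = (c + a) + (d + b) := by intros; abel
    rw [e9]
    exact this
  · have e0 : jm s = G0 := by
      rw [Finset.not_nonempty_iff_eq_empty, Finset.sdiff_eq_empty_iff_subset] at hn
      exact hn.antisymm (h1.trans hJ)
    have e1 : G0 = G1 := h1.antisymm (hJ.trans e0.subset)
    subst e1
    rw [fDS_bs, if_pos rfl, hSD_bs, e0, hD_bs, if_neg (fun h => hn h.1), map_zero]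
    simp only [sdiff_self, Finset.sum_empty, smul_zero, add_zero, Finset.bot_eq_empty] at e2
    convert e2 using 1
    abel

theorem small_equiv : Nonempty (HH (dD F q) (spn F (okD q)) ≃ₗ[F] HH (dS F (UConf q ℂ)) (spn F (Sm (UV q)))) := by
  refine cone_equiv (fun i => bs F i) (okD q) rhD (fun i => bs F i) (Sm (UV q)) (fun s => s.1 * (q + 1)) (dD F q) (dS F _)
    (fDS F q) (hD F q) 0 (hSD F q) 0 dD_mem (fun i hi => dS_small _ _ (bs_mem hi)) ?_ ?_ ?_ ?_ ?_ (fun i _ => dD_dD i)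
    (fun i _ => dS_dS _) ?_ D_NAA ?_ ?_ ?_
  · rintro ⟨s, G0, G1⟩ hi
    rw [fDS_bs]
    split_ifs with h
    · exact bs_mem ⟨⟨G1, hi.2.1⟩, hi.2.2.2⟩
    · exact zero_mem _
  · rintro ⟨s, G0, G1⟩ hi
    rw [hD_bs]
    split_ifs with h
    · exact Submodule.smul_mem _ _ (bs_mem (okD_ins hi h.1))
    · exact zero_mem _
  · intro i _; simp
  · rintro s ⟨⟨G, hG⟩, h⟩
    rw [hSD_bs]
    exact bs_mem (okD_jm hG h)
  · intro i _; simp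
  · rintro ⟨s, G0, G1⟩ hi
    have e : ∀ x, fDS F q (plc F q G0 G1 x) = if G0 = G1 then x else 0 := by
      intro x
      have : (fDS F q).comp (plc F q G0 G1) = if G0 = G1 then LinearMap.id else 0 := by
        refine bs_ext fun s => ?_
        rw [LinearMap.comp_apply, plc_bs, fDS_bs]
        split_ifs <;> rfl
      have := LinearMap.congr_fun this x
      rw [LinearMap.comp_apply] at this
      rw [this]
      split_ifs <;> rfl
    rw [dD_bs, map_add, e, fDS_bs, map_smul, map_sum]
    by_cases h : G0 = G1
    · subst h
      rw [if_pos rfl, if_pos rfl]; simp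
    · rw [if_neg h, if_neg h, map_zero, zero_add]
      rw [Finset.sum_eq_zero, smul_zero]
      intro g hg
      rw [Finset.mem_sdiff] at hg
      rw [map_smul, map_sub, fDS_bs, fDS_bs]
      have h1 : (insert g G0 = G1) ↔ (G0 = G1.erase g) := by
        constructor
        · rintro rfl; rw [Finset.erase_insert hg.2]
        · rintro rfl; rw [Finset.insert_erase hg.1]
      simp only [h1, sub_self, smul_zero]
  · rintro ⟨s, G0, G1⟩ hi
    simp only [LinearMap.zero_apply, map_zero, add_zero, sub_zero]
    rw [hD_bs]
    split_ifs with h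
    · rw [map_smul, fDS_bs, if_neg, smul_zero]
      · exact zero_mem _
      · intro e
        have := Finset.mem_sdiff.1 (mnS_mem h.1)
        exact this.2 (e.symm.subset (Finset.mem_insert_self _ _))
    · rw [map_zero]; exact zero_mem _
  · rintro s ⟨⟨G, hG⟩, h⟩
    rw [hSD_bs, dD_bs]
    simp only [sdiff_self, Finset.sum_empty, smul_zero, add_zero, Finset.bot_eq_empty]
    refine sub_mem (face_Lw (okD_jm hG h)) ?_
    obtain ⟨n, s⟩ := s
    cases n with
    | zero =>
      rw [show dS F _ (bs F ⟨0, s⟩) = 0 from dS_zero s]; simp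
    | succ n =>
      rw [show dS F _ (bs F ⟨n + 1, s⟩) = _ from dS_succ s, map_sum]
      refine Submodule.sum_mem _ fun i _ => ?_
      rw [map_smul, show hSD F q (sg F (faceS s i)) = _ from hSD_bs ⟨n, faceS s i⟩]
      refine Submodule.smul_mem _ _ (bs_mem ⟨okD_jm hG fun t => h _, ?_⟩)
      unfold rhD
      simp only []
      have : (n + 1) * (q + 1) = n * (q + 1) + (q + 1) := by ring
      omega
  · intro s hs
    simp only [LinearMap.zero_apply, map_zero, sub_zero]
    rw [hSD_bs, fDS_bs, if_pos rfl, sub_self]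
    exact zero_mem _

theorem chart_equiv : Nonempty (HH (dD F q) (spn F (okD q)) ≃ₗ[F] HH (dS F (UConf q ℂ)) ⊤) := by
  obtain ⟨e⟩ := small_equiv (F := F) (q := q)
  obtain ⟨e'⟩ := small_simplices (F := F) (UV q) (fun G => VG_open G.1) (fun x => by
    obtain ⟨G, hG, h⟩ := VG_cover x
    exact ⟨⟨G, hG⟩, h⟩)
  exact ⟨e.trans e'⟩

end P4b

section P4c
set_option linter.unusedVariables false
set_option linter.unusedSimpArgs false

variable {F : Type} [Field F] {q : ℕ}

/-- index type of the combinatorial complex -/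
abbrev IK (q : ℕ) : Type := Finset ℕ × Finset ℕ × Equiv.Perm (Fin q)

/-- a point of the simplex -/
noncomputable def dpt (n : ℕ) : Dl (n + 1) := ⟨Pi.single 0 1, single_mem_stdSimplex ℝ 0⟩

noncomputable def dKb (F : Type) [Field F] (q : ℕ) (i : IK q) : IK q →₀ F :=
  ∑ g ∈ i.2.1 \ i.1, sgF F g (i.2.1 \ i.1) •
      (bs F (insert g i.1, i.2.1, lab (insert g i.1) i.2.1 (pj (bpt i.2.1 i.2.2))) -
        bs F (i.1, i.2.1.erase g, lab i.1 (i.2.1.erase g) (pj (bpt i.2.1 i.2.2))))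

noncomputable def dK (F : Type) [Field F] (q : ℕ) : (IK q →₀ F) →ₗ[F] (IK q →₀ F) := lext F (dKb F q)

theorem dK_bs (G0 G1 : Finset ℕ) (w : Equiv.Perm (Fin q)) : dK F q (bs F (G0, G1, w)) =
    ∑ g ∈ G1 \ G0, sgF F g (G1 \ G0) •
      (bs F (insert g G0, G1, lab (insert g G0) G1 (pj (bpt G1 w))) -
        bs F (G0, G1.erase g, lab G0 (G1.erase g) (pj (bpt G1 w)))) := lext_bs _ _

def okK (q : ℕ) : Set (IK q) := {i | i.1 ⊆ i.2.1 ∧ i.2.1 ⊆ Finset.Ico 1 q ∧ Dp i.1 i.2.1 i.2.2}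

theorem bpt_Cw {G0 G1 : Finset ℕ} {w : Equiv.Perm (Fin q)} (h : (G0, G1, w) ∈ okK q) : pj (bpt G1 w) ∈ Cw G0 G1 w :=
  pj_mem_Cw (h.1.trans h.2.1) h.2.1 (bpt_mem h.1 h.2.2)

theorem lab_split {G0 G G1 : Finset ℕ} (h0 : G0 ⊆ G) (h1 : G ⊆ G1) (hG : G1 ⊆ Finset.Ico 1 q) {w : Equiv.Perm (Fin q)}
    {x y : UConf q ℂ} (hx : x ∈ Cw G0 G1 w) (hy : y ∈ Cw G0 G1 w) :
    lab G0 G x = lab G0 G y ∧ lab G G1 x = lab G G1 y := by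
  have mx := VG_mid h0 h1 hG hx.1 hx.2.1
  have my := VG_mid h0 h1 hG hy.1 hy.2.1
  refine Dp.unique (lab_Dp h0 (h1.trans hG) hx.1 mx) (lab_Dp h1 hG mx hx.2.1) (lab_Dp h0 (h1.trans hG) hy.1 my)
    (lab_Dp h1 hG my hy.2.1) ?_
  rw [← lab_mul hx.1 mx hx.2.1, ← lab_mul hy.1 my hy.2.1, hx.2.2, hy.2.2]

/-- label of a simplex -/
noncomputable def slab (s : Sg (UConf q ℂ)) (G0 G1 : Finset ℕ) : Equiv.Perm (Fin q) := lab G0 G1 (s.2 (dpt s.1))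

theorem slab_Cw {s : Sg (UConf q ℂ)} {G0 G1 : Finset ℕ} (h : (s, G0, G1) ∈ okD q) (t) : s.2 t ∈ Cw G0 G1 (slab s G0 G1) :=
  ⟨h.2.2.1 t, h.2.2.2 t, lab_const (h.1.trans h.2.1) h.2.1 s.2 h.2.2.1 h.2.2.2 _ _⟩

theorem slab_okK {s : Sg (UConf q ℂ)} {G0 G1 : Finset ℕ} (h : (s, G0, G1) ∈ okD q) : (G0, G1, slab s G0 G1) ∈ okK q :=
  ⟨h.1, h.2.1, lab_Dp h.1 h.2.1 (h.2.2.1 _) (h.2.2.2 _)⟩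

theorem slab_eq {s : Sg (UConf q ℂ)} {G0 G1 : Finset ℕ} (h : (s, G0, G1) ∈ okD q) {x} {w} (hw : s.2 x ∈ Cw G0 G1 w) :
    slab s G0 G1 = w := by
  rw [← hw.2.2]
  exact lab_const (h.1.trans h.2.1) h.2.1 s.2 h.2.2.1 h.2.2.2 _ _

noncomputable def fDK (F : Type) [Field F] (q : ℕ) : (IX q →₀ F) →ₗ[F] (IK q →₀ F) :=
  lext F fun i => if i.1.1 = 0 then bs F (i.2.1, i.2.2, slab i.1 i.2.1 i.2.2) else 0

theorem fDK_bs (s : Sg (UConf q ℂ)) (G0 G1 : Finset ℕ) : fDK F q (bs F (s, G0, G1)) =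
    if s.1 = 0 then bs F (G0, G1, slab s G0 G1) else 0 := lext_bs _ _

noncomputable def hDc (F : Type) [Field F] (q : ℕ) : (IX q →₀ F) →ₗ[F] (IX q →₀ F) :=
  lext F fun i => - bs F (⟨i.1.1 + 1, coneC i.2.1 i.2.2 (slab i.1 i.2.1 i.2.2) i.1.2⟩, i.2.1, i.2.2)

theorem hDc_bs (s : Sg (UConf q ℂ)) (G0 G1 : Finset ℕ) : hDc F q (bs F (s, G0, G1)) =
    - bs F (⟨s.1 + 1, coneC G0 G1 (slab s G0 G1) s.2⟩, G0, G1) := lext_bs _ _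

noncomputable def hKD (F : Type) [Field F] (q : ℕ) : (IK q →₀ F) →ₗ[F] (IX q →₀ F) :=
  lext F fun i => bs F (⟨0, bvt i.2.1 i.2.2⟩, i.1, i.2.1)

theorem hKD_bs (G0 G1 : Finset ℕ) (w : Equiv.Perm (Fin q)) : hKD F q (bs F (G0, G1, w)) = bs F (⟨0, bvt G1 w⟩, G0, G1) := lext_bs _ _

theorem cone_okD {s : Sg (UConf q ℂ)} {G0 G1 : Finset ℕ} (h : (s, G0, G1) ∈ okD q) :
    ((⟨s.1 + 1, coneC G0 G1 (slab s G0 G1) s.2⟩ : Sg (UConf q ℂ)), G0, G1) ∈ okD q := by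
  have := (coneC_spec (h.1.trans h.2.1) h.2.1 h.1 (slab s G0 G1) s.2 (slab_Cw h)).1
  exact ⟨h.1, h.2.1, fun t => (this t).1, fun t => (this t).2.1⟩

theorem bvt_okD {G0 G1 : Finset ℕ} {w : Equiv.Perm (Fin q)} (h : (G0, G1, w) ∈ okK q) :
    ((⟨0, bvt G1 w⟩ : Sg (UConf q ℂ)), G0, G1) ∈ okD q :=
  ⟨h.1, h.2.1, fun _ => (bpt_Cw h).1, fun _ => (bpt_Cw h).2.1⟩

theorem bvt_slab {G0 G1 : Finset ℕ} {w : Equiv.Perm (Fin q)} (h : (G0, G1, w) ∈ okK q) :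
    slab (⟨0, bvt G1 w⟩ : Sg (UConf q ℂ)) G0 G1 = w := (bpt_Cw h).2.2

theorem okK_raise {G0 G1 : Finset ℕ} {w : Equiv.Perm (Fin q)} (h : (G0, G1, w) ∈ okK q) {g : ℕ} (hg : g ∈ G1 \ G0) :
    (insert g G0, G1, lab (insert g G0) G1 (pj (bpt G1 w))) ∈ okK q := by
  have hb := bpt_Cw h
  have hi : insert g G0 ⊆ G1 := Finset.insert_subset (Finset.mem_sdiff.1 hg).1 h.1
  exact ⟨hi, h.2.1, lab_Dp hi h.2.1 (VG_mid (Finset.subset_insert _ _) hi h.2.1 hb.1 hb.2.1) hb.2.1⟩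

theorem okK_lower {G0 G1 : Finset ℕ} {w : Equiv.Perm (Fin q)} (h : (G0, G1, w) ∈ okK q) {g : ℕ} (hg : g ∈ G1 \ G0) :
    (G0, G1.erase g, lab G0 (G1.erase g) (pj (bpt G1 w))) ∈ okK q := by
  have hb := bpt_Cw h
  have hi : G0 ⊆ G1.erase g := Finset.subset_erase.2 ⟨h.1, (Finset.mem_sdiff.1 hg).2⟩
  exact ⟨hi, (Finset.erase_subset _ _).trans h.2.1, lab_Dp hi ((Finset.erase_subset _ _).trans h.2.1) hb.1
    (VG_mid hi (Finset.erase_subset _ _) h.2.1 hb.1 hb.2.1)⟩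

theorem dK_mem (i : IK q) (hi : i ∈ okK q) : dK F q (bs F i) ∈ spn F (okK q) := by
  obtain ⟨G0, G1, w⟩ := i
  rw [dK_bs]
  exact Submodule.sum_mem _ fun g hg => Submodule.smul_mem _ _ (sub_mem (bs_mem (okK_raise hi hg)) (bs_mem (okK_lower hi hg)))

theorem fDK_dD (i : IX q) (hi : i ∈ okD q) : fDK F q (dD F q (bs F i)) = dK F q (fDK F q (bs F i)) := by
  obtain ⟨s, G0, G1⟩ := i
  rw [dD_bs, fDK_bs, map_add, map_smul, map_sum]
  by_cases h0 : s.1 = 0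
  · rw [if_pos h0, h0, pow_zero, one_smul, dK_bs]
    have e : dS F _ (bs F s) = 0 := by
      obtain ⟨n, s⟩ := s
      simp only at h0
      subst h0
      exact dS_zero s
    rw [e, map_zero, map_zero, zero_add]
    refine Finset.sum_congr rfl fun g hg => ?_
    have hi1 : insert g G0 ⊆ G1 := Finset.insert_subset (Finset.mem_sdiff.1 hg).1 hi.1
    have hi2 : G0 ⊆ G1.erase g := Finset.subset_erase.2 ⟨hi.1, (Finset.mem_sdiff.1 hg).2⟩
    rw [map_smul, map_sub, fDK_bs, fDK_bs, if_pos h0, if_pos h0]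
    have e1 := (lab_split (Finset.subset_insert _ _) hi1 hi.2.1 (slab_Cw hi (dpt _)) (bpt_Cw (slab_okK hi))).2
    have e2 := (lab_split hi2 (Finset.erase_subset _ _) hi.2.1 (slab_Cw hi (dpt _)) (bpt_Cw (slab_okK hi))).1
    rw [← e1, ← e2]
    rfl
  · rw [if_neg h0, map_zero]
    have : ∑ g ∈ G1 \ G0, fDK F q (sgF F g (G1 \ G0) • (bs F (s, insert g G0, G1) - bs F (s, G0, G1.erase g))) = 0 := by
      refine Finset.sum_eq_zero fun g _ => ?_
      rw [map_smul, map_sub, fDK_bs, fDK_bs, if_neg h0, if_neg h0]; simp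
    rw [this, smul_zero, add_zero]
    obtain ⟨n, s⟩ := s
    cases n with
    | zero => exact absurd rfl h0
    | succ n =>
      rw [show dS F _ (bs F ⟨n + 1, s⟩) = _ from dS_succ s, map_sum, map_sum]
      have e : ∀ i : Fin (n + 2), fDK F q (plc F q G0 G1 ((-1 : F) ^ (i : ℕ) • sg F (faceS s i))) =
          (-1 : F) ^ (i : ℕ) • if n = 0 then bs F (G0, G1, slab ⟨n + 1, s⟩ G0 G1) else 0 := by
        intro i
        rw [map_smul, map_smul, show plc F q G0 G1 (sg F (faceS s i)) = bs F (⟨n, faceS s i⟩, G0, G1) from plc_bs _ _ _, fDK_bs]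
        congr 1
        have : slab (⟨n, faceS s i⟩ : Sg (UConf q ℂ)) G0 G1 = slab ⟨n + 1, s⟩ G0 G1 := by
          refine slab_eq (okD_face hi ?_) (x := dpt n) (slab_Cw hi _)
          rintro _ ⟨t, rfl⟩
          exact ⟨_, rfl⟩
        rw [this]
      rw [Finset.sum_congr rfl fun i _ => e i]
      split_ifs with hn
      · subst hn
        rw [Fin.sum_univ_two]; simp
      · simp

noncomputable def LwK (F : Type) [Field F] (q r : ℕ) : Submodule F (IX q →₀ F) := spn F {j | j ∈ okD q ∧ (j.2.2 \ j.2.1).card < r}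

theorem dDK_Lw {s : Sg (UConf q ℂ)} {G0 G1 : Finset ℕ} (hi : (s, G0, G1) ∈ okD q) :
    dD F q (bs F (s, G0, G1)) - plc F q G0 G1 (dS F _ (bs F s)) ∈ LwK F q ((G1 \ G0).card) := by
  rw [dD_bs, add_sub_cancel_left]
  refine Submodule.smul_mem _ _ (Submodule.sum_mem _ fun g hg => Submodule.smul_mem _ _ (sub_mem
    (bs_mem ⟨okD_raise hi hg, ?_⟩) (bs_mem ⟨okD_lower hi hg, ?_⟩)))
  · simp only []
    rw [sdiff_insert_er]
    exact Finset.card_erase_lt_of_mem hg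
  · simp only []
    rw [erase_sdiff_er]
    exact Finset.card_erase_lt_of_mem hg

theorem hDc_Lw (r : ℕ) : ∀ x ∈ LwK F q r, hDc F q x ∈ LwK F q r := by
  refine spn_map _ _ ?_
  rintro ⟨s, G0, G1⟩ ⟨hi, hr⟩
  rw [hDc_bs]
  exact neg_mem (bs_mem ⟨cone_okD hi, hr⟩)

theorem K_NAA (i : IX q) (hi : i ∈ okD q) : bs F i + dD F q (hDc F q (bs F i)) + hDc F q (dD F q (bs F i)) - hKD F q (fDK F q (bs F i)) ∈
    LwK F q ((i.2.2 \ i.2.1).card) := by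
  obtain ⟨s, G0, G1⟩ := i
  have e2 := hDc_Lw _ _ (dDK_Lw (F := F) hi)
  have e1 := dDK_Lw (F := F) (cone_okD hi)
  have key : bs F (s, G0, G1) - plc F q G0 G1 (dS F _ (bs F ⟨s.1 + 1, coneC G0 G1 (slab s G0 G1) s.2⟩))
      + hDc F q (plc F q G0 G1 (dS F _ (bs F s))) - hKD F q (fDK F q (bs F (s, G0, G1))) = 0 := by
    obtain ⟨n, s⟩ := s
    have hS := fun t => slab_Cw hi t
    generalize hw : slab ⟨n, s⟩ G0 G1 = w at hS
    have hG0 := hi.1.trans hi.2.1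
    rw [show dS F _ (bs F ⟨n + 1, coneC G0 G1 w s⟩) = _ from dS_succ _, fDK_bs, hw, Fin.sum_univ_succ, coneC_zero hG0 hi.2.1 hi.1 w s hS,
      map_add]
    rw [show ((-1 : F) ^ ((0 : Fin (n + 2)) : ℕ) • sg F s) = bs F ⟨n, s⟩ by simp; rfl, plc_bs]
    cases n with
    | zero =>
      rw [if_pos rfl, hKD_bs, show dS F _ (bs F ⟨0, s⟩) = 0 from dS_zero s, map_zero, map_zero, Fin.sum_univ_one]
      rw [show faceS (coneC G0 G1 w s) (Fin.succ 0) = bvt G1 w from coneC_one hG0 hi.2.1 hi.1 w s hS]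
      rw [map_smul, show plc F q G0 G1 (sg F (bvt G1 w)) = bs F (⟨0, bvt G1 w⟩, G0, G1) from plc_bs _ _ _]
      simp
    | succ n =>
      rw [if_neg (by simp), map_zero, show dS F _ (bs F ⟨n + 1, s⟩) = _ from dS_succ s, map_sum, map_sum, map_sum]
      have e : ∀ i : Fin (n + 2), hDc F q (plc F q G0 G1 ((-1 : F) ^ (i : ℕ) • sg F (faceS s i))) =
          plc F q G0 G1 ((-1 : F) ^ (i.succ : ℕ) • sg F (faceS (coneC G0 G1 w s) i.succ)) := by
        intro i
        rw [coneC_succ hG0 hi.2.1 hi.1 w s hS, map_smul, map_smul, map_smul,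
          show plc F q G0 G1 (sg F (faceS s i)) = bs F (⟨n, faceS s i⟩, G0, G1) from plc_bs _ _ _, hDc_bs]
        have : slab (⟨n, faceS s i⟩ : Sg (UConf q ℂ)) G0 G1 = w := by
          refine slab_eq (okD_face hi ?_) (x := dpt n) (hS _)
          rintro _ ⟨t, rfl⟩
          exact ⟨_, rfl⟩
        rw [this, show plc F q G0 G1 (sg F (coneC G0 G1 w (faceS s i))) = bs F (⟨n + 1, coneC G0 G1 w (faceS s i)⟩, G0, G1) from plc_bs _ _ _]
        rw [Fin.val_succ, pow_succ]
        simp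
      rw [Finset.sum_congr rfl fun i _ => e i]
      abel
  have := add_mem (sub_mem e2 e1) (show (0 : IX q →₀ F) ∈ LwK F q ((G1 \ G0).card) from zero_mem _)
  rw [map_sub, ← key] at this
  convert this using 1
  rw [hDc_bs, map_neg]
  abel

theorem comb_equiv : Nonempty (HH (dD F q) (spn F (okD q)) ≃ₗ[F] HH (dK F q) (spn F (okK q))) := by
  have hf : ∀ i ∈ okK q, fDK F q (hKD F q (bs F i)) = bs F i := by
    rintro ⟨G0, G1, w⟩ hi
    rw [hKD_bs, fDK_bs, if_pos rfl, bvt_slab hi]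
  have fds : ∀ x ∈ spn F (okD q), fDK F q (dD F q x) = dK F q (fDK F q x) :=
    eq_span_image _ (okD q) ((fDK F q).comp (dD F q)) ((dK F q).comp (fDK F q)) fDK_dD
  have hLw : ∀ r, ∀ x ∈ spn F {j | j ∈ okK q ∧ (j.2.1 \ j.1).card < r}, hKD F q x ∈ LwK F q r := by
    intro r
    refine spn_map _ _ ?_
    rintro ⟨G0, G1, w⟩ ⟨hi, hr⟩
    rw [hKD_bs]
    exact bs_mem ⟨bvt_okD hi, hr⟩
  refine cone_equiv (fun i => bs F i) (okD q) (fun j => (j.2.2 \ j.2.1).card) (fun i => bs F i) (okK q)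
    (fun j => (j.2.1 \ j.1).card) (dD F q) (dK F q)
    (fDK F q) (hDc F q) 0 (hKD F q) 0 dD_mem dK_mem ?_ ?_ ?_ ?_ ?_ (fun i _ => dD_dD i)
    ?_ fDK_dD K_NAA ?_ ?_ ?_
  · rintro ⟨s, G0, G1⟩ hi
    rw [fDK_bs]
    split_ifs with h
    · exact bs_mem (slab_okK hi)
    · exact zero_mem _
  · rintro ⟨s, G0, G1⟩ hi
    rw [hDc_bs]
    exact neg_mem (bs_mem (cone_okD hi))
  · intro i _; simp
  · rintro ⟨G0, G1, w⟩ hi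
    rw [hKD_bs]
    exact bs_mem (bvt_okD hi)
  · intro i _; simp
  · rintro ⟨G0, G1, w⟩ hi
    rw [← hf _ hi, hKD_bs, ← fds _ (bs_mem (bvt_okD hi)), ← fds _ (dD_mem _ (bvt_okD hi)), dD_dD, map_zero]
  · rintro ⟨s, G0, G1⟩ hi
    simp only [LinearMap.zero_apply, map_zero, add_zero, sub_zero]
    rw [hDc_bs, map_neg, fDK_bs, if_neg (by simp), neg_zero]
    exact zero_mem _
  · rintro ⟨G0, G1, w⟩ hi
    refine sub_mem ?_ (hLw _ _ ?_)
    · have := dDK_Lw (F := F) (bvt_okD hi)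
      rw [show dS F _ (bs F ⟨0, bvt G1 w⟩) = 0 from dS_zero _, map_zero, sub_zero] at this
      rw [hKD_bs]
      exact this
    · rw [dK_bs]
      refine Submodule.sum_mem _ fun g hg => Submodule.smul_mem _ _ (sub_mem (bs_mem ⟨okK_raise hi hg, ?_⟩) (bs_mem ⟨okK_lower hi hg, ?_⟩))
      · simp only []
        rw [sdiff_insert_er]
        exact Finset.card_erase_lt_of_mem hg
      · simp only []
        rw [erase_sdiff_er]
        exact Finset.card_erase_lt_of_mem hg
  · intro i hi
    simp only [LinearMap.zero_apply, map_zero, sub_zero]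
    rw [hf i hi, sub_self]
    exact zero_mem _

theorem dK_dK (i : IK q) (hi : i ∈ okK q) : dK F q (dK F q (bs F i)) = 0 := by
  have hf : ∀ i ∈ okK q, fDK F q (hKD F q (bs F i)) = bs F i := by
    rintro ⟨G0, G1, w⟩ hi
    rw [hKD_bs, fDK_bs, if_pos rfl, bvt_slab hi]
  have fds : ∀ x ∈ spn F (okD q), fDK F q (dD F q x) = dK F q (fDK F q x) :=
    eq_span_image _ (okD q) ((fDK F q).comp (dD F q)) ((dK F q).comp (fDK F q)) fDK_dD
  obtain ⟨G0, G1, w⟩ := i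
  rw [← hf _ hi, hKD_bs, ← fds _ (bs_mem (bvt_okD hi)), ← fds _ (dD_mem _ (bvt_okD hi)), dD_dD, map_zero]

end P4c

/-! ## Part 5: the small model -/

section P5a
set_option linter.unusedVariables false
set_option linter.unusedSimpArgs false

variable {F : Type} [Field F] {q : ℕ}

/-- inversions -/
def invS (w : Equiv.Perm (Fin q)) : Finset (Fin q × Fin q) := Finset.univ.filter fun p => p.1 < p.2 ∧ w p.2 < w p.1
def ninv (w : Equiv.Perm (Fin q)) : ℕ := (invS w).card

theorem mem_invS {w : Equiv.Perm (Fin q)} {i j : Fin q} : (i, j) ∈ invS w ↔ i < j ∧ w j < w i := by simp [invS]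

theorem ninv_le (w : Equiv.Perm (Fin q)) : ninv w ≤ q * q := by
  refine (Finset.card_le_univ _).trans ?_
  simp

theorem ninv_one : ninv (1 : Equiv.Perm (Fin q)) = 0 := by
  rw [ninv, Finset.card_eq_zero, Finset.eq_empty_iff_forall_notMem]
  rintro ⟨i, j⟩ h
  rw [mem_invS] at h
  exact absurd h.1 (not_lt.2 h.2.le)

theorem ninv_eq_zero {w : Equiv.Perm (Fin q)} (h : ninv w = 0) : w = 1 := by
  refine perm_eq_one w fun i j hij => ?_
  by_contra hc
  have : (i, j) ∈ invS w := mem_invS.2 ⟨hij, lt_of_le_of_ne (not_lt.1 hc) fun e => hij.ne' (w.injective e)⟩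
  rw [ninv, Finset.card_eq_zero] at h
  rw [h] at this
  simp at this

theorem ninv_mul {G G' G'' : Finset ℕ} {d u : Equiv.Perm (Fin q)} (hd : Dp G G' d) (hu : Dp G' G'' u) :
    ninv (d * u) = ninv d + ninv u := by
  classical
  unfold ninv
  rw [← Finset.card_filter_add_card_filter_not (s := invS (d * u)) (fun p => blk G' p.1 < blk G' p.2)]
  congr 1
  · refine Finset.card_bij (fun p _ => (u p.1, u p.2)) ?_ ?_ ?_
    · rintro ⟨i, j⟩ hp
      rw [Finset.mem_filter, mem_invS] at hp
      exact mem_invS.2 ⟨hu.1.lt hp.2, hp.1.2⟩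
    · rintro ⟨i, j⟩ _ ⟨i', j'⟩ _ h
      rw [Prod.mk.injEq] at h
      exact Prod.ext (u.injective h.1) (u.injective h.2)
    · rintro ⟨a, b⟩ hp
      rw [mem_invS] at hp
      have hb : blk G' a < blk G' b := by
        rcases (blk_mono G' hp.1.le).lt_or_eq with h | h
        · exact h
        · exact absurd (hd.2 a b hp.1 h) (not_lt.2 hp.2.le)
      refine ⟨(u⁻¹ a, u⁻¹ b), ?_, by rw [p_ai, p_ai]⟩
      rw [Finset.mem_filter, mem_invS]
      have h1 : blk G' (u⁻¹ a) < blk G' (u⁻¹ b) := by rw [hu.1.inv, hu.1.inv]; exact hb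
      refine ⟨⟨lt_of_blk_lt h1, ?_⟩, h1⟩
      rw [Equiv.Perm.mul_apply, Equiv.Perm.mul_apply, p_ai, p_ai]
      exact hp.2
  · congr 1
    ext ⟨i, j⟩
    rw [Finset.mem_filter, mem_invS, mem_invS]
    simp only [Equiv.Perm.mul_apply]
    constructor
    · rintro ⟨⟨h1, h2⟩, h3⟩
      have hb : blk G' i = blk G' j := le_antisymm (blk_mono G' h1.le) (not_lt.1 h3)
      refine ⟨h1, ?_⟩
      have hb' : blk G' (u j) = blk G' (u i) := by rw [hu.1, hu.1, hb]
      exact (hd.2.lt_iff hb').1 h2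
    · rintro ⟨h1, h2⟩
      have hb : ¬ blk G' i < blk G' j := fun h => absurd (hu.1.lt h) (not_lt.2 h2.le)
      have hb2 : blk G' i = blk G' j := le_antisymm (blk_mono G' h1.le) (not_lt.1 hb)
      have hb' : blk G' (u j) = blk G' (u i) := by rw [hu.1, hu.1, hb2]
      exact ⟨⟨h1, (hd.2.lt_iff hb').2 h2⟩, hb⟩

open Classical in
/-- set of labels -/
noncomputable def Dps (q : ℕ) (G0 G1 : Finset ℕ) : Finset (Equiv.Perm (Fin q)) := Finset.univ.filter fun w => Dp G0 G1 w

theorem mem_Dps {G0 G1 : Finset ℕ} {w : Equiv.Perm (Fin q)} : w ∈ Dps q G0 G1 ↔ Dp G0 G1 w := by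
  classical
  simp [Dps]

theorem Dp_one (G0 G1 : Finset ℕ) : Dp G0 G1 (1 : Equiv.Perm (Fin q)) := ⟨fun i => rfl, fun i j h _ => h⟩

theorem lab_fac {G0 G G1 : Finset ℕ} (h0 : G0 ⊆ G) (h1 : G ⊆ G1) {w : Equiv.Perm (Fin q)} (h : (G0, G1, w) ∈ okK q) :
    Dp G0 G (lab G0 G (pj (bpt G1 w))) ∧ Dp G G1 (lab G G1 (pj (bpt G1 w))) ∧
      lab G0 G (pj (bpt G1 w)) * lab G G1 (pj (bpt G1 w)) = w := by
  have hb := bpt_Cw h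
  have hm := VG_mid h0 h1 h.2.1 hb.1 hb.2.1
  refine ⟨lab_Dp h0 (h1.trans h.2.1) hb.1 hm, lab_Dp h1 h.2.1 hm hb.2.1, ?_⟩
  rw [← lab_mul hb.1 hm hb.2.1, hb.2.2]

theorem lab_fac_eq {G0 G G1 : Finset ℕ} (h0 : G0 ⊆ G) (h1 : G ⊆ G1) (hG : G1 ⊆ Finset.Ico 1 q) {d u : Equiv.Perm (Fin q)}
    (hd : Dp G0 G d) (hu : Dp G G1 u) :
    lab G0 G (pj (bpt G1 (d * u))) = d ∧ lab G G1 (pj (bpt G1 (d * u))) = u := by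
  obtain ⟨a, b, c⟩ := lab_fac h0 h1 (w := d * u) ⟨h0.trans h1, hG, hd.mul h0 h1 hu⟩
  exact Dp.unique a b hd hu c

theorem sum_Dp {M : Type*} [AddCommMonoid M] {G0 G G1 : Finset ℕ} (h0 : G0 ⊆ G) (h1 : G ⊆ G1) (hG : G1 ⊆ Finset.Ico 1 q)
    (φ : Equiv.Perm (Fin q) → M) : ∑ w ∈ Dps q G0 G1, φ w = ∑ d ∈ Dps q G0 G, ∑ u ∈ Dps q G G1, φ (d * u) := by
  rw [← Finset.sum_product']
  symm
  refine Finset.sum_bij (fun p _ => p.1 * p.2) ?_ ?_ ?_ ?_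
  · rintro ⟨d, u⟩ hp
    rw [Finset.mem_product, mem_Dps, mem_Dps] at hp
    exact mem_Dps.2 (hp.1.mul h0 h1 hp.2)
  · rintro ⟨d, u⟩ hp ⟨d', u'⟩ hp' h
    rw [Finset.mem_product, mem_Dps, mem_Dps] at hp hp'
    exact Prod.ext_iff.2 (Dp.unique hp.1 hp.2 hp'.1 hp'.2 h)
  · intro w hw
    rw [mem_Dps] at hw
    obtain ⟨a, b, c⟩ := lab_fac h0 h1 (w := w) ⟨h0.trans h1, hG, hw⟩
    exact ⟨(_, _), Finset.mem_product.2 ⟨mem_Dps.2 a, mem_Dps.2 b⟩, c⟩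
  · intros; rfl

/-- Poincare polynomial -/
noncomputable def PP (R : Type) [CommRing R] (t : R) (q : ℕ) (G0 G1 : Finset ℕ) : R := ∑ w ∈ Dps q G0 G1, t ^ ninv w

theorem PP_mul {R : Type} [CommRing R] (t : R) {G0 G G1 : Finset ℕ} (h0 : G0 ⊆ G) (h1 : G ⊆ G1) (hG : G1 ⊆ Finset.Ico 1 q) :
    PP R t q G0 G1 = PP R t q G0 G * PP R t q G G1 := by
  unfold PP
  rw [sum_Dp h0 h1 hG, Finset.sum_mul_sum]
  refine Finset.sum_congr rfl fun d hd => Finset.sum_congr rfl fun u hu => ?_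
  rw [ninv_mul (mem_Dps.1 hd) (mem_Dps.1 hu), pow_add]

/-- the cycle -/
def cyc (a b : ℕ) (hab : a ≤ b) (hb : b < q) : Equiv.Perm (Fin q) where
  toFun i := if i.1 = a then ⟨b, hb⟩ else if a < i.1 ∧ i.1 ≤ b then ⟨i.1 - 1, by omega⟩ else i
  invFun i := if i.1 = b then ⟨a, by omega⟩ else if h : a ≤ i.1 ∧ i.1 < b then ⟨i.1 + 1, by omega⟩ else i
  left_inv i := by
    obtain ⟨i, hi⟩ := i
    refine Fin.ext ?_
    dsimp only
    split_ifs <;> simp_all <;> (try split_ifs) <;> (try simp_all) <;> omega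
  right_inv i := by
    obtain ⟨i, hi⟩ := i
    refine Fin.ext ?_
    dsimp only
    split_ifs <;> simp_all <;> (try split_ifs) <;> (try simp_all) <;> omega

theorem cyc_val (a b : ℕ) (hab : a ≤ b) (hb : b < q) (i : Fin q) :
    (cyc a b hab hb i : ℕ) = if i.1 = a then b else if a < i.1 ∧ i.1 ≤ b then i.1 - 1 else i := by
  simp only [cyc, Equiv.coe_fn_mk]
  split_ifs <;> rfl

theorem ninv_cyc (a b : ℕ) (hab : a ≤ b) (hb : b < q) : ninv (cyc a b hab hb) = b - a := by
  rw [← Nat.card_Ioc a b]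
  symm
  unfold ninv
  refine Finset.card_bij (fun i hi => (⟨a, by omega⟩, ⟨i, by rw [Finset.mem_Ioc] at hi; omega⟩)) ?_ ?_ ?_
  · intro i hi
    rw [Finset.mem_Ioc] at hi
    rw [mem_invS, Fin.lt_def, Fin.lt_def, cyc_val, cyc_val]
    dsimp only
    rw [if_pos rfl, if_neg (by omega), if_pos (by omega)]
    omega
  · intro i _ j _ h
    simpa using h
  · rintro ⟨⟨i, hi⟩, ⟨j, hj⟩⟩ hp
    rw [mem_invS, Fin.lt_def, Fin.lt_def, cyc_val, cyc_val] at hp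
    dsimp only at hp
    have : i = a ∧ a < j ∧ j ≤ b := by
      obtain ⟨h1, h2⟩ := hp
      split_ifs at h2 <;> omega
    obtain ⟨rfl, h2, h3⟩ := this
    exact ⟨j, Finset.mem_Ioc.2 ⟨h2, h3⟩, rfl⟩

/-- block description -/
def Blk (q : ℕ) (G : Finset ℕ) (a0 m : ℕ) : Prop :=
  a0 + m ≤ q ∧ (a0 = 0 ∨ a0 ∈ G) ∧ (a0 + m = q ∨ a0 + m ∈ G) ∧ ∀ g ∈ G, g ≤ a0 ∨ a0 + m ≤ g

theorem Blk.blk_iff {G : Finset ℕ} {a0 m : ℕ} (h : Blk q G a0 m) {i j : Fin q} (hi : a0 ≤ i.1 ∧ i.1 < a0 + m) :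
    blk G i = blk G j ↔ a0 ≤ j.1 ∧ j.1 < a0 + m := by
  obtain ⟨h1, h2, h3, h4⟩ := h
  constructor
  · intro hb
    constructor
    · rcases h2 with h2 | h2
      · omega
      · by_contra hc
        have := (lt_iff_of_blk_eq h2 hb).2 (by omega)
        omega
    · rcases h3 with h3 | h3
      · have := j.2; omega
      · exact (lt_iff_of_blk_eq h3 hb).1 hi.2
  · intro hj
    refine blk_eq_of fun g hg => ?_
    rcases h4 g hg with h | h <;> omega

theorem Wp_full (w : Equiv.Perm (Fin q)) (h : Wp (Finset.Ico 1 q) w) : w = 1 := by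
  refine Equiv.ext fun i => ?_
  have := h i
  by_contra hne
  rcases lt_or_gt_of_ne hne with hl | hl
  · have := blk_lt_of (G := Finset.Ico 1 q) (i := w i) (j := i) (g := i.1) (Finset.mem_Ico.2 ⟨by have := Fin.lt_def.1 hl; simp at this; omega, i.2⟩) hl le_rfl
    omega
  · have := blk_lt_of (G := Finset.Ico 1 q) (i := i) (j := w i) (g := (w i).1) (Finset.mem_Ico.2 ⟨by have := Fin.lt_def.1 hl; simp at this; omega, (w i).2⟩) hl le_rfl
    omega

theorem Inc_full (w : Equiv.Perm (Fin q)) : Inc (Finset.Ico 1 q) w := by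
  intro i j hij hb
  have := blk_lt_of (G := Finset.Ico 1 q) (i := i) (j := j) (g := j.1) (Finset.mem_Ico.2 ⟨by have := Fin.lt_def.1 hij; omega, j.2⟩) hij le_rfl
  omega

theorem PP_cyc {R : Type} [CommRing R] (t : R) {G : Finset ℕ} (hG : G ⊆ Finset.Ico 1 q) {a0 m : ℕ} (hB : Blk q G a0 m) (hm : 1 < m) :
    PP R t q G (insert (a0 + 1) G) = ∑ j ∈ Finset.range m, t ^ j := by
  have hq := hB.1
  have ha : a0 < q := by omega
  set A : Fin q := ⟨a0, ha⟩ with hA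
  have hAm : a0 ≤ A.1 ∧ A.1 < a0 + m := by rw [hA]; dsimp only; omega
  have hi : insert (a0 + 1) G ⊆ Finset.Ico 1 q := Finset.insert_subset (Finset.mem_Ico.2 ⟨by omega, by omega⟩) hG
  unfold PP
  symm
  have hcD : ∀ j, (hj : j < m) → Dp G (insert (a0 + 1) G) (cyc a0 (a0 + j) (by omega) (by omega) : Equiv.Perm (Fin q)) := by
    intro j hj
    constructor
    · intro i
      by_cases hib : a0 ≤ i.1 ∧ i.1 < a0 + m
      · refine ((hB.blk_iff hib).2 ?_).symm
        rw [cyc_val]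
        split_ifs <;> omega
      · congr 1
        rw [cyc_val, if_neg (by omega), if_neg (by omega)]
    · intro i i' hii hb
      have := lt_iff_of_blk_eq (Finset.mem_insert_self _ _) hb
      rw [Fin.lt_def] at hii
      rw [Fin.lt_def, cyc_val, cyc_val]
      split_ifs <;> omega
  refine Finset.sum_bij (fun j hj => cyc a0 (a0 + j) (by omega) (by rw [Finset.mem_range] at hj; omega)) ?_ ?_ ?_ ?_
  · intro j hj
    exact mem_Dps.2 (hcD j (Finset.mem_range.1 hj))
  · intro j hj j' hj' h
    have := congrArg (fun w : Equiv.Perm (Fin q) => (w A).1) h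
    simp only [cyc_val, hA, if_true] at this
    omega
  · intro w hw
    rw [mem_Dps] at hw
    have h1 := (hB.blk_iff (j := w A) hAm).1 (hw.1 A).symm
    have hjm : (w A).1 - a0 < m := by omega
    refine ⟨(w A).1 - a0, Finset.mem_range.2 hjm, ?_⟩
    have hc := hcD _ hjm
    generalize hcc : (cyc a0 (a0 + ((w A).1 - a0)) (by omega) (by omega) : Equiv.Perm (Fin q)) = c at hc
    have hcA : c A = w A := by
      refine Fin.ext ?_
      rw [← hcc, cyc_val, if_pos (by rw [hA])]
      omega
    have hv : Wp (insert (a0 + 1) G) (c⁻¹ * w) := by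
      have hvG : Wp G (c⁻¹ * w) := hc.1.inv.mul hw.1
      have hvA : (c⁻¹ * w) A = A := by rw [Equiv.Perm.mul_apply, ← hcA, p_ia]
      intro i
      refine blk_eq_of fun g hg => ?_
      rw [Finset.mem_insert] at hg
      rcases hg with rfl | hg
      · by_cases hiA : i = A
        · rw [hiA, hvA]
        · have hne : (c⁻¹ * w) i ≠ A := fun e => hiA ((c⁻¹ * w).injective (e.trans hvA.symm))
          have h5 : i.1 ≠ a0 := fun e => hiA (Fin.ext e)
          have h6 : ((c⁻¹ * w) i).1 ≠ a0 := fun e => hne (Fin.ext e)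
          rcases hB.2.1 with h | h
          · omega
          · have := lt_iff_of_blk_eq h (hvG i)
            omega
      · exact lt_iff_of_blk_eq hg (hvG i)
    refine (Dp.unique (G'' := Finset.Ico 1 q) (u := c⁻¹ * w) (u' := 1) hc ⟨hv, Inc_full _⟩ hw (Dp_one _ _) ?_).1
    rw [mul_inv_cancel_left, mul_one]
  · intro j hj
    rw [ninv_cyc]
    congr 1
    omega

end P5a

section P5b
set_option linter.unusedVariables false
set_option linter.unusedSimpArgs false

/-- Gaussian binomials -/
def qb {R : Type} [CommRing R] (t : R) : ℕ → ℕ → R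
  | _, 0 => 1
  | 0, _ + 1 => 0
  | n + 1, k + 1 => qb t n k + t ^ (k + 1) * qb t n (k + 1)

theorem qb_zero {R : Type} [CommRing R] (t : R) (n : ℕ) : qb t n 0 = 1 := by cases n <;> rfl
theorem qb_succ {R : Type} [CommRing R] (t : R) (n k : ℕ) : qb t (n + 1) (k + 1) = qb t n k + t ^ (k + 1) * qb t n (k + 1) := rfl

theorem qb_abs {R : Type} [CommRing R] (t : R) (n : ℕ) : ∀ k, qb t (n + 1) (k + 1) * (1 - t ^ (k + 1)) = (1 - t ^ (n + 1)) * qb t n k := by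
  induction n with
  | zero =>
    intro k
    cases k with
    | zero => simp [qb]
    | succ k => simp [qb]
  | succ n ih =>
    have hB : ∀ k, t ^ k * (1 - t ^ (n + 1)) * qb t n k = (t ^ k - t ^ (n + 1)) * qb t (n + 1) k := by
      intro k
      cases k with
      | zero => simp [qb_zero]
      | succ k =>
        have := ih k
        have h2 := qb_succ t n k
        linear_combination (-(1 - t ^ (n + 1))) * h2 + this
    intro k
    have h1 := qb_succ t (n + 1) k
    have h2 := ih k
    have h3 := hB k
    rw [h1]
    linear_combination t ^ (k + 1) * h2 + t * h3

theorem qb_neg {F : Type} [Field F] : ∀ n k, qb (-1 : F) n k = b2 F n k := by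
  intro n
  induction n with
  | zero =>
    intro k
    cases k with
    | zero => simp [qb, b2]
    | succ k =>
      simp only [qb, b2]
      split_ifs with h
      · have : (k + 1) / 2 = ((k + 1) / 2 - 1) + 1 := by omega
        rw [this]; simp
      · rfl
  | succ n ih =>
    intro k
    cases k with
    | zero => simp [qb, b2]
    | succ k =>
      rw [qb_succ, ih, ih]
      simp only [b2]
      obtain ⟨i, rfl | rfl⟩ := Nat.even_or_odd' n <;> obtain ⟨j, rfl | rfl⟩ := Nat.even_or_odd' k
      · rw [if_pos (by omega), if_neg (by omega), if_pos (by omega)]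
        rw [show (2 * i + 1) / 2 = i by omega, show (2 * j + 1) / 2 = j by omega]; simp
      · rw [if_neg (by omega), if_pos (by omega), if_pos (by omega)]
        rw [show (2 * i + 1) / 2 = i by omega, show (2 * j + 1 + 1) / 2 = j + 1 by omega, show 2 * i / 2 = i by omega,
          show 2 * j + 1 + 1 = 2 * (j + 1) by ring, pow_mul]; simp
      · rw [if_pos (by omega), if_pos (by omega), if_neg (by omega)]
        rw [show (2 * i + 1) / 2 = i by omega, show (2 * j + 1) / 2 = j by omega, show 2 * j / 2 = j by omega, pow_succ, pow_mul]; simp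
      · rw [if_pos (by omega), if_pos (by omega), if_pos (by omega)]
        rw [show (2 * i + 1) / 2 = i by omega, show (2 * i + 1 + 1) / 2 = i + 1 by omega, show (2 * j + 1) / 2 = j by omega, show (2 * j + 1 + 1) / 2 = j + 1 by omega,
          show 2 * j + 1 + 1 = 2 * (j + 1) by ring, pow_mul, Nat.choose_succ_succ]; simp

variable {q : ℕ}

theorem PP_qb {q : ℕ} {a : ℕ} : ∀ {G : Finset ℕ} (hG : G ⊆ Finset.Ico 1 q) {a0 m : ℕ} (hB : Blk q G a0 m) (h0 : 0 < a) (hm : a < m),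
    PP (Polynomial ℤ) Polynomial.X q G (insert (a0 + a) G) = qb Polynomial.X m a := by
  induction a with
  | zero => intro G hG a0 m hB h0; omega
  | succ a ih =>
    intro G hG a0 m hB h0 hm
    obtain ⟨m, rfl⟩ : ∃ m', m = m' + 1 := ⟨m - 1, by omega⟩
    set t : Polynomial ℤ := Polynomial.X with ht
    have hne : (1 - t ^ (a + 1)) ≠ 0 := by
      intro h
      have := congrArg (Polynomial.eval 2) h
      simp [ht] at this
      have h3 : (1:ℤ) < 2 ^ (a + 1) := one_lt_pow₀ (by norm_num) (by omega)
      omega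
    refine mul_right_cancel₀ hne ?_
    rw [qb_abs]
    have hq := hB.1
    have hgs : ∀ n, (∑ j ∈ Finset.range n, t ^ j) * (1 - t) = 1 - t ^ n := fun n => by
      have := geom_sum_mul t n
      linear_combination -this
    have hm' := PP_cyc t hG hB (by omega)
    rcases Nat.eq_zero_or_pos a with rfl | ha
    · rw [hm', qb_zero, pow_one, mul_one]
      simpa using hgs (m + 1)
    · have hi1 : insert (a0 + 1) G ⊆ Finset.Ico 1 q := Finset.insert_subset (Finset.mem_Ico.2 ⟨by omega, by omega⟩) hG
      have hi2 : insert (a0 + (a + 1)) G ⊆ Finset.Ico 1 q := Finset.insert_subset (Finset.mem_Ico.2 ⟨by omega, by omega⟩) hG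
      have hi3 : insert (a0 + 1) (insert (a0 + (a + 1)) G) ⊆ Finset.Ico 1 q := Finset.insert_subset (Finset.mem_Ico.2 ⟨by omega, by omega⟩) hi2
      have e1 := PP_mul t (Finset.subset_insert (a0 + 1) G) (Finset.insert_subset_insert (a0 + 1) (Finset.subset_insert (a0 + (a + 1)) G)) hi3
      have e2 := PP_mul t (Finset.subset_insert (a0 + (a + 1)) G) (Finset.subset_insert (a0 + 1) _) hi3
      have hB1 : Blk q (insert (a0 + (a + 1)) G) a0 (a + 1) := by
        obtain ⟨b1, b2, b3, b4⟩ := hB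
        refine ⟨by omega, b2.imp id fun h => Finset.mem_insert_of_mem h, Or.inr (Finset.mem_insert_self _ _), ?_⟩
        intro g hg
        rcases Finset.mem_insert.1 hg with rfl | hg
        · right; omega
        · rcases b4 g hg with h | h <;> omega
      have hB2 : Blk q (insert (a0 + 1) G) (a0 + 1) m := by
        obtain ⟨b1, b2, b3, b4⟩ := hB
        refine ⟨by omega, Or.inr (Finset.mem_insert_self _ _), ?_, ?_⟩
        · rcases b3 with h | h
          · left; omega
          · right; rw [show a0 + 1 + m = a0 + (m + 1) by omega]; exact Finset.mem_insert_of_mem h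
        intro g hg
        rcases Finset.mem_insert.1 hg with rfl | hg
        · left; omega
        · rcases b4 g hg with h | h <;> omega
      have e3 := PP_cyc t hi2 hB1 (by omega)
      have e4 := ih hi1 hB2 ha (by omega)
      rw [Finset.insert_comm, show a0 + (a + 1) = a0 + 1 + a by omega] at e1
      rw [hm', e4] at e1
      rw [Finset.insert_comm, show a0 + (a + 1) = a0 + 1 + a by omega, e1] at e2
      rw [show a0 + (a + 1) = a0 + 1 + a by omega] at e3 ⊢
      rw [Finset.insert_comm] at e3
      rw [e3] at e2
      linear_combination (-(1 - t)) * e2 + (-PP (Polynomial ℤ) t q G (insert (a0 + 1 + a) G)) * hgs (a + 1) + qb t m a * hgs (m + 1)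

theorem PP_map {R S : Type} [CommRing R] [CommRing S] (f : R →+* S) (t : R) (G G' : Finset ℕ) : f (PP R t q G G') = PP S (f t) q G G' := by
  simp [PP, map_sum, map_pow]

theorem qb_map {R S : Type} [CommRing R] [CommRing S] (f : R →+* S) (t : R) : ∀ n k, f (qb t n k) = qb (f t) n k := by
  intro n
  induction n with
  | zero => intro k; cases k <;> simp [qb]
  | succ n ih => intro k; cases k <;> simp [qb, ih]

theorem PP_b2 {F : Type} [Field F] {G : Finset ℕ} (hG : G ⊆ Finset.Ico 1 q) {a0 m a : ℕ} (hB : Blk q G a0 m) (h0 : 0 < a) (hm : a < m) :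
    PP F (-1) q G (insert (a0 + a) G) = b2 F m a := by
  have h := congrArg (Polynomial.eval₂RingHom (Int.castRingHom F) (-1 : F)) (PP_qb hG hB h0 hm)
  rw [PP_map, qb_map] at h
  simp only [Polynomial.coe_eval₂RingHom, Polynomial.eval₂_X] at h
  rw [h, qb_neg]

end P5b

section P5c
set_option linter.unusedVariables false
set_option linter.unusedSimpArgs false

variable {F : Type} [Field F] {q : ℕ}

theorem contr_id2 {M : Type*} [AddCommGroup M] [Module F M] (G0 G1 : Finset ℕ) (T : Finset ℕ → M) (g : ℕ) (hg : g ∉ G0) :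
    T G1 - (if g ∈ G1 then 0 else sgF F g (G1 \ G0) •
        ∑ h ∈ insert g G1 \ G0, sgF F h (insert g G1 \ G0) • T ((insert g G1).erase h))
      - ∑ h ∈ G1 \ G0, sgF F h (G1 \ G0) • (sgF F g (G1.erase h \ G0) • (if g ∈ G1.erase h then 0 else T (insert g (G1.erase h)))) = 0 := by
  by_cases hg1 : g ∈ G1
  · rw [if_pos hg1, Finset.sum_eq_single g]
    · rw [if_neg (by simp), Finset.insert_erase hg1, erase_sdiff_er, sgF_erase_gt le_rfl, smul_smul, sgF_sq]; simp
    · intro h hh hne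
      rw [if_pos (by simp [hg1, Ne.symm hne])]; simp
    · intro h; exact absurd (Finset.mem_sdiff.2 ⟨hg1, hg⟩) h
  · rw [if_neg hg1]
    have e1 : insert g G1 \ G0 = insert g (G1 \ G0) := Finset.insert_sdiff_of_notMem _ hg
    have hgn : g ∉ G1 \ G0 := by simp [hg1]
    rw [e1, Finset.sum_insert hgn, sgF_insert_gt le_rfl, Finset.erase_insert hg1, smul_add, smul_smul, sgF_sq, one_smul, Finset.smul_sum]
    have e2 : ∀ h ∈ G1 \ G0, sgF F g (G1 \ G0) • (sgF F h (insert g (G1 \ G0)) • T ((insert g G1).erase h)) =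
        - (sgF F h (G1 \ G0) • (sgF F g (G1.erase h \ G0) • (if g ∈ G1.erase h then 0 else T (insert g (G1.erase h))))) := by
      intro h hh
      have hne : g ≠ h := fun e => hgn (e ▸ hh)
      rw [if_neg (by simp [hg1]), erase_sdiff_er, Finset.erase_insert_of_ne hne, smul_smul, smul_smul, ← neg_smul]
      congr 1
      rcases lt_or_gt_of_ne hne with hl | hl
      · rw [sgF_insert_lt hgn hl, sgF_erase_gt hl.le]; ring
      · rw [sgF_insert_gt hl.le, sgF_erase_lt hh hl]; ring
    rw [Finset.sum_congr rfl e2, Finset.sum_neg_distrib]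
    simp

open Classical in
/-- ascents -/
noncomputable def asc (w : Equiv.Perm (Fin q)) : Finset ℕ :=
  (Finset.Ico 1 q).filter fun g => ∃ (h : g < q), w ⟨g - 1, by omega⟩ < w ⟨g, h⟩

theorem asc_sub (w : Equiv.Perm (Fin q)) : asc w ⊆ Finset.Ico 1 q := Finset.filter_subset _ _

theorem mem_asc {w : Equiv.Perm (Fin q)} {g : ℕ} (h1 : 1 ≤ g) (hq : g < q) :
    g ∈ asc w ↔ w ⟨g - 1, by omega⟩ < w ⟨g, hq⟩ := by
  simp only [asc, Finset.mem_filter, Finset.mem_Ico]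
  exact ⟨fun h => h.2.2, fun h => ⟨⟨h1, hq⟩, hq, h⟩⟩

theorem Inc_insert {w : Equiv.Perm (Fin q)} {g : ℕ} {G : Finset ℕ} (hg : g ∈ asc w) (h : Inc (insert g G) w) : Inc G w := by
  have hg' := Finset.mem_Ico.1 (asc_sub w hg)
  rw [mem_asc hg'.1 hg'.2] at hg
  intro i j hij hb
  rw [Fin.lt_def] at hij
  by_cases hc : i.1 < g ∧ g ≤ j.1
  · have h1 : w i ≤ w ⟨g - 1, by omega⟩ := by
      rcases eq_or_ne i ⟨g - 1, by omega⟩ with e | e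
      · rw [← e]
      · have e' : i.1 ≠ g - 1 := fun e2 => e (Fin.ext e2)
        refine (h i _ (Fin.lt_def.2 (show i.1 < g - 1 by omega)) ?_).le
        refine blk_eq_of fun x hx => ?_
        rcases Finset.mem_insert.1 hx with rfl | hx
        · dsimp only; omega
        · have := lt_iff_of_blk_eq hx hb
          dsimp only; omega
    have h2 : w ⟨g, hg'.2⟩ ≤ w j := by
      rcases eq_or_ne j ⟨g, hg'.2⟩ with e | e
      · rw [← e]
      · have e' : j.1 ≠ g := fun e2 => e (Fin.ext e2)
        refine (h _ j (Fin.lt_def.2 (show g < j.1 by omega)) ?_).le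
        refine blk_eq_of fun x hx => ?_
        rcases Finset.mem_insert.1 hx with rfl | hx
        · dsimp only; omega
        · have := lt_iff_of_blk_eq hx hb
          dsimp only; omega
    exact h1.trans_lt (hg.trans_le h2)
  · refine h i j hij (blk_eq_of fun x hx => ?_)
    rcases Finset.mem_insert.1 hx with rfl | hx
    · omega
    · exact lt_iff_of_blk_eq hx hb

theorem asc_of_Inc {w : Equiv.Perm (Fin q)} {G : Finset ℕ} (h : Inc G w) {g : ℕ} (hg : g ∈ Finset.Ico 1 q) (hG : g ∉ G) : g ∈ asc w := by
  have hg' := Finset.mem_Ico.1 hg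
  rw [mem_asc hg'.1 hg'.2]
  refine h _ _ (Fin.lt_def.2 (show g - 1 < g by omega)) (blk_eq_of fun x hx => ?_)
  have : x ≠ g := fun e => hG (e ▸ hx)
  dsimp only; omega

/-- decreasing on blocks -/
theorem dec_of {w : Equiv.Perm (Fin q)} {G : Finset ℕ} (h : asc w ⊆ G) {i : Fin q} :
    ∀ n (hn : i.1 + (n + 1) < q), blk G i = blk G (i.1 + (n + 1)) → w ⟨i.1 + (n + 1), hn⟩ < w i := by
  intro n
  have step : ∀ g (h1 : 1 ≤ g) (hq : g < q), g ∉ G → w ⟨g, hq⟩ < w ⟨g - 1, by omega⟩ := by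
    intro g h1 hq hg
    by_contra hc
    refine hg (h ((mem_asc h1 hq).2 (lt_of_le_of_ne (not_lt.1 hc) fun e => ?_)))
    have := congrArg Fin.val (w.injective e)
    dsimp only at this; omega
  induction n with
  | zero =>
    intro hn hb
    refine step (i.1 + 1) (by omega) hn fun hg => ?_
    have := lt_iff_of_blk_eq hg hb; omega
  | succ n ih =>
    intro hn hb
    have hb' : blk G i = blk G (i.1 + (n + 1)) :=
      le_antisymm (blk_mono G (by omega)) (hb ▸ blk_mono G (by omega))
    refine lt_trans (step (i.1 + (n + 1 + 1)) (by omega) hn fun hg => ?_) (ih (by omega) hb')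
    have := lt_iff_of_blk_eq hg hb; omega

theorem invS_inj {v w : Equiv.Perm (Fin q)} (h : invS v = invS w) : v = w := by
  have : v * w⁻¹ = 1 := by
    refine perm_eq_one _ fun a b hab => ?_
    simp only [Equiv.Perm.mul_apply]
    have hne : w⁻¹ a ≠ w⁻¹ b := fun e => hab.ne (w⁻¹.injective e)
    rcases lt_or_gt_of_ne hne with hl | hl
    · have h1 : (w⁻¹ a, w⁻¹ b) ∉ invS w := by rw [mem_invS, p_ai, p_ai]; exact fun hh => absurd hab (not_lt.2 hh.2.le)
      rw [← h, mem_invS] at h1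
      exact lt_of_le_of_ne (not_lt.1 fun hc => h1 ⟨hl, hc⟩) fun e => hne (v.injective e)
    · have h1 : (w⁻¹ b, w⁻¹ a) ∈ invS w := by rw [mem_invS, p_ai, p_ai]; exact ⟨hl, hab⟩
      rw [← h, mem_invS] at h1
      exact h1.2
  exact mul_inv_eq_one.1 this

theorem inv_dec {v w : Equiv.Perm (Fin q)} {G : Finset ℕ} (h : asc w ⊆ G) (hv : Wp G v) : invS v ⊆ invS w := by
  rintro ⟨i, j⟩ hij
  rw [mem_invS] at hij ⊢
  refine ⟨hij.1, ?_⟩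
  have hb : blk G i = blk G j := by
    refine le_antisymm (blk_mono G hij.1.le) (not_lt.1 fun hl => ?_)
    exact absurd (hv.lt hl) (not_lt.2 hij.2.le)
  obtain ⟨n, hn⟩ : ∃ n, j.1 = i.1 + (n + 1) := ⟨j.1 - i.1 - 1, by have := Fin.lt_def.1 hij.1; omega⟩
  have := dec_of h (i := i) n (hn ▸ j.2) (hn ▸ hb)
  convert this using 2
  exact Fin.ext hn

theorem ninv_dec {v w : Equiv.Perm (Fin q)} {G : Finset ℕ} (h : asc w ⊆ G) (hv : Wp G v) (hne : v ≠ w) : ninv v < ninv w := by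
  refine Finset.card_lt_card ⟨inv_dec h hv, fun h' => hne (invS_inj (le_antisymm (inv_dec h hv) h'))⟩

theorem exists_dec (G : Finset ℕ) : ∃ w : Equiv.Perm (Fin q), Wp G w ∧ asc w ⊆ G := by
  let key : Fin q → ℕ ×ₗ ℕ := fun i => toLex (blk G i, q - i.1)
  have kinj : Function.Injective key := by
    intro i j hij
    have h2 : q - i.1 = q - j.1 := congrArg (fun x => (ofLex x).2) hij
    exact Fin.ext (by omega)
  let w := Tuple.sort key
  have hs : StrictMono (key ∘ w) := (Tuple.monotone_sort key).strictMono_of_injective (kinj.comp w.injective)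
  have hlt : ∀ i j : Fin q, i < j → blk G (w i) < blk G (w j) ∨ blk G (w i) = blk G (w j) ∧ w j < w i := by
    intro i j hij
    have h2 := hs hij
    simp only [key, Function.comp, Prod.Lex.toLex_lt_toLex] at h2
    rcases h2 with h2 | ⟨h2, h3⟩
    · exact Or.inl h2
    · exact Or.inr ⟨h2, Fin.lt_def.2 (by omega)⟩
  have hW : Wp G w := by
    let f : Fin q → ℕ := fun i => blk G i
    have h1 : Monotone (f ∘ w) := by
      intro i j hij
      rcases hij.lt_or_eq with h | h
      · rcases hlt i j h with h | h
        · exact h.le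
        · exact h.1.le
      · rw [h]
    have h2 : Monotone (f ∘ (1 : Equiv.Perm (Fin q))) := fun i j hij => blk_mono G hij
    have h3 := (Tuple.comp_sort_eq_comp_iff_monotone.2 h1).trans (Tuple.comp_sort_eq_comp_iff_monotone.2 h2).symm
    exact fun i => congrFun h3 i
  refine ⟨w, hW, fun g hg => ?_⟩
  have hg' := Finset.mem_Ico.1 (asc_sub w hg)
  rw [mem_asc hg'.1 hg'.2] at hg
  by_contra hG
  rcases hlt ⟨g - 1, by omega⟩ ⟨g, hg'.2⟩ (Fin.lt_def.2 (show g - 1 < g by omega)) with h | h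
  · rw [hW, hW] at h
    refine absurd h (not_lt.2 (le_of_eq (blk_eq_of fun x hx => ?_)))
    have : x ≠ g := fun e => hG (e ▸ hx)
    dsimp only; omega
  · exact absurd hg (not_lt.2 h.2.le)

/-- the Salvetti complex -/
noncomputable def dSal (F : Type) [Field F] (q : ℕ) : (Finset ℕ →₀ F) →ₗ[F] (Finset ℕ →₀ F) :=
  lext F fun G => ∑ g ∈ Finset.Ico 1 q \ G, (sgF F g (Finset.Ico 1 q \ G) * PP F (-1) q G (insert g G)) • bs F (insert g G)

theorem dSal_bs (G : Finset ℕ) : dSal F q (bs F G) =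
    ∑ g ∈ Finset.Ico 1 q \ G, (sgF F g (Finset.Ico 1 q \ G) * PP F (-1) q G (insert g G)) • bs F (insert g G) := lext_bs _ _

def okA (q : ℕ) : Set (Finset ℕ) := {G | G ⊆ Finset.Ico 1 q}

noncomputable def fSal (F : Type) [Field F] (q : ℕ) : (Finset ℕ →₀ F) →ₗ[F] (IK q →₀ F) :=
  lext F fun G => ∑ w ∈ Dps q G (Finset.Ico 1 q), (-1 : F) ^ ninv w • bs F (G, Finset.Ico 1 q, w)

theorem fSal_bs (G : Finset ℕ) : fSal F q (bs F G) =
    ∑ w ∈ Dps q G (Finset.Ico 1 q), (-1 : F) ^ ninv w • bs F (G, Finset.Ico 1 q, w) := lext_bs _ _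

theorem okA_ins {G : Finset ℕ} (hG : G ∈ okA q) {g : ℕ} (hg : g ∈ Finset.Ico 1 q \ G) : insert g G ∈ okA q :=
  Finset.insert_subset (Finset.mem_sdiff.1 hg).1 hG

theorem dSal_mem (G : Finset ℕ) (hG : G ∈ okA q) : dSal F q (bs F G) ∈ spn F (okA q) := by
  rw [dSal_bs]
  exact Submodule.sum_mem _ fun g hg => Submodule.smul_mem _ _ (bs_mem (okA_ins hG hg))

theorem fSal_mem (G : Finset ℕ) (hG : G ∈ okA q) : fSal F q (bs F G) ∈ spn F (okK q) := by
  rw [fSal_bs]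
  exact Submodule.sum_mem _ fun w hw => Submodule.smul_mem _ _ (bs_mem ⟨hG, subset_rfl, mem_Dps.1 hw⟩)

theorem PP_two {g : ℕ} (hg : g ∈ Finset.Ico 1 q) : PP F (-1) q ((Finset.Ico 1 q).erase g) (Finset.Ico 1 q) = 0 := by
  have hg' := Finset.mem_Ico.1 hg
  have hB : Blk q ((Finset.Ico 1 q).erase g) (g - 1) 2 := by
    refine ⟨by omega, ?_, ?_, ?_⟩
    · simp only [Finset.mem_erase, Finset.mem_Ico]; omega
    · simp only [Finset.mem_erase, Finset.mem_Ico]; omega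
    · simp only [Finset.mem_erase, Finset.mem_Ico]; intro x; omega
  have := PP_b2 (F := F) (Finset.erase_subset _ _) hB (show 0 < 1 by omega) (by omega)
  rw [show g - 1 + 1 = g by omega, Finset.insert_erase hg] at this
  rw [this]
  simp [b2]

theorem fSal_d (G : Finset ℕ) (hG : G ∈ okA q) : fSal F q (dSal F q (bs F G)) = dK F q (fSal F q (bs F G)) := by
  rw [fSal_bs, dSal_bs, map_sum, map_sum]
  simp only [map_smul, dK_bs, Finset.smul_sum]
  rw [Finset.sum_comm]
  refine Finset.sum_congr rfl fun g hg => ?_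
  have hg' := Finset.mem_sdiff.1 hg
  simp only [smul_sub, Finset.sum_sub_distrib]
  rw [sum_Dp (G := insert g G) (Finset.subset_insert _ _) (okA_ins hG hg) subset_rfl,
    sum_Dp (G := (Finset.Ico 1 q).erase g) (Finset.subset_erase.2 ⟨hG, hg'.2⟩) (Finset.erase_subset _ _) subset_rfl (fun w => _ • _ • bs F (G, (Finset.Ico 1 q).erase g, _))]
  have e1 : ∀ d ∈ Dps q G (insert g G), ∀ u ∈ Dps q (insert g G) (Finset.Ico 1 q),
      (-1 : F) ^ ninv (d * u) • sgF F g (Finset.Ico 1 q \ G) • bs F (insert g G, Finset.Ico 1 q, lab (insert g G) (Finset.Ico 1 q) (pj (bpt (Finset.Ico 1 q) (d * u))))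
      = (sgF F g (Finset.Ico 1 q \ G) * (-1 : F) ^ ninv d) • ((-1 : F) ^ ninv u • bs F (insert g G, Finset.Ico 1 q, u)) := by
    intro d hd u hu
    rw [mem_Dps] at hd hu
    rw [(lab_fac_eq (Finset.subset_insert _ _) (okA_ins hG hg) subset_rfl hd hu).2, ninv_mul hd hu, smul_smul, smul_smul, pow_add]
    congr 1; ring
  have e2 : ∀ d ∈ Dps q G ((Finset.Ico 1 q).erase g), ∀ u ∈ Dps q ((Finset.Ico 1 q).erase g) (Finset.Ico 1 q),
      (-1 : F) ^ ninv (d * u) • sgF F g (Finset.Ico 1 q \ G) • bs F (G, (Finset.Ico 1 q).erase g, lab G ((Finset.Ico 1 q).erase g) (pj (bpt (Finset.Ico 1 q) (d * u))))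
      = ((-1 : F) ^ ninv u) • ((sgF F g (Finset.Ico 1 q \ G) * (-1 : F) ^ ninv d) • bs F (G, (Finset.Ico 1 q).erase g, d)) := by
    intro d hd u hu
    rw [mem_Dps] at hd hu
    rw [(lab_fac_eq (Finset.subset_erase.2 ⟨hG, hg'.2⟩) (Finset.erase_subset _ _) subset_rfl hd hu).1, ninv_mul hd hu, smul_smul, smul_smul, pow_add]
    congr 1; ring
  rw [Finset.sum_congr rfl fun d hd => Finset.sum_congr rfl fun u hu => e1 d hd u hu,
    Finset.sum_congr rfl fun d hd => Finset.sum_congr rfl fun u hu => e2 d hd u hu]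
  have e3 : ∀ x : IK q →₀ F, ∑ u ∈ Dps q ((Finset.Ico 1 q).erase g) (Finset.Ico 1 q), ((-1 : F) ^ ninv u) • x = 0 := by
    intro x
    rw [← Finset.sum_smul]
    have := PP_two (F := F) hg'.1
    unfold PP at this
    rw [this, zero_smul]
  simp only [e3, Finset.sum_const_zero, sub_zero, ← Finset.smul_sum]
  rw [← Finset.sum_smul, fSal_bs, ← Finset.mul_sum]
  rfl

end P5c

section P5d
set_option linter.unusedVariables false
set_option linter.unusedSimpArgs false

variable {F : Type} [Field F] {q : ℕ}

noncomputable def rSal (F : Type) [Field F] (q : ℕ) : (IK q →₀ F) →ₗ[F] (Finset ℕ →₀ F) := by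
  classical
  exact lext F fun i => if i.2.2 = 1 then bs F i.1 else 0

theorem rSal_bs (G0 G1 : Finset ℕ) (w : Equiv.Perm (Fin q)) [Decidable (w = 1)] : rSal F q (bs F (G0, G1, w)) = if w = 1 then bs F G0 else 0 := by
  rw [rSal, lext_bs]; dsimp only; congr

theorem rSal_f (G : Finset ℕ) : rSal F q (fSal F q (bs F G)) = bs F G := by
  classical
  rw [fSal_bs, map_sum]
  simp only [map_smul, rSal_bs]
  rw [Finset.sum_eq_single 1]
  · rw [if_pos rfl, ninv_one]; simp
  · intro w _ hw; rw [if_neg hw, smul_zero]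
  · intro h; exact absurd (mem_Dps.2 (Dp_one _ _)) h

theorem dSal_dSal (G : Finset ℕ) (hG : G ∈ okA q) : dSal F q (dSal F q (bs F G)) = 0 := by
  have hr : ∀ x ∈ spn F (okA q), rSal F q (fSal F q x) = x :=
    eq_span_image _ (okA q) ((rSal F q).comp (fSal F q)) LinearMap.id (fun G _ => rSal_f G)
  have hd : ∀ x ∈ spn F (okA q), dSal F q x ∈ spn F (okA q) := spn_map _ _ dSal_mem
  have hf : ∀ x ∈ spn F (okA q), fSal F q (dSal F q x) = dK F q (fSal F q x) :=
    eq_span_image _ (okA q) ((fSal F q).comp (dSal F q)) ((dK F q).comp (fSal F q)) fSal_d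
  have h1 := bs_mem (F := F) hG
  have hdd : ∀ x ∈ spn F (okK q), dK F q (dK F q x) = 0 :=
    eq_span_image _ (okK q) ((dK F q).comp (dK F q)) 0 (fun i hi => dK_dK i hi)
  rw [← hr _ (hd _ (hd _ h1)), hf _ (hd _ h1), hf _ h1, hdd _ (fSal_mem G hG), map_zero]

noncomputable def hSb (F : Type) [Field F] (q : ℕ) : (IK q →₀ F) →ₗ[F] (IK q →₀ F) := by
  classical
  exact lext F fun i => if (asc i.2.2 \ i.1).Nonempty ∧ mnS (asc i.2.2 \ i.1) ∉ i.2.1 then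
    - (sgF F (mnS (asc i.2.2 \ i.1)) (i.2.1 \ i.1)) • bs F (i.1, insert (mnS (asc i.2.2 \ i.1)) i.2.1, i.2.2) else 0

theorem hSb_bs (G0 G1 : Finset ℕ) (w : Equiv.Perm (Fin q)) [Decidable ((asc w \ G0).Nonempty ∧ mnS (asc w \ G0) ∉ G1)] :
    hSb F q (bs F (G0, G1, w)) = if (asc w \ G0).Nonempty ∧ mnS (asc w \ G0) ∉ G1 then
    - (sgF F (mnS (asc w \ G0)) (G1 \ G0)) • bs F (G0, insert (mnS (asc w \ G0)) G1, w) else 0 := by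
  rw [hSb, lext_bs]; dsimp only; congr

noncomputable def hSa (F : Type) [Field F] (q : ℕ) : (IK q →₀ F) →ₗ[F] (Finset ℕ →₀ F) := by
  classical
  exact lext F fun i => if i.2.1 = Finset.Ico 1 q ∧ asc i.2.2 ⊆ i.1 then (-1 : F) ^ ninv i.2.2 • bs F i.1 else 0

theorem hSa_bs (G0 G1 : Finset ℕ) (w : Equiv.Perm (Fin q)) [Decidable (G1 = Finset.Ico 1 q ∧ asc w ⊆ G0)] :
    hSa F q (bs F (G0, G1, w)) = if G1 = Finset.Ico 1 q ∧ asc w ⊆ G0 then (-1 : F) ^ ninv w • bs F G0 else 0 := by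
  rw [hSa, lext_bs]; dsimp only; congr

def rkA (q : ℕ) (G : Finset ℕ) : ℕ := (q - G.card) * (q * q + 1)
def rkB (q : ℕ) (i : IK q) : ℕ := rkA q i.1 + ninv i.2.2

theorem rkA_ins {G : Finset ℕ} {g : ℕ} (hG : insert g G ⊆ Finset.Ico 1 q) (hg : g ∉ G) : rkA q (insert g G) + q * q < rkA q G := by
  have h := card_le_q hG
  rw [Finset.card_insert_of_notMem hg] at h
  unfold rkA
  rw [Finset.card_insert_of_notMem hg]
  obtain ⟨k, hk⟩ : ∃ k, q - G.card = k + 1 := ⟨q - G.card - 1, by omega⟩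
  rw [show q - (G.card + 1) = k by omega, hk]
  nlinarith

noncomputable def LwS (F : Type) [Field F] (q r : ℕ) : Submodule F (IK q →₀ F) := spn F {j | j ∈ okK q ∧ rkB q j < r}

theorem hSb_Lw (r : ℕ) : ∀ x ∈ LwS F q r, hSb F q x ∈ LwS F q r := by
  classical
  refine spn_map _ _ ?_
  rintro ⟨G0, G1, w⟩ ⟨hi, hr⟩
  rw [hSb_bs]
  split_ifs with h
  · refine Submodule.smul_mem _ _ (bs_mem ⟨?_, hr⟩)
    have hm := Finset.mem_sdiff.1 (mnS_mem h.1)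
    exact ⟨hi.1.trans (Finset.subset_insert _ _), Finset.insert_subset (asc_sub w hm.1) hi.2.1, hi.2.2.1, hi.2.2.2.sub (Finset.subset_insert _ _)⟩
  · exact zero_mem _

theorem hSb_mem (i : IK q) (hi : i ∈ okK q) : hSb F q (bs F i) ∈ spn F (okK q) := by
  have := hSb_Lw (F := F) (rkB q i + 1) (bs F i) (bs_mem ⟨hi, Nat.lt_succ_self _⟩)
  exact Submodule.span_mono (Set.image_mono fun j hj => hj.1) this

noncomputable def TS (F : Type) [Field F] (G0 : Finset ℕ) (w : Equiv.Perm (Fin q)) (G : Finset ℕ) : IK q →₀ F := by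
  classical
  exact if Inc G w then bs F (G0, G, w) else 0

theorem TS_eq (G0 : Finset ℕ) (w : Equiv.Perm (Fin q)) (G : Finset ℕ) [Decidable (Inc G w)] : TS F G0 w G = if Inc G w then bs F (G0, G, w) else 0 := by
  unfold TS; congr

theorem dK_Lw {G0 G1 : Finset ℕ} {w : Equiv.Perm (Fin q)} (hi : (G0, G1, w) ∈ okK q) :
    dK F q (bs F (G0, G1, w)) + ∑ h ∈ G1 \ G0, sgF F h (G1 \ G0) • TS F G0 w (G1.erase h) ∈ LwS F q (rkB q (G0, G1, w)) := by
  classical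
  rw [dK_bs, ← Finset.sum_add_distrib]
  refine Submodule.sum_mem _ fun g hg => ?_
  rw [← smul_add]
  refine Submodule.smul_mem _ _ ?_
  rw [sub_add_eq_add_sub, add_sub_assoc]
  have hg' := Finset.mem_sdiff.1 hg
  refine add_mem (bs_mem ⟨okK_raise hi hg, ?_⟩) ?_
  · have hr := okK_raise hi hg
    have h1 := rkA_ins (hr.1.trans hr.2.1) hg'.2
    have h2 := ninv_le (lab (insert g G0) G1 (pj (bpt G1 w)))
    unfold rkB
    dsimp only
    omega
  · have hs : G0 ⊆ G1.erase g := Finset.subset_erase.2 ⟨hi.1, hg'.2⟩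
    obtain ⟨a, b, c⟩ := lab_fac hs (Finset.erase_subset _ _) hi
    have hl := okK_lower hi hg
    rw [TS_eq]
    split_ifs with hI
    · have := (Dp.unique a b (d' := w) (u' := 1) ⟨hi.2.2.1, hI⟩ (Dp_one _ _) (by rw [c, mul_one])).1
      rw [this, sub_self]; exact zero_mem _
    · rw [zero_sub]
      refine neg_mem (bs_mem ⟨hl, ?_⟩)
      have h1 := ninv_mul a b
      rw [c] at h1
      have h2 : ninv (lab (G1.erase g) G1 (pj (bpt G1 w))) ≠ 0 := by
        intro h0
        have h3 := ninv_eq_zero h0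
        rw [h3, mul_one] at c
        rw [c] at a
        exact hI a.2
      unfold rkB
      dsimp only
      omega

theorem hSb_TS {G0 : Finset ℕ} {w : Equiv.Perm (Fin q)} (hA : (asc w \ G0).Nonempty) (G : Finset ℕ) :
    hSb F q (TS F G0 w G) = - (sgF F (mnS (asc w \ G0)) (G \ G0) • if mnS (asc w \ G0) ∈ G then 0 else TS F G0 w (insert (mnS (asc w \ G0)) G)) := by
  classical
  have hm := Finset.mem_sdiff.1 (mnS_mem hA)
  rw [TS_eq, TS_eq]
  by_cases hI : Inc G w
  · rw [if_pos hI, hSb_bs, if_pos (hI.sub (Finset.subset_insert _ _))]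
    by_cases hmG : mnS (asc w \ G0) ∈ G
    · rw [if_neg (by simp [hmG]), if_pos hmG]; simp
    · rw [if_pos ⟨hA, hmG⟩, if_neg hmG]; simp
  · rw [if_neg hI, if_neg fun h => hI (Inc_insert hm.1 h)]; simp

theorem S_NBB (i : IK q) (hi : i ∈ okK q) : bs F i - fSal F q (hSa F q (bs F i)) - dK F q (hSb F q (bs F i)) - hSb F q (dK F q (bs F i)) ∈
    LwS F q (rkB q i) := by
  classical
  obtain ⟨G0, G1, w⟩ := i
  have hd := dK_Lw (F := F) hi
  have hd' := hSb_Lw _ _ hd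
  rw [map_add, map_sum] at hd'
  simp only [map_smul] at hd'
  have hT1 : TS F G0 w G1 = bs F (G0, G1, w) := by rw [TS_eq, if_pos hi.2.2.2]
  by_cases hA : (asc w \ G0).Nonempty
  · have hn : ¬ asc w ⊆ G0 := fun h => by rw [Finset.sdiff_eq_empty_iff_subset.2 h] at hA; simp at hA
    have hm := Finset.mem_sdiff.1 (mnS_mem hA)
    rw [hSa_bs, if_neg fun h => hn h.2, map_zero, sub_zero]
    have hc := contr_id2 (F := F) G0 G1 (TS F G0 w) _ hm.2
    simp only [hSb_TS hA] at hd'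
    set g := mnS (asc w \ G0) with hgdef
    by_cases hg1 : g ∈ G1
    · rw [hSb_bs, if_neg (by rw [← hgdef]; simp [hg1]), map_zero, sub_zero]
      rw [if_pos hg1, sub_zero, hT1] at hc
      have := neg_mem hd'
      refine (Submodule.add_mem_iff_left _ (zero_mem _)).1 ?_
      rw [← hc]
      convert (sub_mem (zero_mem _) hd') using 1
      simp only [smul_neg, Finset.sum_neg_distrib]
      rw [sub_eq_zero.1 hc]
      abel
    · rw [hSb_bs, ← hgdef, if_pos ⟨hA, hg1⟩, map_smul]
      rw [if_neg hg1, hT1] at hc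
      have hi' : (G0, insert g G1, w) ∈ okK q :=
        ⟨hi.1.trans (Finset.subset_insert _ _), Finset.insert_subset (asc_sub w hm.1) hi.2.1, hi.2.2.1, hi.2.2.2.sub (Finset.subset_insert _ _)⟩
      have h3 := dK_Lw (F := F) hi'
      have h4 : rkB q (G0, insert g G1, w) = rkB q (G0, G1, w) := rfl
      rw [h4] at h3
      have h5 := sub_mem (Submodule.smul_mem _ (sgF F g (G1 \ G0)) h3) hd'
      simp only [smul_neg, Finset.sum_neg_distrib, smul_add] at h5
      rw [neg_smul]
      generalize (sgF F g (G1 \ G0) • dK F q (bs F (G0, insert g G1, w))) = x1 at h5 ⊢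
      generalize hSb F q (dK F q (bs F (G0, G1, w))) = x2 at h5 ⊢
      have h6 := sub_eq_zero.1 hc
      rw [← h6] at h5
      generalize bs F (G0, G1, w) = x3 at h5 ⊢
      generalize sgF F g (G1 \ G0) • ∑ h ∈ insert g G1 \ G0, sgF F h (insert g G1 \ G0) • TS F G0 w ((insert g G1).erase h) = x4 at h5
      have h7 : x3 - -x1 - x2 = x1 + x4 - (x2 + -(x3 - x4)) := by abel
      rw [h7]
      exact h5
  · have hn : asc w ⊆ G0 := Finset.sdiff_eq_empty_iff_subset.1 (Finset.not_nonempty_iff_eq_empty.1 hA)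
    have hfull : G1 = Finset.Ico 1 q := by
      refine le_antisymm hi.2.1 fun g hg => ?_
      by_contra hgG
      exact hgG (hi.1 (hn (asc_of_Inc hi.2.2.2 hg hgG)))
    subst hfull
    rw [hSb_bs, if_neg fun h => hA h.1, map_zero, sub_zero, hSa_bs, if_pos ⟨rfl, hn⟩, map_smul, fSal_bs]
    refine sub_mem ?_ ?_
    · rw [← Finset.add_sum_erase _ _ (mem_Dps.2 hi.2.2), smul_add, smul_smul, ← mul_pow]
      simp only [mul_neg, mul_one, neg_neg, one_pow, one_smul]
      rw [sub_add_cancel_left]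
      refine neg_mem (Submodule.smul_mem _ _ (Submodule.sum_mem _ fun v hv => Submodule.smul_mem _ _ (bs_mem ⟨⟨hi.1, subset_rfl, mem_Dps.1 (Finset.mem_erase.1 hv).2⟩, ?_⟩)))
      have := ninv_dec hn (mem_Dps.1 (Finset.mem_erase.1 hv).2).1 (Finset.mem_erase.1 hv).1
      unfold rkB
      dsimp only
      omega
    · have h0 : ∀ G, hSb F q (TS F G0 w G) = 0 := by
        intro G
        rw [TS_eq]
        split_ifs
        · rw [hSb_bs, if_neg fun h => hA h.1]
        · simp
      simpa [h0] using hd'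

theorem sal_equiv : Nonempty (HH (dSal F q) (spn F (okA q)) ≃ₗ[F] HH (dK F q) (spn F (okK q))) := by
  classical
  refine cone_equiv (fun i => bs F i) (okA q) (rkA q) (fun i => bs F i) (okK q) (rkB q) (dSal F q) (dK F q)
    (fSal F q) 0 0 (hSa F q) (hSb F q) dSal_mem dK_mem fSal_mem ?_ ?_ ?_ hSb_mem dSal_dSal dK_dK fSal_d ?_ ?_ ?_ S_NBB
  · intro i _; simp
  · intro i _; simp
  · rintro ⟨G0, G1, w⟩ hi
    rw [hSa_bs]
    split_ifs
    · exact Submodule.smul_mem _ _ (bs_mem (hi.1.trans hi.2.1))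
    · exact zero_mem _
  · intro G hG
    simp only [LinearMap.zero_apply, map_zero, add_zero]
    obtain ⟨w, hw, ha⟩ := exists_dec (q := q) G
    rw [fSal_bs, map_sum]
    simp only [map_smul, hSa_bs]
    rw [Finset.sum_eq_single w]
    · rw [if_pos ⟨by trivial, ha⟩, smul_smul, ← mul_pow]
      simp
    · intro v hv hne
      rw [if_neg, smul_zero]
      rintro ⟨_, h⟩
      have h1 := ninv_dec ha (mem_Dps.1 hv).1 hne
      have h2 := ninv_dec h hw hne.symm
      omega
    · intro h; exact absurd (mem_Dps.2 ⟨hw, Inc_full w⟩) h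
  · intro G hG
    simp only [LinearMap.zero_apply, map_zero, add_zero, sub_zero, zero_add]
    rw [fSal_bs, map_sum]
    refine Submodule.sum_mem _ fun w hw => ?_
    rw [map_smul, hSb_bs, if_neg, smul_zero]
    · exact zero_mem _
    · rintro ⟨h1, h2⟩
      exact h2 (asc_sub w (Finset.mem_sdiff.1 (mnS_mem h1)).1)
  · rintro ⟨G0, G1, w⟩ hi
    refine sub_mem ?_ ?_
    · rw [hSa_bs]
      split_ifs
      · rw [map_smul, dSal_bs]
        refine Submodule.smul_mem _ _ (Submodule.sum_mem _ fun g hg => Submodule.smul_mem _ _ (bs_mem ⟨okA_ins (hi.1.trans hi.2.1) hg, ?_⟩))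
        have := rkA_ins (G := G0) (okA_ins (hi.1.trans hi.2.1) hg) (Finset.mem_sdiff.1 hg).2
        unfold rkB
        dsimp only
        omega
      · simp
    · rw [dK_bs, map_sum]
      refine Submodule.sum_mem _ fun g hg => ?_
      have hg' := Finset.mem_sdiff.1 hg
      rw [map_smul, map_sub]
      refine Submodule.smul_mem _ _ (sub_mem ?_ ?_)
      · rw [hSa_bs]
        split_ifs
        · have hr := okK_raise hi hg
          refine Submodule.smul_mem _ _ (bs_mem ⟨hr.1.trans hr.2.1, ?_⟩)
          have := rkA_ins (hr.1.trans hr.2.1) hg'.2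
          unfold rkB
          dsimp only
          omega
        · exact zero_mem _
      · rw [hSa_bs, if_neg]
        · exact zero_mem _
        · rintro ⟨h, _⟩
          have := hi.2.1 hg'.1
          rw [← h] at this
          simp at this

end P5d

section P5e
set_option linter.unusedVariables false
set_option linter.unusedSimpArgs false

variable {F : Type} [Field F] {q : ℕ}

/-- partial sums -/
def gp : ℕ → List ℕ → Finset ℕ
  | _, [] => ∅
  | o, m :: l => insert (o + m) (gp (o + m) l)

theorem gp_nil (o : ℕ) : gp o [] = ∅ := rfl
theorem gp_cons (o m : ℕ) (l : List ℕ) : gp o (m :: l) = insert (o + m) (gp (o + m) l) := rfl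

theorem gp_bd {l : List ℕ} : ∀ {o : ℕ}, (∀ m ∈ l, 0 < m) → ∀ g ∈ gp o l, o < g ∧ g ≤ o + l.sum := by
  induction l with
  | nil => intro o _ g hg; simp [gp_nil] at hg
  | cons m l ih =>
    intro o hl g hg
    have hm := hl m (by simp)
    rw [List.sum_cons]
    rw [gp_cons, Finset.mem_insert] at hg
    rcases hg with rfl | hg
    · omega
    · have := ih (fun x hx => hl x (by simp [hx])) g hg
      omega

theorem gp_last {l : List ℕ} : ∀ {o : ℕ}, l ≠ [] → o + l.sum ∈ gp o l := by
  induction l with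
  | nil => intro o h; exact absurd rfl h
  | cons m l ih =>
    intro o _
    rw [List.sum_cons, gp_cons]
    cases l with
    | nil => simp
    | cons m' l => rw [← add_assoc]; exact Finset.mem_insert_of_mem (ih (by simp))

theorem gp_inj {l : List ℕ} : ∀ {o : ℕ} {l' : List ℕ}, (∀ m ∈ l, 0 < m) → (∀ m ∈ l', 0 < m) → gp o l = gp o l' → l = l' := by
  induction l with
  | nil =>
    intro o l' _ _ h
    cases l' with
    | nil => rfl
    | cons m l => rw [gp_nil, gp_cons] at h; exact absurd h.symm (Finset.insert_ne_empty _ _)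
  | cons m l ih =>
    intro o l' hl hl' h
    cases l' with
    | nil => rw [gp_nil, gp_cons] at h; exact absurd h (Finset.insert_ne_empty _ _)
    | cons m' l' =>
      have p1 := fun x hx => hl x (List.mem_cons_of_mem m hx)
      have p2 := fun x hx => hl' x (List.mem_cons_of_mem m' hx)
      rw [gp_cons, gp_cons] at h
      have h1 : o + m ∈ insert (o + m') (gp (o + m') l') := h ▸ Finset.mem_insert_self _ _
      have h2 : o + m' ∈ insert (o + m) (gp (o + m) l) := h.symm ▸ Finset.mem_insert_self _ _
      have e : m = m' := by
        rcases Finset.mem_insert.1 h1 with h1 | h1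
        · omega
        · rcases Finset.mem_insert.1 h2 with h2 | h2
          · omega
          · have := gp_bd p2 _ h1
            have := gp_bd p1 _ h2
            omega
      subst e
      have n1 : o + m ∉ gp (o + m) l := fun h => by have := gp_bd p1 _ h; omega
      have n2 : o + m ∉ gp (o + m) l' := fun h => by have := gp_bd p2 _ h; omega
      have : gp (o + m) l = gp (o + m) l' := by
        rw [← Finset.erase_insert n1, h, Finset.erase_insert n2]
      rw [ih p1 p2 this]

theorem gp_surj (n : ℕ) : ∀ (o : ℕ) (G : Finset ℕ), G ⊆ Finset.Ioc o (o + n) → (0 < n → o + n ∈ G) →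
    ∃ l : List ℕ, (∀ m ∈ l, 0 < m) ∧ l.sum = n ∧ gp o l = G := by
  induction n using Nat.strong_induction_on with
  | _ n ih =>
    intro o G hG hn
    rcases Nat.eq_zero_or_pos n with rfl | h0
    · refine ⟨[], by simp, rfl, ?_⟩
      rw [gp_nil]
      exact (by simpa using hG : G = ∅).symm
    · have hx := mnS_mem ⟨_, hn h0⟩
      have hxl := Finset.mem_Ioc.1 (hG hx)
      have hmin : ∀ y ∈ G, mnS G ≤ y := fun y hy => mnS_le hy
      set x := mnS G
      obtain ⟨l, h1, h2, h3⟩ := ih (n - (x - o)) (by omega) x (G.erase x) (by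
        intro y hy
        rw [Finset.mem_erase] at hy
        have h5 := hmin y hy.2
        have h6 := Finset.mem_Ioc.1 (hG hy.2)
        rw [Finset.mem_Ioc]
        have := hy.1
        omega) (by
        intro hp
        rw [Finset.mem_erase, show x + (n - (x - o)) = o + n by omega]
        exact ⟨by omega, hn h0⟩)
      refine ⟨(x - o) :: l, ?_, ?_, ?_⟩
      · intro m hm
        rcases List.mem_cons.1 hm with rfl | hm
        · omega
        · exact h1 m hm
      · rw [List.sum_cons, h2]; omega
      · rw [gp_cons, show o + (x - o) = x by omega, h3, Finset.insert_erase hx]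

noncomputable def Psi (F : Type) [Field F] (C : Finset ℕ) (o : ℕ) : (List ℕ →₀ F) →ₗ[F] (Finset ℕ →₀ F) :=
  lext F fun l => bs F (C ∪ gp o l)

theorem Psi_wd (C : Finset ℕ) (o : ℕ) (l : List ℕ) : Psi F C o (wd F l) = bs F (C ∪ gp o l) := lext_wd _ _

theorem gp_un (C : Finset ℕ) (o m : ℕ) (l : List ℕ) : C ∪ gp o (m :: l) = insert (o + m) C ∪ gp (o + m) l := by
  rw [gp_cons, Finset.union_insert, Finset.insert_union]

theorem Psi_cons (C : Finset ℕ) (o m : ℕ) (x : List ℕ →₀ F) : Psi F C o (consL m x) = Psi F (insert (o + m) C) (o + m) x := by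
  have : (Psi F C o).comp (consL m) = Psi F (insert (o + m) C) (o + m) := by
    apply wd_ext
    intro l
    rw [LinearMap.comp_apply, consL_wd, Psi_wd, Psi_wd, gp_un]
  exact LinearMap.congr_fun this x

theorem Psi_d (β : ℕ → ℕ → F) (κ : Finset ℕ → ℕ → F) (q : ℕ)
    (hκ : ∀ (G : Finset ℕ) (a0 m a : ℕ), G ⊆ Finset.Icc 1 q → 0 < a → a < m → (a0 = 0 ∨ a0 ∈ G) → a0 + m ∈ G →
      (∀ g ∈ G, g ≤ a0 ∨ a0 + m ≤ g) → κ G (a0 + a) = β m a) (l : List ℕ) : ∀ (C : Finset ℕ) (o : ℕ),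
    (∀ m ∈ l, 0 < m) → C ⊆ Finset.Icc 1 q → (∀ c ∈ C, c ≤ o) → (o = 0 ∨ o ∈ C) → o + l.sum ≤ q →
    Psi F C o (dWL β (wd F l)) = ∑ g ∈ Finset.Ioo o (o + l.sum) \ gp o l,
      ((-1 : F) ^ ((gp o l).filter (· < g)).card * κ (C ∪ gp o l) g) • bs F (insert g (C ∪ gp o l)) := by
  induction l with
  | nil => intro C o _ _ _ _ _; rw [dWL_nil]; simp
  | cons m l ih =>
    intro C o hl hC hCo ho hq
    have hm := hl m (by simp)
    have hl' := fun x hx => hl x (List.mem_cons_of_mem m hx)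
    rw [List.sum_cons] at hq ⊢
    have hbd := gp_bd (o := o + m) hl'
    have hC' : insert (o + m) C ⊆ Finset.Icc 1 q := Finset.insert_subset (Finset.mem_Icc.2 ⟨by omega, by omega⟩) hC
    have hCo' : ∀ c ∈ insert (o + m) C, c ≤ o + m := by
      intro c hc
      rcases Finset.mem_insert.1 hc with rfl | hc
      · omega
      · have := hCo c hc; omega
    have hun : insert (o + m) C ∪ gp (o + m) l ⊆ Finset.Icc 1 q := by
      refine Finset.union_subset hC' fun g hg => ?_
      have := hbd g hg
      exact Finset.mem_Icc.2 ⟨by omega, by omega⟩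
    have hset : Finset.Ioo o (o + (m + l.sum)) \ gp o (m :: l) =
        Finset.Ioo o (o + m) ∪ (Finset.Ioo (o + m) (o + m + l.sum) \ gp (o + m) l) := by
      ext g
      rw [gp_cons]
      simp only [Finset.mem_sdiff, Finset.mem_union, Finset.mem_Ioo, Finset.mem_insert]
      constructor
      · rintro ⟨h1, h2⟩
        by_cases h3 : g < o + m
        · left; omega
        · right
          exact ⟨by omega, fun h => h2 (Or.inr h)⟩
      · rintro (h | ⟨h1, h2⟩)
        · refine ⟨by omega, ?_⟩
          rintro (h1 | h1)
          · omega
          · have := hbd g h1; omega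
        · refine ⟨by omega, ?_⟩
          rintro (h3 | h3)
          · omega
          · exact h2 h3
    have hdisj : Disjoint (Finset.Ioo o (o + m)) (Finset.Ioo (o + m) (o + m + l.sum) \ gp (o + m) l) := by
      rw [Finset.disjoint_left]
      intro g h1 h2
      rw [Finset.mem_sdiff] at h2
      rw [Finset.mem_Ioo] at h1 h2
      omega
    rw [hset, Finset.sum_union hdisj, dWL_cons, map_sub, sub_eq_add_neg]
    rw [Psi_cons, ih _ _ hl' hC' hCo' (Or.inr (Finset.mem_insert_self _ _)) (by omega), map_sum, ← Finset.sum_neg_distrib]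
    congr 1
    · refine Finset.sum_bij (fun a _ => o + a) ?_ ?_ ?_ ?_
      · intro a ha
        rw [Finset.mem_Ioo] at ha ⊢
        omega
      · intro a _ b _ h; omega
      · intro g hg
        rw [Finset.mem_Ioo] at hg
        exact ⟨g - o, Finset.mem_Ioo.2 ⟨by omega, by omega⟩, by omega⟩
      · intro a ha
        rw [Finset.mem_Ioo] at ha
        have e1 : (gp o (m :: l)).filter (· < o + a) = ∅ := by
          rw [Finset.filter_eq_empty_iff]
          intro g hg
          rw [gp_cons, Finset.mem_insert] at hg
          rcases hg with rfl | hg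
          · omega
          · have := hbd g hg; omega
        rw [map_smul, Psi_wd, e1, Finset.card_empty, pow_zero, one_mul]
        rw [gp_un, gp_un, gp_un, show o + a + (m - a) = o + m by omega, Finset.insert_comm, Finset.insert_union (o + a)]
        rw [hκ _ o m a hun ha.1 ha.2 ?_ ?_ ?_]
        · rcases ho with h | h
          · exact Or.inl h
          · exact Or.inr (Finset.mem_union_left _ (Finset.mem_insert_of_mem h))
        · exact Finset.mem_union_left _ (Finset.mem_insert_self _ _)
        · intro g hg
          rcases Finset.mem_union.1 hg with hg | hg
          · rcases Finset.mem_insert.1 hg with rfl | hg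
            · right; omega
            · left; exact hCo g hg
          · have := hbd g hg; right; omega
    · refine Finset.sum_congr rfl fun g hg => ?_
      rw [Finset.mem_sdiff, Finset.mem_Ioo] at hg
      rw [gp_un, gp_cons, Finset.filter_insert, if_pos (by omega), Finset.card_insert_of_notMem, pow_succ, ← neg_smul]
      · congr 1; ring
      · intro h
        have := hbd _ (Finset.mem_filter.1 h).1
        omega

noncomputable def uS (F : Type) [Field F] (G : Finset ℕ) : F := ∏ h ∈ G, (-1) ^ (h - 1)

theorem uS_sq (G : Finset ℕ) : uS F G * uS F G = 1 := by
  unfold uS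
  rw [← Finset.prod_mul_distrib]
  refine Finset.prod_eq_one fun h _ => ?_
  rw [← mul_pow]; simp

theorem sg_full {G : Finset ℕ} {g : ℕ} (hG : G ⊆ Finset.Ico 1 q) (hg : g ∈ Finset.Ico 1 q) :
    sgF F g (Finset.Ico 1 q \ G) = (-1) ^ (G.filter (· < g)).card * (-1) ^ (g - 1) := by
  have h1 : ((Finset.Ico 1 q \ G).filter (· < g)).card + (G.filter (· < g)).card = g - 1 := by
    rw [← Finset.card_union_of_disjoint, ← Nat.card_Ico 1 g]
    · congr 1
      ext x
      rw [Finset.mem_Ico] at hg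
      simp only [Finset.mem_union, Finset.mem_filter, Finset.mem_sdiff, Finset.mem_Ico]
      constructor
      · rintro (h | h)
        · omega
        · have := Finset.mem_Ico.1 (hG h.1); omega
      · intro h
        by_cases hx : x ∈ G
        · right; exact ⟨hx, by omega⟩
        · left; exact ⟨⟨by omega, hx⟩, by omega⟩
    · rw [Finset.disjoint_left]
      intro x h1 h2
      simp only [Finset.mem_filter, Finset.mem_sdiff] at h1 h2
      exact h1.1.2 h2.1
  unfold sgF
  rw [← h1, pow_add, mul_comm, mul_assoc, ← mul_pow]
  simp

noncomputable def Rho (F : Type) [Field F] (q : ℕ) : (Finset ℕ →₀ F) →ₗ[F] (Finset ℕ →₀ F) :=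
  lext F fun G => uS F (G.erase q) • bs F (G.erase q)

theorem Rho_bs (G : Finset ℕ) : Rho F q (bs F G) = uS F (G.erase q) • bs F (G.erase q) := lext_bs _ _

/-- word to set -/
def gq (q : ℕ) (l : List ℕ) : Finset ℕ := (gp 0 l).erase q

theorem gq_mem {l : List ℕ} (hl : l ∈ okW q) : gq q l ∈ okA q := by
  intro g hg
  rw [gq, Finset.mem_erase] at hg
  have := gp_bd hl.1 g hg.2
  have h2 := hl.2
  have h3 := hg.1
  rw [Finset.mem_Ico]; omega

theorem gq_inj {l l' : List ℕ} (hl : l ∈ okW q) (hl' : l' ∈ okW q) (h : gq q l = gq q l') : l = l' := by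
  have key : ∀ {l : List ℕ}, l ∈ okW q → 0 < q → insert q (gq q l) = gp 0 l := by
    intro l hl hq
    have hne : l ≠ [] := by
      rintro rfl
      have := hl.2
      simp at this; omega
    have := gp_last (o := 0) hne
    rw [hl.2, zero_add] at this
    exact Finset.insert_erase this
  rcases Nat.eq_zero_or_pos q with h0 | h0
  · have nl : ∀ {l : List ℕ}, l ∈ okW q → l = [] := by
      intro l hl
      cases l with
      | nil => rfl
      | cons m l =>
        have h1 := hl.1 m (by simp)
        have h2 := hl.2
        rw [List.sum_cons] at h2
        omega
    rw [nl hl, nl hl']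
  · exact gp_inj hl.1 hl'.1 (by rw [← key hl h0, ← key hl' h0, h])

theorem gq_surj {G : Finset ℕ} (hG : G ∈ okA q) : ∃ l ∈ okW q, gq q l = G := by
  rcases Nat.eq_zero_or_pos q with rfl | h0
  · refine ⟨[], ⟨by simp, rfl⟩, ?_⟩
    have : G ⊆ Finset.Ico 1 0 := hG
    simp at this
    rw [this]; simp [gq, gp]
  · obtain ⟨l, h1, h2, h3⟩ := gp_surj q 0 (insert q G) (by
      refine Finset.insert_subset (Finset.mem_Ioc.2 ⟨h0, by omega⟩) fun g hg => ?_
      have := Finset.mem_Ico.1 (hG hg)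
      exact Finset.mem_Ioc.2 ⟨by omega, by omega⟩) (by intro _; simp)
    refine ⟨l, ⟨h1, h2⟩, ?_⟩
    rw [gq, h3, Finset.erase_insert]
    intro h
    have := Finset.mem_Ico.1 (hG h)
    omega

noncomputable def Phi (F : Type) [Field F] (q : ℕ) : (List ℕ →₀ F) →ₗ[F] (Finset ℕ →₀ F) := (Rho F q).comp (Psi F ∅ 0)

theorem Phi_wd (l : List ℕ) : Phi F q (wd F l) = uS F (gq q l) • bs F (gq q l) := by
  rw [Phi, LinearMap.comp_apply, Psi_wd, Rho_bs, Finset.empty_union]; rfl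

theorem Phi_d (l : List ℕ) (hl : l ∈ okW q) : Phi F q (dWL (b2 F) (wd F l)) = dSal F q (Phi F q (wd F l)) := by
  have hG := gq_mem hl
  rw [Phi_wd, Phi, LinearMap.comp_apply]
  rw [Psi_d (b2 F) (fun G g => PP F (-1) q (G.erase q) (insert g (G.erase q))) q ?_ l ∅ 0 hl.1 (by simp) (by simp) (Or.inl rfl) (by rw [hl.2]; omega)]
  · rw [map_sum, map_smul, dSal_bs, Finset.smul_sum, Finset.empty_union, hl.2, zero_add]
    have hset : Finset.Ioo 0 q \ gp 0 l = Finset.Ico 1 q \ gq q l := by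
      ext g
      simp only [gq, Finset.mem_sdiff, Finset.mem_Ioo, Finset.mem_Ico, Finset.mem_erase]
      constructor
      · rintro ⟨h1, h2⟩; exact ⟨by omega, fun h => h2 h.2⟩
      · rintro ⟨h1, h2⟩; exact ⟨by omega, fun h => h2 ⟨by omega, h⟩⟩
    rw [hset]
    refine Finset.sum_congr rfl fun g hg => ?_
    have hg' := Finset.mem_sdiff.1 hg
    have hgq := Finset.mem_Ico.1 hg'.1
    have e1 : (gp 0 l).filter (· < g) = (gq q l).filter (· < g) := by
      ext x
      simp only [gq, Finset.mem_filter, Finset.mem_erase]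
      constructor
      · rintro ⟨h1, h2⟩; exact ⟨⟨by omega, h1⟩, h2⟩
      · rintro ⟨h1, h2⟩; exact ⟨h1.2, h2⟩
    have e2 : (insert g (gp 0 l)).erase q = insert g (gq q l) := by
      rw [Finset.erase_insert_of_ne (by omega)]; rfl
    have e3 : uS F (insert g (gq q l)) = (-1) ^ (g - 1) * uS F (gq q l) := Finset.prod_insert hg'.2
    rw [map_smul, Rho_bs, e1, e2, e3, smul_smul, smul_smul, sg_full hG hg'.1]
    congr 1
    change _ * PP F (-1) q (gq q l) (insert g (gq q l)) * _ = _
    ring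
  · intro G a0 m a hGq ha ham h0 hm hb
    have hmq := Finset.mem_Icc.1 (hGq hm)
    refine PP_b2 ?_ ⟨hmq.2, ?_, ?_, ?_⟩ ha ham
    · intro x hx
      rw [Finset.mem_erase] at hx
      have := Finset.mem_Icc.1 (hGq hx.2)
      have := hx.1
      exact Finset.mem_Ico.2 ⟨by omega, by omega⟩
    · rcases h0 with h | h
      · exact Or.inl h
      · exact Or.inr (Finset.mem_erase.2 ⟨by omega, h⟩)
    · by_cases h : a0 + m = q
      · exact Or.inl h
      · exact Or.inr (Finset.mem_erase.2 ⟨h, hm⟩)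
    · intro g hg
      exact hb g (Finset.mem_erase.1 hg).2

theorem word_equiv : Nonempty (HH (dWL (b2 F)) (spW F (okW q)) ≃ₗ[F] HH (dSal F q) (spn F (okA q))) := by
  classical
  have hs : ∀ G : Finset ℕ, ∃ l : List ℕ, G ∈ okA q → l ∈ okW q ∧ gq q l = G := by
    intro G
    by_cases hG : G ∈ okA q
    · obtain ⟨l, h1, h2⟩ := gq_surj hG
      exact ⟨l, fun _ => ⟨h1, h2⟩⟩
    · exact ⟨[], fun h => absurd h hG⟩
  choose s hs using hs
  let g : (Finset ℕ →₀ F) →ₗ[F] (List ℕ →₀ F) := lext F fun G => uS F G • wd F (s G)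
  have eg : ∀ G, g (bs F G) = uS F G • wd F (s G) := fun G => lext_bs _ _
  have hgs : ∀ l ∈ okW q, s (gq q l) = l := fun l hl =>
    gq_inj (hs _ (gq_mem hl)).1 hl (hs _ (gq_mem hl)).2
  refine hh_iso (dWL (b2 F)) (spW F (okW q)) (dSal F q) (spn F (okA q)) (Phi F q) g ?_ ?_ ?_ ?_ ?_ ?_
  · refine map_span_image _ _ _ _ fun l hl => ?_
    rw [Phi_wd]
    exact Submodule.smul_mem _ _ (bs_mem (gq_mem hl))
  · refine map_span_image _ _ _ _ fun G hG => ?_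
    rw [eg]
    exact Submodule.smul_mem _ _ (Submodule.subset_span ⟨_, (hs G hG).1, rfl⟩)
  · refine eq_span_image _ (okW q) (g.comp (Phi F q)) LinearMap.id fun l hl => ?_
    rw [LinearMap.comp_apply, Phi_wd, map_smul, eg, smul_smul, uS_sq, one_smul, hgs l hl]; rfl
  · refine eq_span_image _ (okA q) ((Phi F q).comp g) LinearMap.id fun G hG => ?_
    rw [LinearMap.comp_apply, eg, map_smul, Phi_wd, (hs G hG).2, smul_smul, uS_sq, one_smul]; rfl
  · exact map_span_image _ _ _ _ fun l hl => dWL_mem (b2 F) q l hl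
  · exact eq_span_image _ (okW q) ((Phi F q).comp (dWL (b2 F))) ((dSal F q).comp (Phi F q)) fun l hl => Phi_d l hl

theorem dDim_eq (p : ℕ) [Fact p.Prime] (q : ℕ) : dDim p q = XW (b2 (ZMod p)) q := by
  obtain ⟨e1⟩ := chart_equiv (F := ZMod p) (q := q)
  obtain ⟨e2⟩ := comb_equiv (F := ZMod p) (q := q)
  obtain ⟨e3⟩ := sal_equiv (F := ZMod p) (q := q)
  obtain ⟨e4⟩ := word_equiv (F := ZMod p) (q := q)
  rw [dDim, bridge, XW, ← e1.finrank_eq, e2.finrank_eq, ← e3.finrank_eq, e4.finrank_eq]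

end P5e

theorem statement1 (p : ℕ) (hp : p.Prime) (q : ℕ) :
    dDim p (p * q) = ∑ i ∈ Finset.range (q + 1), dDim p i := by
  have := Fact.mk hp
  simp only [dDim_eq]
  exact numerics p q
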